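/- Let K be a number field with r₁ real places (r₁ > 0) and r₂ complex places. Let S₂ ⊆ Sel₂(K) be the subgroup of classes z·Kˣ² such that z = α′β² for some β ∈ Kˣ and some α′ ∈ Kˣ having valuation 0 at every prime of O_K above 2 whose image in O_{K,2}ˣ lies in (1 + 4O_{K,2})·O_{K,2}ˣ² (i.e., z is, up to a square in Kˣ, a unit above 2 that is congruent to a square modulo 4). Then dim_{F₂} S₂ = ρ⁺. Moreover, the subgroup of S₂ of classes that in addition admit a totally positive representative has F₂-dimension ρ, where ρ = rk₂(C_K) and ρ⁺ = rk₂(C_K⁺). -/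

import Mathlib

open NumberField FractionalIdeal
open scoped nonZeroDivisors TensorProduct

variable (K : Type*) [Field K] [NumberField K]

/-- The group of singular elements of `K`: those `z ∈ Kˣ` whose principal fractional ideal
is the square of a fractional ideal. -/
noncomputable def singularSubgroup : Subgroup Kˣ where
  carrier := {z : Kˣ | ∃ a : FractionalIdeal (𝓞 K)⁰ K,
    spanSingleton (𝓞 K)⁰ (z : K) = a ^ 2}
  one_mem' := ⟨1, by simp⟩
  mul_mem' := by
    rintro x y ⟨a, ha⟩ ⟨b, hb⟩
    exact ⟨a * b, by rw [Units.val_mul, ← spanSingleton_mul_spanSingleton, ha, hb, mul_pow]⟩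
  inv_mem' := by
    rintro x ⟨a, ha⟩
    refine ⟨a⁻¹, ?_⟩
    rw [Units.val_inv_eq_inv_val, ← spanSingleton_inv, ha, inv_pow]

/-- The subgroup `Kˣ²` of squares in `Kˣ`. -/
def squaresSubgroup : Subgroup Kˣ := (powMonoidHom 2 : Kˣ →* Kˣ).range

/-- The subgroup `P_K⁺` of the group of invertible fractional ideals consisting of principal
fractional ideals generated by a totally positive element. -/
noncomputable def totPosPrincipalSubgroup : Subgroup (FractionalIdeal (𝓞 K)⁰ K)ˣ where
  carrier := {I | ∃ x : Kˣ, (∀ φ : K →+* ℝ, 0 < φ (x : K)) ∧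
    (I : FractionalIdeal (𝓞 K)⁰ K) = spanSingleton (𝓞 K)⁰ (x : K)}
  one_mem' := ⟨1, fun φ => by simp, by simp⟩
  mul_mem' := by
    rintro I J ⟨x, hx, hI⟩ ⟨y, hy, hJ⟩
    refine ⟨x * y, fun φ => ?_, ?_⟩
    · rw [Units.val_mul, _root_.map_mul]; exact mul_pos (hx φ) (hy φ)
    · rw [Units.val_mul, hI, hJ, spanSingleton_mul_spanSingleton, Units.val_mul]
  inv_mem' := by
    rintro I ⟨x, hx, hI⟩
    refine ⟨x⁻¹, fun φ => ?_, ?_⟩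
    · rw [Units.val_inv_eq_inv_val, map_inv₀]; exact inv_pos.mpr (hx φ)
    · rw [Units.val_inv_eq_inv_val, hI, spanSingleton_inv, Units.val_inv_eq_inv_val]

/-- The narrow (strict) class group `C_K⁺ = I_K/P_K⁺` of the number field `K`. -/
noncomputable abbrev NarrowClassGroup :=
  (FractionalIdeal (𝓞 K)⁰ K)ˣ ⧸ totPosPrincipalSubgroup K

/-- `O_{K,2} = O_K ⊗_ℤ ℤ₂`. -/
def OK2 : Type _ := 𝓞 K ⊗[ℤ] ℤ_[2]

noncomputable instance : CommRing (OK2 K) := inferInstanceAs (CommRing (𝓞 K ⊗[ℤ] ℤ_[2]))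

/-- The canonical ring homomorphism `O_K → O_{K,2} = O_K ⊗_ℤ ℤ₂`. -/
noncomputable def iota : 𝓞 K →+* OK2 K := Algebra.TensorProduct.includeLeftRingHom

attribute [irreducible] OK2

/-- The subgroup `(1 + 4·O_{K,2})·O_{K,2}ˣ²` of `O_{K,2}ˣ`: units congruent to a square
modulo `4`. -/
def modFourSquares : Subgroup (OK2 K)ˣ where
  carrier := {w : (OK2 K)ˣ | ∃ (a : OK2 K) (y : (OK2 K)ˣ),
    (w : OK2 K) = (1 + 4 * a) * (y : OK2 K) ^ 2}
  one_mem' := ⟨0, 1, by rw [Units.val_one]; ring⟩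
  mul_mem' := by
    rintro w₁ w₂ ⟨a₁, y₁, h₁⟩ ⟨a₂, y₂, h₂⟩
    refine ⟨a₁ + a₂ + 4 * (a₁ * a₂), y₁ * y₂, ?_⟩
    rw [Units.val_mul, Units.val_mul, h₁, h₂]
    ring
  inv_mem' := by
    rintro w ⟨a, y, h⟩
    have hww : (w : OK2 K) * ((w⁻¹ : (OK2 K)ˣ) : OK2 K) = 1 := w.mul_inv
    have hyy : (y : OK2 K) * ((y⁻¹ : (OK2 K)ˣ) : OK2 K) = 1 := y.mul_inv
    set e : OK2 K := ((w⁻¹ : (OK2 K)ˣ) : OK2 K) * (y : OK2 K) ^ 2 with he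
    have h1 : (1 + 4 * a) * e = 1 := by
      calc (1 + 4 * a) * e
          = ((1 + 4 * a) * (y : OK2 K) ^ 2) * ((w⁻¹ : (OK2 K)ˣ) : OK2 K) := by
            rw [he]; ring
        _ = (w : OK2 K) * ((w⁻¹ : (OK2 K)ˣ) : OK2 K) := by rw [← h]
        _ = 1 := hww
    have h2 : (1 : OK2 K) + 4 * (-(a * e)) = e := by linear_combination -h1
    refine ⟨-(a * e), y⁻¹, ?_⟩
    rw [h2, he]
    calc ((w⁻¹ : (OK2 K)ˣ) : OK2 K)
        = ((w⁻¹ : (OK2 K)ˣ) : OK2 K) *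
            ((y : OK2 K) * ((y⁻¹ : (OK2 K)ˣ) : OK2 K)) ^ 2 := by rw [hyy]; ring
      _ = ((w⁻¹ : (OK2 K)ˣ) : OK2 K) * (y : OK2 K) ^ 2 *
            ((y⁻¹ : (OK2 K)ˣ) : OK2 K) ^ 2 := by ring

/-- The subgroup of `Kˣ` of elements that, up to a square in `Kˣ`, are units above `2`
congruent to a square modulo `4`: elements `z = α′β²` where `α′ = s/t` has valuation `0` at
every prime above `2` and the image of `α′` in `O_{K,2}ˣ` lies in
`(1 + 4·O_{K,2})·O_{K,2}ˣ²`. -/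
noncomputable def adicSquareClass : Subgroup Kˣ where
  carrier := {z : Kˣ | ∃ (β : Kˣ) (s t : 𝓞 K) (u v : (OK2 K)ˣ),
    (u : OK2 K) = iota K s ∧ (v : OK2 K) = iota K t ∧
    (z : K) = (algebraMap (𝓞 K) K s / algebraMap (𝓞 K) K t) * (β : K) ^ 2 ∧
    u * v⁻¹ ∈ modFourSquares K}
  one_mem' := by
    refine ⟨1, 1, 1, 1, 1, ?_, ?_, ?_, ?_⟩
    · rw [Units.val_one, _root_.map_one]
    · rw [Units.val_one, _root_.map_one]
    · simp
    · rw [inv_one, mul_one]; exact (modFourSquares K).one_mem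
  mul_mem' := by
    rintro z₁ z₂ ⟨β₁, s₁, t₁, u₁, v₁, hu₁, hv₁, hz₁, hd₁⟩
      ⟨β₂, s₂, t₂, u₂, v₂, hu₂, hv₂, hz₂, hd₂⟩
    refine ⟨β₁ * β₂, s₁ * s₂, t₁ * t₂, u₁ * u₂, v₁ * v₂, ?_, ?_, ?_, ?_⟩
    · rw [Units.val_mul, _root_.map_mul, hu₁, hu₂]
    · rw [Units.val_mul, _root_.map_mul, hv₁, hv₂]
    · simp only [Units.val_mul, hz₁, hz₂, _root_.map_mul]
      ring
    · have hrw : u₁ * u₂ * (v₁ * v₂)⁻¹ = (u₁ * v₁⁻¹) * (u₂ * v₂⁻¹) := by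
        rw [mul_inv, mul_mul_mul_comm]
      rw [hrw]
      exact mul_mem hd₁ hd₂
  inv_mem' := by
    rintro z ⟨β, s, t, u, v, hu, hv, hz, hd⟩
    refine ⟨β⁻¹, t, s, v, u, hv, hu, ?_, ?_⟩
    · simp only [Units.val_inv_eq_inv_val, hz]
      rw [mul_inv, inv_div, inv_pow]
    · have hrw : v * u⁻¹ = (u * v⁻¹)⁻¹ := by rw [mul_inv, inv_inv, mul_comm]
      rw [hrw]
      exact inv_mem hd

/-- The subgroup of `Kˣ` of elements admitting a totally positive representative modulo
squares. -/
def posModSquares : Subgroup Kˣ where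
  carrier := {z : Kˣ | ∃ x : Kˣ, ∀ φ : K →+* ℝ, 0 < φ ((z * x ^ 2 : Kˣ) : K)}
  one_mem' := ⟨1, fun φ => by simp⟩
  mul_mem' := by
    rintro z₁ z₂ ⟨x₁, h₁⟩ ⟨x₂, h₂⟩
    refine ⟨x₁ * x₂, fun φ => ?_⟩
    have hrw : (z₁ * z₂ * (x₁ * x₂) ^ 2 : Kˣ) = (z₁ * x₁ ^ 2) * (z₂ * x₂ ^ 2) := by
      rw [mul_pow]; exact mul_mul_mul_comm _ _ _ _
    rw [hrw, Units.val_mul, _root_.map_mul]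
    exact mul_pos (h₁ φ) (h₂ φ)
  inv_mem' := by
    rintro z ⟨x, hx⟩
    refine ⟨x⁻¹, fun φ => ?_⟩
    have hrw : (z⁻¹ * x⁻¹ ^ 2 : Kˣ) = (z * x ^ 2)⁻¹ := by rw [mul_inv, inv_pow]
    rw [hrw, Units.val_inv_eq_inv_val, map_inv₀]
    exact inv_pos.mpr (hx φ)


section
open Complex Filter Topology

namespace Recip

lemma mul_cpow_ofReal_left' {t : ℝ} (ht : 0 < t) {x : ℂ} (hx : x ≠ 0) (s : ℂ) :
    ((t : ℂ) * x) ^ s = (t : ℂ) ^ s * x ^ s := by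
  have htC : (t : ℂ) ≠ 0 := by exact_mod_cast ht.ne'
  rw [Complex.cpow_def_of_ne_zero (mul_ne_zero htC hx), Complex.cpow_def_of_ne_zero htC,
    Complex.cpow_def_of_ne_zero hx, ← Complex.exp_add, Complex.log_ofReal_mul ht hx,
    ← Complex.ofReal_log ht.le]
  congr 1
  ring

lemma theta_lim (x y : ℝ) :
    Tendsto (fun T : ℝ => jacobiTheta₂ (x : ℂ) (y + I * T)) atTop (𝓝 1) := by
  have key : Tendsto (fun T : ℝ => ∑' n : ℤ, jacobiTheta₂_term n (x : ℂ) (y + I * T)) atTop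
      (𝓝 (∑' n : ℤ, if n = 0 then (1:ℂ) else 0)) := by
    have hnorm : ∀ (n : ℤ) (T : ℝ), ‖jacobiTheta₂_term n (x : ℂ) (y + I * T)‖
        = Real.exp (-Real.pi * n ^ 2 * T) := by
      intro n T
      rw [norm_jacobiTheta₂_term]
      simp
    refine tendsto_tsum_of_dominated_convergence
      (bound := fun n : ℤ => Real.exp (-Real.pi * n ^ 2 * 1)) ?_ ?_ ?_
    · have := (summable_jacobiTheta₂_term_iff (x : ℂ) (y + I * (1:ℝ))).2 (by simp)
      refine this.norm.congr ?_
      intro n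
      rw [hnorm]
    · intro n
      by_cases hn : n = 0
      · subst hn
        simp [jacobiTheta₂_term]
      · simp only [hn, if_false]
        rw [tendsto_zero_iff_norm_tendsto_zero]
        simp_rw [hnorm]
        apply Real.tendsto_exp_atBot.comp
        apply Tendsto.const_mul_atTop_of_neg _ tendsto_id
        have : (0:ℝ) < (n:ℝ) ^ 2 := by positivity
        nlinarith [Real.pi_pos]
    · filter_upwards [eventually_ge_atTop 1] with T hT n
      rw [hnorm]
      apply Real.exp_le_exp.2
      have : (0:ℝ) ≤ (n:ℝ) ^ 2 := by positivity
      have := mul_nonneg Real.pi_pos.le this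
      nlinarith
  simpa [jacobiTheta₂] using key

lemma theta_split (m : ℕ) (hm : 0 < m) (t : ℝ) (ht : 0 < t) :
    jacobiTheta₂ 0 ((1 : ℂ) / (2 * m : ℕ) + I * t) =
      ∑ k : Fin (2 * m), cexp (Real.pi * I * (k : ℕ) ^ 2 / (2 * m : ℕ)) *
        (cexp (- Real.pi * (k : ℕ) ^ 2 * t) *
          jacobiTheta₂ (I * ((k : ℕ) * (2 * m : ℕ) * t)) (I * ((2 * m : ℕ) ^ 2 * t))) := by
  set N : ℕ := 2 * m with hN
  have hN0 : N ≠ 0 := by omega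
  have : NeZero N := ⟨hN0⟩
  have hNC : (N : ℂ) ≠ 0 := by exact_mod_cast hN0
  have hsum := (summable_jacobiTheta₂_term_iff (0 : ℂ) ((1 : ℂ) / N + I * t)).2 (by
    simp [ht])
  unfold jacobiTheta₂
  rw [← (Int.divModEquiv N).symm.tsum_eq]
  have hs' : Summable (fun c => jacobiTheta₂_term ((Int.divModEquiv N).symm c) 0 ((1 : ℂ) / N + I * t)) :=
    (Int.divModEquiv N).symm.summable_iff.2 hsum
  rw [hs'.tsum_prod' (fun b => (hasSum_fintype _).summable)]
  simp_rw [tsum_fintype]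
  have hterm : ∀ (k : Fin N) (q : ℤ),
      jacobiTheta₂_term ((Int.divModEquiv N).symm (q, k)) 0 ((1 : ℂ) / N + I * t) =
      cexp (Real.pi * I * (k : ℕ) ^ 2 / N) * (cexp (- Real.pi * (k : ℕ) ^ 2 * t) *
       jacobiTheta₂_term q (I * ((k : ℕ) * N * t)) (I * ((N : ℂ) ^ 2 * t))) := by
    intro k q
    have h1 : cexp (2 * Real.pi * I * ((m * q ^ 2 + q * (k : ℕ) : ℤ) : ℂ)) = 1 := by
      rw [Complex.exp_eq_one_iff]
      exact ⟨m * q ^ 2 + q * (k : ℕ), by ring⟩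
    simp only [jacobiTheta₂_term, Int.divModEquiv]
    have h2 : ∀ z, cexp z = cexp (2 * Real.pi * I * ((m * q ^ 2 + q * (k : ℕ) : ℤ) : ℂ) + z) := by
      intro z
      rw [Complex.exp_add, h1, one_mul]
    rw [← Complex.exp_add, ← Complex.exp_add, h2 (_ + (_ + _))]
    congr 1
    have hNm : (N : ℂ) = 2 * m := by rw [hN]; push_cast; ring
    have hmC : (m : ℂ) ≠ 0 := by exact_mod_cast hm.ne'
    simp [hNm]
    field_simp
    ring_nf
    simp only [I_sq]
    ring_nf
  have hsk : ∀ k : Fin N, Summable (fun q : ℤ =>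
     cexp (Real.pi * I * (k : ℕ) ^ 2 / N) * (cexp (- Real.pi * (k : ℕ) ^ 2 * t) *
       jacobiTheta₂_term q (I * ((k : ℕ) * N * t)) (I * ((N : ℂ) ^ 2 * t)))) := by
    intro k
    apply Summable.mul_left
    apply Summable.mul_left
    rw [summable_jacobiTheta₂_term_iff]
    have : (I * ((N : ℂ) ^ 2 * t)).im = N ^ 2 * t := by
      rw [show ((N : ℂ) ^ 2 * t) = ((N ^ 2 * t : ℝ) : ℂ) by push_cast; ring]
      simp [-ofReal_mul]
    rw [this]; positivity
  simp_rw [hterm]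
  rw [Summable.tsum_finsetSum (fun k _ => hsk k)]
  simp_rw [tsum_mul_left]

lemma theta_split2 (m : ℕ) (hm : 0 < m) (t : ℝ) (ht : 0 < t) :
    (Real.sqrt t : ℂ) * jacobiTheta₂ 0 ((1 : ℂ) / (2 * m : ℕ) + I * t) =
      ∑ k : Fin (2 * m), cexp (Real.pi * I * (k : ℕ) ^ 2 / (2 * m : ℕ)) *
        ((1 / (2 * m : ℕ)) *
          jacobiTheta₂ ((((k : ℕ) / (2 * m : ℕ) : ℝ)) : ℂ) (((0:ℝ):ℂ) + I * ((1 / ((2 * m : ℕ) ^ 2 * t) : ℝ) : ℂ))) := by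
  rw [theta_split m hm t ht, Finset.mul_sum]
  obtain ⟨N, hN⟩ : ∃ N, N = 2 * m := ⟨_, rfl⟩
  rw [← hN]
  refine Finset.sum_congr rfl fun k _ => ?_
  have hN0 : (N:ℝ) ≠ 0 := by have : N ≠ 0 := by omega
                             exact_mod_cast this
  have hNC : (N : ℂ) ≠ 0 := by exact_mod_cast hN0
  have htC : (t : ℂ) ≠ 0 := by exact_mod_cast ht.ne'
  rw [mul_left_comm]
  congr 1
  rw [jacobiTheta₂_functional_equation]
  have e1 : (-I * (I * ((N : ℂ) ^ 2 * t))) ^ (1 / 2 : ℂ) = N * (Real.sqrt t : ℂ) := by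
    have : (-I * (I * ((N : ℂ) ^ 2 * t))) = ((N ^ 2 * t : ℝ) : ℂ) := by
      push_cast
      rw [← mul_assoc]; simp
    rw [this, show (1 / 2 : ℂ) = ((1/2 : ℝ) : ℂ) by push_cast; ring, ← ofReal_cpow (by positivity),
      ← Real.sqrt_eq_rpow, Real.sqrt_mul (by positivity), Real.sqrt_sq (by positivity)]
    push_cast; rfl
  rw [e1]
  have e2 : I * ((k : ℕ) * (N : ℂ) * t) / (I * ((N : ℂ) ^ 2 * t)) = ((((k : ℕ) / N : ℝ)) : ℂ) := by
    push_cast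
    field_simp
  have e3 : -1 / (I * ((N : ℂ) ^ 2 * t)) = (((0:ℝ):ℂ) + I * ((1 / (N ^ 2 * t) : ℝ) : ℂ)) := by
    push_cast
    field_simp
    simp [I_sq]
  have e4 : cexp (-Real.pi * I * (I * ((k : ℕ) * (N : ℂ) * t)) ^ 2 / (I * ((N : ℂ) ^ 2 * t)))
     = (cexp (- Real.pi * (k : ℕ) ^ 2 * t))⁻¹ := by
    rw [← Complex.exp_neg]
    congr 1
    field_simp
    simp [I_sq]
  rw [e2, e3, e4]
  have hs : (Real.sqrt t : ℂ) ≠ 0 := by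
    exact_mod_cast (Real.sqrt_pos.2 ht).ne'
  have := Complex.exp_ne_zero (- Real.pi * (k : ℕ) ^ 2 * t)
  field_simp

theorem landsberg_schaar (m : ℕ) (hm : 0 < m) :
    ∑ k : Fin (2 * m), cexp (Real.pi * I * (k : ℕ) ^ 2 / (2 * m : ℕ)) =
      Real.sqrt (2 * m : ℕ) * cexp (Real.pi * I / 4) := by
  set N : ℕ := 2 * m with hN
  have hN0 : (N:ℝ) ≠ 0 := by have : N ≠ 0 := by omega
                             exact_mod_cast this
  have hNpos : (0:ℝ) < N := by positivity
  have hNC : (N : ℂ) ≠ 0 := by exact_mod_cast hN0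
  have hT : Tendsto (fun t : ℝ => 1 / ((N:ℝ) ^ 2 * t)) (𝓝[>] 0) atTop := by
    have : Tendsto (fun t : ℝ => ((N:ℝ) ^ 2 * t)⁻¹) (𝓝[>] 0) atTop := by
      apply Tendsto.comp tendsto_inv_nhdsGT_zero
      apply tendsto_nhdsWithin_of_tendsto_nhds_of_eventually_within
      · have : Tendsto (fun t : ℝ => (N:ℝ) ^ 2 * t) (𝓝 0) (𝓝 ((N:ℝ) ^ 2 * 0)) :=
          (continuous_const.mul continuous_id).tendsto _
        rw [mul_zero] at this
        exact this.mono_left nhdsWithin_le_nhds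
      · filter_upwards [self_mem_nhdsWithin] with t ht
        have : (0:ℝ) < t := ht
        show (0:ℝ) < _
        positivity
    simpa using this
  have L1 : Tendsto (fun t : ℝ => (Real.sqrt t : ℂ) * jacobiTheta₂ 0 ((1 : ℂ) / N + I * t))
      (𝓝[>] 0) (𝓝 (∑ k : Fin N, cexp (Real.pi * I * (k : ℕ) ^ 2 / N) * ((1 / N) * 1))) := by
    have : Tendsto (fun t : ℝ => ∑ k : Fin N, cexp (Real.pi * I * (k : ℕ) ^ 2 / N) *
        ((1 / N) * jacobiTheta₂ ((((k : ℕ) / N : ℝ)) : ℂ) (((0:ℝ):ℂ) + I * ((1 / (N ^ 2 * t) : ℝ) : ℂ))))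
        (𝓝[>] 0) (𝓝 (∑ k : Fin N, cexp (Real.pi * I * (k : ℕ) ^ 2 / N) * ((1 / N) * 1))) := by
      apply tendsto_finsetSum
      intro k _
      apply Tendsto.const_mul
      apply Tendsto.const_mul
      exact (theta_lim _ 0).comp hT
    refine this.congr' ?_
    filter_upwards [self_mem_nhdsWithin] with t ht
    exact (theta_split2 m hm t ht).symm
  have L2 : Tendsto (fun t : ℝ => (Real.sqrt t : ℂ) * jacobiTheta₂ 0 ((1 : ℂ) / N + I * t))
      (𝓝[>] 0) (𝓝 ((1 / (-I * ((1 : ℂ) / N)) ^ (1 / 2 : ℂ)) *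
        (1 / ((N : ℂ) ^ 2) ^ (1 / 2 : ℂ)) * 1)) := by
    have hτ : Tendsto (fun t : ℝ => (1 : ℂ) / N + I * t) (𝓝[>] 0) (𝓝 ((1 : ℂ) / N)) := by
      have : Tendsto (fun t : ℝ => (1 : ℂ) / N + I * t) (𝓝 0) (𝓝 ((1 : ℂ) / N + I * (0:ℝ))) := by
        apply Continuous.tendsto
        fun_prop
      simp only [ofReal_zero, mul_zero, add_zero] at this
      exact this.mono_left nhdsWithin_le_nhds
    have hA : Tendsto (fun t : ℝ => (1 / (-I * ((1 : ℂ) / N + I * t)) ^ (1 / 2 : ℂ))) (𝓝[>] 0)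
        (𝓝 (1 / (-I * ((1 : ℂ) / N)) ^ (1 / 2 : ℂ))) := by
      have hsl : (-I * ((1 : ℂ) / N)) ∈ slitPlane := by
        rw [show (-I * ((1 : ℂ) / N)) = ((-(1 / N : ℝ) : ℝ) : ℂ) * I by push_cast; ring]
        right
        simp [-ofReal_neg, hN0]
      apply Tendsto.div tendsto_const_nhds
      · exact (continuousAt_cpow_const hsl).tendsto.comp (hτ.const_mul (-I))
      · rw [Complex.cpow_def_of_ne_zero (slitPlane_ne_zero hsl)]
        exact Complex.exp_ne_zero _
    have hB : Tendsto (fun t : ℝ => (1 / ((N : ℂ) / ((1 : ℂ) / N + I * t)) ^ (1 / 2 : ℂ))) (𝓝[>] 0)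
        (𝓝 (1 / ((N : ℂ) ^ 2) ^ (1 / 2 : ℂ))) := by
      have hsl : ((N : ℂ) ^ 2) ∈ slitPlane := by
        left
        rw [show ((N : ℂ) ^ 2) = (((N:ℝ) ^ 2 : ℝ) : ℂ) by push_cast; ring]
        rw [ofReal_re]; positivity
      apply Tendsto.div tendsto_const_nhds
      · have h2 : Tendsto (fun t : ℝ => (N : ℂ) / ((1 : ℂ) / N + I * t)) (𝓝[>] 0) (𝓝 ((N:ℂ) ^ 2)) := by
          have := (tendsto_const_nhds (x := (N:ℂ))).div hτ (by simpa using hNC)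
          have h3 : (N:ℂ) / (1 / N) = (N:ℂ) ^ 2 := by field_simp
          rw [h3] at this
          exact this
        exact (continuousAt_cpow_const hsl).tendsto.comp h2
      · rw [Complex.cpow_def_of_ne_zero (slitPlane_ne_zero hsl)]
        exact Complex.exp_ne_zero _
    have hC : Tendsto (fun t : ℝ => jacobiTheta₂ ((0:ℝ) : ℂ)
        (((-(1 / N) : ℝ) : ℂ) + I * ((1 / (N ^ 2 * t) : ℝ) : ℂ))) (𝓝[>] 0) (𝓝 1) :=
      (theta_lim 0 _).comp hT
    refine ((hA.mul hB).mul hC).congr' ?_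
    filter_upwards [self_mem_nhdsWithin] with t ht
    have ht : 0 < t := ht
    have htC : (t : ℂ) ≠ 0 := by exact_mod_cast ht.ne'
    set τ : ℂ := (1 : ℂ) / N + I * t with hτd
    have hτ0 : τ ≠ 0 := by
      intro h
      have := congrArg Complex.im h
      simp [hτd] at this
      exact ht.ne' this
    have hstep : jacobiTheta₂ 0 (-1 / τ + ((2 * m : ℕ) : ℂ)) = jacobiTheta₂ 0 (-1 / τ) := by
      have hper : ∀ j : ℕ, jacobiTheta₂ 0 (-1 / τ + ((2 * j : ℕ) : ℂ)) = jacobiTheta₂ 0 (-1 / τ) := by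
        intro j
        induction j with
        | zero => simp
        | succ j ih =>
          rw [← ih, ← jacobiTheta₂_add_right 0 (-1 / τ + ((2 * j : ℕ) : ℂ))]
          congr 1
          push_cast; ring
      exact hper m
    have hw : -1 / τ + ((2 * m : ℕ) : ℂ) = I * (t * (N / τ)) := by
      rw [← hN]
      field_simp
      rw [hτd]
      field_simp
      ring
    rw [jacobiTheta₂_functional_equation 0 τ]
    simp only [zero_div, ne_eq, OfNat.ofNat_ne_zero, not_false_eq_true, zero_pow, mul_zero,
      Complex.exp_zero, mul_one]
    rw [← hstep, hw, jacobiTheta₂_functional_equation 0 (I * (t * (N / τ)))]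
    simp only [zero_div, ne_eq, OfNat.ofNat_ne_zero, not_false_eq_true, zero_pow, mul_zero,
      Complex.exp_zero, mul_one]
    have e1 : (-I * (I * (t * (N / τ)))) ^ (1 / 2 : ℂ) = (Real.sqrt t : ℂ) * (N / τ) ^ (1 / 2 : ℂ) := by
      have : (-I * (I * (t * (N / τ)))) = t * (N / τ) := by
        rw [← mul_assoc]; simp
      rw [this, mul_cpow_ofReal_left' ht (div_ne_zero hNC hτ0)]
      congr 1
      rw [show (1 / 2 : ℂ) = ((1/2 : ℝ) : ℂ) by push_cast; ring, ← ofReal_cpow ht.le, ← Real.sqrt_eq_rpow]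
    have e2 : -1 / (I * (t * (N / τ))) = (((-(1 / N) : ℝ) : ℂ) + I * ((1 / (N ^ 2 * t) : ℝ) : ℂ)) := by
      push_cast
      field_simp
      rw [hτd]
      field_simp
      ring_nf
      simp only [I_sq]
      ring
    rw [e1, e2]
    have hs : (Real.sqrt t : ℂ) ≠ 0 := by
      exact_mod_cast (Real.sqrt_pos.2 ht).ne'
    simp only [ofReal_zero]
    field_simp
  have hEq := tendsto_nhds_unique L1 L2
  rw [← Finset.sum_mul] at hEq
  have e3 : ((N : ℂ) ^ 2) ^ (1 / 2 : ℂ) = N := by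
    rw [show ((N : ℂ) ^ 2) = (((N:ℝ) ^ 2 : ℝ) : ℂ) by push_cast; ring,
      show (1 / 2 : ℂ) = ((1/2 : ℝ) : ℂ) by push_cast; ring, ← ofReal_cpow (by positivity),
      ← Real.sqrt_eq_rpow, Real.sqrt_sq hNpos.le]
    simp
  have e4 : (-I * ((1 : ℂ) / N)) ^ (1 / 2 : ℂ) = ((Real.sqrt N : ℝ) : ℂ)⁻¹ * cexp (-(Real.pi * I / 4)) := by
    have h1 : (-I * ((1 : ℂ) / N)) = (((N:ℝ)⁻¹ : ℝ) : ℂ) * (-I) := by push_cast; ring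
    rw [h1, mul_cpow_ofReal_left' (by positivity) (neg_ne_zero.2 I_ne_zero)]
    congr 1
    · rw [show (1 / 2 : ℂ) = ((1/2 : ℝ) : ℂ) by push_cast; ring, ← ofReal_cpow (by positivity),
        ← Real.sqrt_eq_rpow, Real.sqrt_inv]
      simp
    · rw [Complex.cpow_def_of_ne_zero (by simp), Complex.log_neg_I]
      congr 1
      ring
  rw [e3, e4] at hEq
  have hs : (Real.sqrt N : ℂ) ≠ 0 := by
    exact_mod_cast (Real.sqrt_pos.2 hNpos).ne'
  have h5 := congrArg (fun z => z * (N : ℂ)) hEq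
  simp only [mul_one] at h5
  rw [mul_assoc, one_div_mul_cancel hNC, mul_one] at h5
  rw [h5, Complex.exp_neg]
  field_simp

end Recip

end

section
namespace Recip

section qsums
variable {V : Type*} [AddCommGroup V]

/-- sum of `f` over representatives of `A / B`. -/
noncomputable def qs (A B : AddSubgroup V) (f : V → ℂ) : ℂ :=
  ∑ᶠ q : A ⧸ B.addSubgroupOf A, f (q.out : A)

structure IsReps (A B : AddSubgroup V) {ι : Type*} (s : ι → V) : Prop where
  mem : ∀ i, s i ∈ A
  inj : ∀ i j, s i - s j ∈ B → i = j
  surj : ∀ a ∈ A, ∃ i, a - s i ∈ B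

def Per (A B : AddSubgroup V) (f : V → ℂ) : Prop := ∀ a ∈ A, ∀ b ∈ B, f (a + b) = f a

variable {A B : AddSubgroup V}

lemma IsReps.bij {ι : Type*} {s : ι → V} (h : IsReps A B s) :
    Function.Bijective (fun i => (QuotientAddGroup.mk (⟨s i, h.mem i⟩ : A) : A ⧸ B.addSubgroupOf A)) := by
  constructor
  · intro i j hij
    rw [QuotientAddGroup.eq] at hij
    have : -(s i) + s j ∈ B := by simpa [AddSubgroup.mem_addSubgroupOf] using hij
    symm
    apply h.inj
    rwa [sub_eq_neg_add]
  · intro q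
    obtain ⟨a, rfl⟩ := QuotientAddGroup.mk_surjective q
    obtain ⟨i, hi⟩ := h.surj a a.2
    refine ⟨i, ?_⟩
    rw [QuotientAddGroup.eq]
    have : -(s i) + a ∈ B := by rwa [← sub_eq_neg_add]
    simpa [AddSubgroup.mem_addSubgroupOf] using this

lemma qs_eq_sum {ι : Type*} [Fintype ι] {s : ι → V} (h : IsReps A B s) (f : V → ℂ)
    (hf : Per A B f) : qs A B f = ∑ i, f (s i) := by
  unfold qs
  rw [← finsum_eq_sum_of_fintype]
  symm
  refine finsum_eq_of_bijective _ h.bij ?_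
  intro i
  set q : A ⧸ B.addSubgroupOf A := QuotientAddGroup.mk (⟨s i, h.mem i⟩ : A) with hq
  have h1 : (QuotientAddGroup.mk q.out : A ⧸ B.addSubgroupOf A) = QuotientAddGroup.mk (⟨s i, h.mem i⟩ : A) := by
    rw [← hq]; exact Quotient.out_eq' q
  rw [QuotientAddGroup.eq] at h1
  have h2 : -((q.out : A) : V) + s i ∈ B := by simpa [AddSubgroup.mem_addSubgroupOf] using h1
  have := hf (q.out : A) (q.out : A).2 _ h2
  rw [← this]
  congr 1
  abel

lemma IsReps.finite {ι : Type*} [Finite ι] {s : ι → V} (h : IsReps A B s) : B.relIndex A ≠ 0 := by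
  have := Finite.of_surjective _ h.bij.2
  exact AddSubgroup.index_ne_zero_of_finite

lemma IsReps.card {ι : Type*} [Finite ι] {s : ι → V} (h : IsReps A B s) : B.relIndex A = Nat.card ι := by
  rw [Nat.card_congr (Equiv.ofBijective _ h.bij)]
  rfl

lemma exists_reps (h : B.relIndex A ≠ 0) : ∃ (n : ℕ) (s : Fin n → V), IsReps A B s ∧ n = B.relIndex A := by
  have : Finite (A ⧸ B.addSubgroupOf A) := by
    have : (B.addSubgroupOf A).FiniteIndex := ⟨h⟩
    exact AddSubgroup.finite_quotient_of_finiteIndex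
  obtain ⟨n, ⟨e⟩⟩ := Finite.exists_equiv_fin (A ⧸ B.addSubgroupOf A)
  have hr : IsReps A B (fun i : Fin n => (((e.symm i).out : A) : V)) := by
    refine ⟨fun i => (e.symm i).out.2, ?_, ?_⟩
    · intro i j hij
      apply e.symm.injective
      have h1 : (QuotientAddGroup.mk (e.symm j).out : A ⧸ B.addSubgroupOf A) = QuotientAddGroup.mk (e.symm i).out := by
        rw [QuotientAddGroup.eq, AddSubgroup.mem_addSubgroupOf]
        simpa [sub_eq_neg_add] using hij
      have h2 : ∀ q : A ⧸ B.addSubgroupOf A, (QuotientAddGroup.mk q.out : A ⧸ B.addSubgroupOf A) = q := fun q => Quotient.out_eq' q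
      rw [h2, h2] at h1
      exact h1.symm
    · intro a ha
      refine ⟨e (QuotientAddGroup.mk ⟨a, ha⟩), ?_⟩
      have h1 : (QuotientAddGroup.mk (QuotientAddGroup.mk (⟨a, ha⟩ : A) : A ⧸ B.addSubgroupOf A).out : A ⧸ B.addSubgroupOf A) = QuotientAddGroup.mk (⟨a, ha⟩ : A) := Quotient.out_eq' _
      rw [QuotientAddGroup.eq, AddSubgroup.mem_addSubgroupOf] at h1
      simpa [sub_eq_neg_add] using h1
  exact ⟨n, _, hr, by rw [hr.card]; simp⟩

lemma qs_congr {f g : V → ℂ} (hfg : ∀ a ∈ A, f a = g a) : qs A B f = qs A B g := by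
  unfold qs
  congr 1
  ext q
  exact hfg _ q.out.2

/-- product lemma -/
lemma qs_mul {A₁ A₂ : AddSubgroup V} (h₁ : B ≤ A₁) (h₂ : B ≤ A₂) (hB : A₁ ⊓ A₂ ≤ B)
    (r₁ : B.relIndex A₁ ≠ 0) (r₂ : B.relIndex A₂ ≠ 0) (f : V → ℂ)
    (hmul : ∀ x ∈ A₁, ∀ y ∈ A₂, f (x + y) = f x * f y) (hf : ∀ b ∈ B, f b = 1) :
    qs (A₁ ⊔ A₂) B f = qs A₁ B f * qs A₂ B f := by
  obtain ⟨n, s, hs, -⟩ := exists_reps r₁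
  obtain ⟨m, t, ht, -⟩ := exists_reps r₂
  have p₁ : Per A₁ B f := fun a ha b hb => by rw [hmul a ha b (h₂ hb), hf b hb, mul_one]
  have p₂ : Per A₂ B f := fun a ha b hb => by
    rw [add_comm, hmul b (h₁ hb) a ha, hf b hb, one_mul]
  have p : Per (A₁ ⊔ A₂) B f := by
    intro a ha b hb
    obtain ⟨x, hx, y, hy, rfl⟩ := AddSubgroup.mem_sup.1 ha
    rw [add_assoc, hmul x hx _ (A₂.add_mem hy (h₂ hb)), p₂ y hy b hb, hmul x hx y hy]
  have hr : IsReps (A₁ ⊔ A₂) B (fun ij : Fin n × Fin m => s ij.1 + t ij.2) := by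
    refine ⟨fun ij => AddSubgroup.add_mem_sup (hs.mem _) (ht.mem _), ?_, ?_⟩
    · rintro ⟨i, j⟩ ⟨i', j'⟩ h
      simp only at h
      have e : s i + t j - (s i' + t j') = (s i - s i') + (t j - t j') := by abel
      have h1 : s i - s i' ∈ B := by
        apply hB
        refine ⟨A₁.sub_mem (hs.mem _) (hs.mem _), ?_⟩
        have : s i - s i' = (s i + t j - (s i' + t j')) - (t j - t j') := by abel
        rw [this]
        exact A₂.sub_mem (h₂ h) (A₂.sub_mem (ht.mem _) (ht.mem _))
      have h2 : t j - t j' ∈ B := by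
        have : t j - t j' = (s i + t j - (s i' + t j')) - (s i - s i') := by abel
        rw [this]
        exact B.sub_mem h h1
      rw [hs.inj _ _ h1, ht.inj _ _ h2]
    · intro a ha
      obtain ⟨x, hx, y, hy, rfl⟩ := AddSubgroup.mem_sup.1 ha
      obtain ⟨i, hi⟩ := hs.surj x hx
      obtain ⟨j, hj⟩ := ht.surj y hy
      refine ⟨(i, j), ?_⟩
      have : x + y - (s i + t j) = (x - s i) + (y - t j) := by abel
      rw [this]
      exact B.add_mem hi hj
  rw [qs_eq_sum hr f p, qs_eq_sum hs f p₁, qs_eq_sum ht f p₂, Fintype.sum_prod_type, Finset.sum_mul_sum]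
  refine Finset.sum_congr rfl fun i _ => Finset.sum_congr rfl fun j _ => ?_
  exact hmul _ (hs.mem _) _ (ht.mem _)

lemma qs_char_zero {H : AddSubgroup V} (hBH : B ≤ H) (r : B.relIndex H ≠ 0) (χ : V → ℂ)
    (hχ : ∀ x ∈ H, ∀ y ∈ H, χ (x + y) = χ x * χ y) (hB : ∀ b ∈ B, χ b = 1)
    (h0 : V) (hh0 : h0 ∈ H) (hne : χ h0 ≠ 1) : qs H B χ = 0 := by
  obtain ⟨n, s, hs, -⟩ := exists_reps r
  have p : Per H B χ := fun a ha b hb => by rw [hχ a ha b (hBH hb), hB b hb, mul_one]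
  have hs' : IsReps H B (fun i => s i + h0) := by
    refine ⟨fun i => H.add_mem (hs.mem i) hh0, ?_, ?_⟩
    · intro i j h
      apply hs.inj
      simpa using h
    · intro a ha
      obtain ⟨i, hi⟩ := hs.surj (a - h0) (H.sub_mem ha hh0)
      refine ⟨i, ?_⟩
      have : a - (s i + h0) = a - h0 - s i := by abel
      rwa [this]
  have e1 := qs_eq_sum hs χ p
  have e2 := qs_eq_sum hs' χ p
  have e3 : ∑ i, χ (s i + h0) = (∑ i, χ (s i)) * χ h0 := by
    rw [Finset.sum_mul]
    exact Finset.sum_congr rfl fun i _ => hχ _ (hs.mem _) _ hh0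
  rw [e3, ← e1] at e2
  have : qs H B χ * (χ h0 - 1) = 0 := by rw [mul_sub, ← e2]; ring
  rcases mul_eq_zero.1 this with h | h
  · exact h
  · exact absurd (sub_eq_zero.1 h) hne

/-- isotropic reduction -/
lemma qs_iso {H C : AddSubgroup V} (hBH : B ≤ H) (hHA : H ≤ A) (r : B.relIndex A ≠ 0)
    (f : V → ℂ) (χ : V → V → ℂ)
    (hf : ∀ x ∈ A, ∀ h ∈ H, f (x + h) = f x * χ x h)
    (hχ : ∀ x ∈ A, ∀ h ∈ H, ∀ h' ∈ H, χ x (h + h') = χ x h * χ x h')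
    (hχB : ∀ x ∈ A, ∀ b ∈ B, χ x b = 1)
    (hC : ∀ x, x ∈ C ↔ x ∈ A ∧ ∀ h ∈ H, χ x h = 1) (hHC : H ≤ C) :
    qs A B f = (B.relIndex H : ℂ) * qs C H f := by
  have r1 : B.relIndex H ≠ 0 := fun h0 => r (by
    rw [← AddSubgroup.relIndex_mul_relIndex B H A hBH hHA, h0, zero_mul])
  have r2 : H.relIndex A ≠ 0 := fun h0 => r (by
    rw [← AddSubgroup.relIndex_mul_relIndex B H A hBH hHA, h0, mul_zero])
  obtain ⟨n, s, hs, -⟩ := exists_reps r2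
  obtain ⟨m, t, ht, hm⟩ := exists_reps r1
  have hr : IsReps A B (fun ij : Fin n × Fin m => s ij.1 + t ij.2) := by
    refine ⟨fun ij => A.add_mem (hs.mem _) (hHA (ht.mem _)), ?_, ?_⟩
    · rintro ⟨i, j⟩ ⟨i', j'⟩ h
      simp only at h
      have h1 : i = i' := by
        apply hs.inj
        have : s i - s i' = (s i + t j - (s i' + t j')) - (t j - t j') := by abel
        rw [this]
        exact H.sub_mem (hBH h) (H.sub_mem (ht.mem _) (ht.mem _))
      subst h1
      have h2 : j = j' := by
        apply ht.inj
        simpa using h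
      rw [h2]
    · intro a ha
      obtain ⟨i, hi⟩ := hs.surj a ha
      obtain ⟨j, hj⟩ := ht.surj _ hi
      refine ⟨(i, j), ?_⟩
      simpa [sub_add_eq_sub_sub] using hj
  have p : Per A B f := fun a ha b hb => by rw [hf a ha b (hBH hb), hχB a ha b hb, mul_one]
  have pc : Per C H f := fun a ha b hb => by
    rw [hf a ((hC a).1 ha).1 b hb, ((hC a).1 ha).2 b hb, mul_one]
  classical
  have hrC : IsReps C H (fun i : {i // s i ∈ C} => s i) := by
    refine ⟨fun i => i.2, fun i j h => Subtype.ext (hs.inj _ _ h), ?_⟩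
    intro a ha
    obtain ⟨i, hi⟩ := hs.surj a ((hC a).1 ha).1
    refine ⟨⟨i, ?_⟩, hi⟩
    have : s i = a - (a - s i) := by abel
    rw [this]
    exact C.sub_mem ha (hHC hi)
  rw [qs_eq_sum hr f p, qs_eq_sum hrC f pc, Fintype.sum_prod_type]
  have key : ∀ i, ∑ j, f (s i + t j) = if s i ∈ C then (B.relIndex H : ℂ) * f (s i) else 0 := by
    intro i
    have e : ∑ j, f (s i + t j) = f (s i) * ∑ j, χ (s i) (t j) := by
      rw [Finset.mul_sum]
      exact Finset.sum_congr rfl fun j _ => hf _ (hs.mem _) _ (ht.mem _)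
    rw [e]
    split_ifs with hi
    · rw [Finset.sum_congr rfl (fun j _ => ((hC _).1 hi).2 _ (ht.mem j))]
      simp [← hm, mul_comm]
    · have : ∃ h ∈ H, χ (s i) h ≠ 1 := by
        by_contra hcon
        push Not at hcon
        exact hi ((hC _).2 ⟨hs.mem _, hcon⟩)
      obtain ⟨h, hh, hne⟩ := this
      have pχ : Per H B (χ (s i)) := fun a ha b hb => by
        rw [hχ _ (hs.mem _) a ha b (hBH hb), hχB _ (hs.mem _) b hb, mul_one]
      rw [← qs_eq_sum ht (χ (s i)) pχ,
        qs_char_zero hBH r1 _ (hχ _ (hs.mem _)) (hχB _ (hs.mem _)) h hh hne, mul_zero]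
  rw [Finset.sum_congr rfl fun i _ => key i, Finset.mul_sum, ← Finset.sum_filter]
  exact Finset.sum_subtype _ (by simp) _

end qsums
end Recip

end

section
open Complex NumberField
namespace Recip

/-- `e(x) = exp(2πix)`. -/
noncomputable def ee (x : ℚ) : ℂ := cexp (2 * Real.pi * I * (x : ℂ))

lemma ee_add (x y : ℚ) : ee (x + y) = ee x * ee y := by
  unfold ee; rw [← Complex.exp_add]; congr 1; push_cast; ring

lemma ee_int (k : ℤ) : ee (k : ℚ) = 1 := by
  unfold ee
  rw [Complex.exp_eq_one_iff]
  exact ⟨k, by push_cast; ring⟩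

lemma ee_eq_one_iff (x : ℚ) : ee x = 1 ↔ ∃ k : ℤ, x = k := by
  constructor
  · intro h
    unfold ee at h
    rw [Complex.exp_eq_one_iff] at h
    obtain ⟨k, hk⟩ := h
    refine ⟨k, ?_⟩
    have h2 : (2 * Real.pi * I : ℂ) ≠ 0 := Complex.two_pi_I_ne_zero
    have h3 : (2 * Real.pi * I : ℂ) * (x : ℂ) = (2 * Real.pi * I : ℂ) * (k : ℂ) := by rw [hk]; ring
    have := mul_left_cancel₀ h2 h3
    exact_mod_cast this
  · rintro ⟨k, rfl⟩
    exact ee_int k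

lemma ee_sum {ι : Type*} (s : Finset ι) (f : ι → ℚ) : ee (∑ i ∈ s, f i) = ∏ i ∈ s, ee (f i) := by
  classical
  induction s using Finset.induction_on with
  | empty => simpa using ee_int 0
  | insert a s ha ih => rw [Finset.sum_insert ha, Finset.prod_insert ha, ee_add, ih]

lemma gauss_one (m : ℤ) (hm : m ≠ 0) :
    ∑ k : Fin (2 * m.natAbs), ee ((k : ℕ) ^ 2 / (4 * m)) =
      Real.sqrt (2 * m.natAbs : ℕ) * cexp (Real.pi * I / 4 * (SignType.sign m : ℤ)) := by
  have hn : 0 < m.natAbs := Int.natAbs_pos.2 hm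
  have hmC : ((m.natAbs : ℕ) : ℂ) ≠ 0 := by exact_mod_cast hn.ne'
  have key := landsberg_schaar m.natAbs hn
  rcases lt_or_gt_of_ne hm with h | h
  · have hm' : (m : ℚ) = -(m.natAbs : ℚ) := by
      rw [Nat.cast_natAbs, abs_of_neg h]; push_cast; ring
    have key2 := congrArg (starRingEnd ℂ) key
    rw [map_sum, map_mul, Complex.conj_ofReal, ← Complex.exp_conj] at key2
    rw [sign_neg h]
    have e2 : (starRingEnd ℂ) (Real.pi * I / 4) = Real.pi * I / 4 * ((((-1 : SignType)) : ℤ) : ℂ) := by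
      have h4 : (starRingEnd ℂ) 4 = 4 := Complex.conj_ofReal 4
      simp [neg_div, h4]
    rw [← e2, ← key2]
    refine Finset.sum_congr rfl fun k _ => ?_
    rw [← Complex.exp_conj, ee, hm']
    congr 1
    have h2 : (starRingEnd ℂ) 2 = 2 := Complex.conj_ofReal 2
    simp only [map_div₀, map_mul, map_pow, Complex.conj_ofReal, Complex.conj_I, Complex.conj_natCast,
      Nat.cast_mul, Nat.cast_ofNat, h2]
    push_cast [-Nat.cast_natAbs]
    field_simp
    norm_num [-Nat.cast_natAbs]
    ring
  · have hm' : (m : ℚ) = (m.natAbs : ℚ) := by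
      rw [Nat.cast_natAbs, abs_of_pos h]
    rw [sign_pos h]
    have e2 : Real.pi * I / 4 * (((SignType.pos : SignType) : ℤ) : ℂ) = Real.pi * I / 4 := by simp
    show _ = _ * cexp (Real.pi * I / 4 * (((SignType.pos : SignType) : ℤ) : ℂ))
    rw [e2, ← key]
    refine Finset.sum_congr rfl fun k _ => ?_
    rw [ee, hm']
    congr 1
    push_cast
    field_simp
    norm_num
    ring

section abstract
variable {V : Type*} [AddCommGroup V] [Module ℚ V] {n : ℕ}

/-- `ℤ`-valued coordinates after scaling by `c`. -/
def coordLat (v : Module.Basis (Fin n) ℚ V) (c : Fin n → ℚ) : AddSubgroup V where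
  carrier := {x | ∀ i, ∃ k : ℤ, c i * v.repr x i = k}
  zero_mem' := fun i => ⟨0, by simp⟩
  add_mem' := by
    intro x y hx hy i
    obtain ⟨k, hk⟩ := hx i
    obtain ⟨l, hl⟩ := hy i
    exact ⟨k + l, by rw [map_add, Finsupp.add_apply, mul_add, hk, hl]; push_cast; rfl⟩
  neg_mem' := by
    intro x hx i
    obtain ⟨k, hk⟩ := hx i
    exact ⟨-k, by rw [map_neg, Finsupp.neg_apply, mul_neg, hk]; push_cast; rfl⟩

lemma mem_coordLat (v : Module.Basis (Fin n) ℚ V) (c : Fin n → ℚ) (x : V) :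
    x ∈ coordLat v c ↔ ∀ i, ∃ k : ℤ, c i * v.repr x i = k := Iff.rfl

lemma coord_reps (v : Module.Basis (Fin n) ℚ V) (m : Fin n → ℤ) (hm : ∀ i, m i ≠ 0) :
    IsReps (coordLat v (fun i => 2 * (m i : ℚ))) (coordLat v (fun _ => 1))
      (fun k : (∀ i, Fin (2 * (m i).natAbs)) => ∑ i, ((k i : ℕ) / (2 * (m i : ℚ)) : ℚ) • v i) := by
  have hmQ : ∀ i, (m i : ℚ) ≠ 0 := fun i => by exact_mod_cast hm i
  have hrepr : ∀ (c : Fin n → ℚ) i, v.repr (∑ i, c i • v i) i = c i := by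
    intro c i
    rw [v.repr_sum_self]
  refine ⟨?_, ?_, ?_⟩
  · intro k i
    refine ⟨(k i : ℕ), ?_⟩
    rw [hrepr]
    have := hmQ i
    push_cast
    field_simp
  · intro k l h
    funext i
    obtain ⟨j, hj⟩ := h i
    rw [map_sub, Finsupp.sub_apply, hrepr, hrepr] at hj
    have := hmQ i
    have h2 : ((k i : ℕ) : ℚ) - ((l i : ℕ) : ℚ) = j * (2 * m i) := by
      rw [← hj]; field_simp
    have h3 : ((k i : ℕ) : ℤ) - ((l i : ℕ) : ℤ) = j * (2 * m i) := by exact_mod_cast h2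
    have hk := (k i).2
    have hl := (l i).2
    apply Fin.ext
    have h4 : (2 * (m i).natAbs : ℤ) ∣ ((k i : ℕ) : ℤ) - ((l i : ℕ) : ℤ) := by
      rw [h3]
      have : (2 * ((m i).natAbs : ℤ)) ∣ 2 * m i := mul_dvd_mul_left 2 (Int.natAbs_dvd.2 dvd_rfl)
      exact this.mul_left j
    have h5 : ((k i : ℕ) : ℤ) - ((l i : ℕ) : ℤ) = 0 := by
      apply Int.eq_zero_of_abs_lt_dvd h4
      rw [abs_lt]
      constructor <;> omega
    omega
  · intro a ha
    choose k hk using ha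
    have hpos : ∀ i, 0 < 2 * (m i).natAbs := fun i => by
      have := Int.natAbs_pos.2 (hm i); omega
    have hnn : ∀ i, 0 ≤ k i % (2 * m i) := fun i => Int.emod_nonneg _ (by have := hm i; omega)
    refine ⟨fun i => ⟨(k i % (2 * m i)).natAbs, ?_⟩, ?_⟩
    · have := Int.emod_lt (k i) (b := 2 * m i) (by have := hm i; omega)
      have := hnn i
      omega
    · intro i
      rw [map_sub, Finsupp.sub_apply, hrepr]
      refine ⟨k i / (2 * m i), ?_⟩
      have h1 : (((k i % (2 * m i)).natAbs : ℕ) : ℚ) = ((k i % (2 * m i) : ℤ) : ℚ) := by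
        rw [Nat.cast_natAbs, abs_of_nonneg (hnn i)]
      have h2 : (k i : ℚ) = 2 * m i * (k i / (2 * m i) : ℤ) + (k i % (2 * m i) : ℤ) := by
        have := Int.mul_ediv_add_emod (k i) (2 * m i)
        exact_mod_cast this.symm
      have := hmQ i
      show 1 * (_ - ((((k i % (2 * m i)).natAbs : ℕ) : ℚ) / _)) = _
      rw [h1]
      have h3 : v.repr a i = k i / (2 * m i) := by
        rw [← hk i]; field_simp
      rw [h3, h2]
      field_simp
      ring

lemma milgram_abstract (v : Module.Basis (Fin n) ℚ V) (m : Fin n → ℤ) (hm : ∀ i, m i ≠ 0)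
    (b : V → V → ℚ) (hb : ∀ x y, b x y = ∑ i, m i * v.repr x i * v.repr y i)
    (O A : AddSubgroup V) (hA : ∀ x, x ∈ A ↔ ∀ o ∈ O, ∃ k : ℤ, 2 * b x o = k)
    (hO : ∀ o ∈ O, ∃ k : ℤ, b o o = k) (hv : ∀ i, v i ∈ O) :
    ∃ r : ℝ, 0 < r ∧ qs A O (fun x => ee (b x x)) =
      r * cexp (Real.pi * I / 4 * ((∑ i, (SignType.sign (m i) : ℤ) : ℤ) : ℂ)) := by
  set L := coordLat v (fun _ => 1)
  set A₁ := coordLat v (fun i => 2 * (m i : ℚ))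
  have hreps := coord_reps v m hm
  have hmQ : ∀ i, (m i : ℚ) ≠ 0 := fun i => by exact_mod_cast hm i
  have hbadd : ∀ x y z, b x (y + z) = b x y + b x z := by
    intro x y z
    simp only [hb, map_add, Finsupp.add_apply, mul_add, Finset.sum_add_distrib]
  have hbsymm : ∀ x y, b x y = b y x := by
    intro x y
    simp only [hb]
    exact Finset.sum_congr rfl fun i _ => by ring
  have hq : ∀ x y, b (x + y) (x + y) = b x x + 2 * b x y + b y y := by
    intro x y
    rw [hbadd, hbsymm _ x, hbsymm _ y, hbadd, hbadd, hbsymm y x]; ring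
  have hLO : L ≤ O := by
    intro x hx
    rw [← v.sum_repr x]
    refine O.sum_mem fun i _ => ?_
    obtain ⟨k, hk⟩ := hx i
    rw [one_mul] at hk
    rw [hk, Int.cast_smul_eq_zsmul]
    exact O.zsmul_mem (hv i) k
  have hOO : ∀ o ∈ O, ∀ o' ∈ O, ∃ k : ℤ, 2 * b o o' = k := by
    intro o ho o' ho'
    obtain ⟨k₁, h1⟩ := hO o ho
    obtain ⟨k₂, h2⟩ := hO o' ho'
    obtain ⟨k₃, h3⟩ := hO _ (O.add_mem ho ho')
    refine ⟨k₃ - k₁ - k₂, ?_⟩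
    rw [hq, h1, h2] at h3
    push_cast; rw [← h3]; ring
  have hA1 : ∀ x, x ∈ A₁ ↔ ∀ i, ∃ k : ℤ, 2 * b x (v i) = k := by
    intro x
    rw [mem_coordLat]
    refine forall_congr' fun i => ?_
    have : b x (v i) = m i * v.repr x i := by
      rw [hb]
      rw [Finset.sum_eq_single i]
      · simp
      · intro j _ hj
        simp [Finsupp.single_apply, hj.symm]
      · simp
    rw [this]
    simp only [mul_assoc]
  have hOA1 : O ≤ A₁ := fun o ho => (hA1 o).2 fun i => hOO o ho _ (hv i)
  have hOA : O ≤ A := fun o ho => (hA o).2 fun o' ho' => hOO o ho o' ho'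
  have hAA1 : A ≤ A₁ := fun a ha => (hA1 a).2 fun i => (hA a).1 ha _ (hv i)
  have hxL : ∀ x ∈ A₁, ∀ l ∈ L, ee (2 * b x l) = 1 := by
    intro x hx l hl
    have : 2 * b x l = ∑ i, (2 * m i * v.repr x i) * v.repr l i := by
      rw [hb, Finset.mul_sum]
      exact Finset.sum_congr rfl fun i _ => by ring
    rw [this, ee_sum]
    refine Finset.prod_eq_one fun i _ => ?_
    obtain ⟨k, hk⟩ := hx i
    obtain ⟨j, hj⟩ := hl i
    rw [one_mul] at hj
    rw [hk, hj, ← Int.cast_mul, ee_int]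
  have iso := qs_iso (A := A₁) (B := L) (H := O) (C := A) hLO hOA1 hreps.finite
    (fun x => ee (b x x)) (fun x h => ee (2 * b x h))
    (fun x hx h hh => by
      obtain ⟨k, hk⟩ := hO h hh
      rw [hq, ee_add, ee_add, hk, ee_int, mul_one])
    (fun x _ h _ h' _ => by rw [hbadd, mul_add, ee_add])
    (fun x hx l hl => hxL x hx l hl)
    (fun x => ⟨fun hx => ⟨hAA1 hx, fun h hh => (ee_eq_one_iff _).2 ((hA x).1 hx h hh)⟩,
      fun hx => (hA x).2 fun o ho => (ee_eq_one_iff _).1 (hx.2 o ho)⟩)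
    hOA
  have hper : Per A₁ L (fun x => ee (b x x)) := by
    intro a ha l hl
    obtain ⟨k, hk⟩ := hO l (hLO hl)
    simp only
    rw [hq, ee_add, ee_add, hk, ee_int, mul_one, hxL a ha l hl, mul_one]
  have hsum := qs_eq_sum hreps _ hper
  have hval : ∀ k : (∀ i, Fin (2 * (m i).natAbs)),
      ee (b (∑ i, ((k i : ℕ) / (2 * (m i : ℚ)) : ℚ) • v i) (∑ i, ((k i : ℕ) / (2 * (m i : ℚ)) : ℚ) • v i))
      = ∏ i, ee ((k i : ℕ) ^ 2 / (4 * m i)) := by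
    intro k
    rw [← ee_sum, hb]
    congr 1
    refine Finset.sum_congr rfl fun i _ => ?_
    rw [v.repr_sum_self]
    have := hmQ i
    field_simp
    norm_num
  simp_rw [hval] at hsum
  rw [← Fintype.prod_sum (fun i (k : Fin (2 * (m i).natAbs)) => ee ((k : ℕ) ^ 2 / (4 * m i)))] at hsum
  simp_rw [fun i => gauss_one (m i) (hm i)] at hsum
  rw [Finset.prod_mul_distrib, ← Complex.exp_sum, ← Finset.mul_sum] at hsum
  have hidx : L.relIndex O ≠ 0 := fun h0 => hreps.finite (by
    rw [← AddSubgroup.relIndex_mul_relIndex L O A₁ hLO hOA1, h0, zero_mul])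
  have hidxC : (L.relIndex O : ℂ) ≠ 0 := by exact_mod_cast hidx
  refine ⟨(∏ i, Real.sqrt (2 * (m i).natAbs : ℕ)) / L.relIndex O, ?_, ?_⟩
  · apply div_pos
    · refine Finset.prod_pos fun i _ => Real.sqrt_pos.2 ?_
      have := Int.natAbs_pos.2 (hm i)
      positivity
    · have : 0 < L.relIndex O := Nat.pos_of_ne_zero hidx
      exact_mod_cast this
  · rw [hsum] at iso
    push_cast at iso ⊢
    rw [div_mul_eq_mul_div, iso, mul_div_cancel_left₀ _ hidxC]

end abstract
end Recip

end

section
open Complex NumberField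
namespace Recip
variable {K : Type*} [Field K] [NumberField K]

lemma pos_count {ι : Type*} [Fintype ι] (γ : K) (v : ι → K) (m : ι → ℚ)
    (horth : ∀ i j, i ≠ j → Algebra.trace ℚ K (γ * (v i * v j)) = 0)
    (hdiag : ∀ i, Algebra.trace ℚ K (γ * (v i * v i)) = m i) :
    Nat.card {i // 0 < m i} ≤ Nat.card {φ : K →+* ℝ // 0 < φ γ} +
      Nat.card {w : InfinitePlace K // w.IsComplex} := by
  classical
  -- square roots
  choose c hc using fun w : InfinitePlace K => IsAlgClosed.exists_pow_nat_eq (w.embedding γ) (n := 2) (by norm_num)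
  let F : ({i // 0 < m i} → ℝ) →ₗ[ℝ] (({φ : K →+* ℝ // 0 < φ γ} ⊕ {w : InfinitePlace K // w.IsComplex}) → ℝ) :=
    { toFun := fun t => Sum.elim (fun φ => ∑ i, t i * φ.1 (v i))
        (fun w => (c w.1 * ∑ i, (t i : ℂ) * w.1.embedding (v i)).re)
      map_add' := by
        intro s t
        ext x
        rcases x with φ | w
        · simp [add_mul, Finset.sum_add_distrib]
        · simp only [Pi.add_apply, Sum.elim_inr, ofReal_add, add_mul, Finset.sum_add_distrib, mul_add, add_re]
      map_smul' := by
        intro a t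
        ext x
        rcases x with φ | w
        · simp [mul_assoc, Finset.mul_sum]
        · simp only [Pi.smul_apply, Sum.elim_inr, smul_eq_mul, ofReal_mul, mul_assoc, RingHom.id_apply]
          rw [← Finset.mul_sum, mul_left_comm, re_ofReal_mul] }
  have hF : Function.Injective F := by
    rw [injective_iff_map_eq_zero]
    intro t ht
    have h1 : ∀ φ : K →+* ℝ, 0 < φ γ → ∑ i : {i // 0 < m i}, t i * φ (v i) = 0 := fun φ hφ =>
      congrFun ht (Sum.inl ⟨φ, hφ⟩)
    have h2 : ∀ w : InfinitePlace K, w.IsComplex →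
        (c w * ∑ i : {i // 0 < m i}, (t i : ℂ) * w.embedding (v i)).re = 0 := fun w hw =>
      congrFun ht (Sum.inr ⟨w, hw⟩)
    have h3 : ∀ σ : K →+* ℂ, (σ γ * (∑ i : {i // 0 < m i}, (t i : ℂ) * σ (v i)) ^ 2).re ≤ 0 := by
      have hC : ∀ w : InfinitePlace K, w.IsComplex →
          (w.embedding γ * (∑ i : {i // 0 < m i}, (t i : ℂ) * w.embedding (v i)) ^ 2).re ≤ 0 := by
        intro w hw
        rw [← hc w, ← mul_pow, sq, Complex.mul_re, h2 w hw]
        nlinarith [mul_self_nonneg (c w * ∑ i : {i // 0 < m i}, (t i : ℂ) * w.embedding (v i)).im]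
      intro σ
      by_cases hσ : ComplexEmbedding.IsReal σ
      · set φ := hσ.embedding with hφd
        have hφ : ∀ x, (φ x : ℂ) = σ x := fun x => hσ.coe_embedding_apply x
        have : (σ γ * (∑ i : {i // 0 < m i}, (t i : ℂ) * σ (v i)) ^ 2) =
          ((φ γ * (∑ i : {i // 0 < m i}, t i * φ (v i)) ^ 2 : ℝ) : ℂ) := by
          push_cast
          simp only [hφ]
        rw [this, ofReal_re]
        rcases lt_or_ge 0 (φ γ) with h | h
        · rw [h1 φ h]; simp
        · exact mul_nonpos_of_nonpos_of_nonneg h (sq_nonneg _)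
      · have hw : (InfinitePlace.mk σ).IsComplex := by
          rw [← InfinitePlace.not_isReal_iff_isComplex]
          intro h
          exact hσ (InfinitePlace.isReal_of_mk_isReal h)
        have := hC _ hw
        rcases InfinitePlace.embedding_mk_eq σ with h | h
        · rwa [h] at this
        · rw [h] at this
          rw [← Complex.conj_re]
          refine le_of_eq_of_le ?_ this
          congr 1
          simp [map_mul, map_pow, map_sum, ComplexEmbedding.conjugate]
    have h4 : ((∑ i : {i // 0 < m i}, (m i : ℝ) * t i ^ 2 : ℝ) : ℂ) =
        ∑ σ : K →+* ℂ, σ γ * (∑ i : {i // 0 < m i}, (t i : ℂ) * σ (v i)) ^ 2 := by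
      have e1 : ∀ σ : K →+* ℂ, σ γ * (∑ i : {i // 0 < m i}, (t i : ℂ) * σ (v i)) ^ 2 =
          ∑ i : {i // 0 < m i}, ∑ j : {i // 0 < m i}, (t i : ℂ) * t j * σ (γ * (v i * v j)) := by
        intro σ
        rw [sq, Finset.sum_mul_sum, Finset.mul_sum]
        refine Finset.sum_congr rfl fun i _ => ?_
        rw [Finset.mul_sum]
        refine Finset.sum_congr rfl fun j _ => ?_
        rw [map_mul, map_mul]; ring
      simp_rw [e1]
      rw [Finset.sum_comm]
      push_cast
      refine Finset.sum_congr rfl fun i _ => ?_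
      rw [Finset.sum_comm]
      have e2 : ∀ x : K, ∑ σ : K →+* ℂ, σ x = ((Algebra.trace ℚ K x : ℚ) : ℂ) := by
        intro x
        have := trace_eq_sum_embeddings (K := ℚ) (L := K) ℂ (x := x)
        rw [show ((Algebra.trace ℚ K x : ℚ) : ℂ) = algebraMap ℚ ℂ (Algebra.trace ℚ K x) from rfl, this]
        rw [← (RingHom.equivRatAlgHom (R := K) (S := ℂ)).sum_comp]
        rfl
      simp_rw [← Finset.mul_sum, e2]
      rw [Finset.sum_eq_single i]
      · rw [hdiag]; ring
      · intro j _ hj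
        rw [horth _ _ (fun h => hj (Subtype.ext h).symm)]; simp
      · simp
    have h5 : ∑ i : {i // 0 < m i}, (m i : ℝ) * t i ^ 2 ≤ 0 := by
      have := congrArg Complex.re h4
      rw [ofReal_re, Complex.re_sum] at this
      rw [this]
      exact Finset.sum_nonpos fun σ _ => h3 σ
    have h6 : ∀ i : {i // 0 < m i}, 0 ≤ (m i : ℝ) * t i ^ 2 := fun i => by
      have : (0:ℝ) < m i := by exact_mod_cast i.2
      positivity
    have h7 := (Finset.sum_eq_zero_iff_of_nonneg (fun i _ => h6 i)).1 (le_antisymm h5 (Finset.sum_nonneg fun i _ => h6 i))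
    funext i
    have h8 := h7 i (Finset.mem_univ _)
    have : (m i : ℝ) ≠ 0 := by exact_mod_cast i.2.ne'
    simpa [this] using h8
  have := LinearMap.finrank_le_finrank_of_injective hF
  simpa [Module.finrank_fintype_fun_eq_card, Nat.card_eq_fintype_card] using this

/-- real embeddings are real places -/
lemma card_real_emb : Nat.card (K →+* ℝ) = Nat.card {w : InfinitePlace K // w.IsReal} := by
  rw [← Nat.card_congr (InfinitePlace.mkReal (K := K))]
  refine Nat.card_congr ⟨fun φ => ⟨(algebraMap ℝ ℂ).comp φ, ?_⟩, fun σ => σ.2.embedding, ?_, ?_⟩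
  · rw [ComplexEmbedding.isReal_iff]
    ext x
    simp [ComplexEmbedding.conjugate]
  · intro φ
    ext x
    apply Complex.ofReal_injective
    rw [ComplexEmbedding.IsReal.coe_embedding_apply]
    rfl
  · intro σ
    ext x
    exact ComplexEmbedding.IsReal.coe_embedding_apply σ.2 x

lemma card_places : Nat.card (K →+* ℝ) + 2 * Nat.card {w : InfinitePlace K // w.IsComplex}
    = Module.finrank ℚ K := by
  rw [card_real_emb]
  have := InfinitePlace.card_add_two_mul_card_eq_rank K
  unfold InfinitePlace.nrRealPlaces InfinitePlace.nrComplexPlaces at this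
  classical
  rw [Nat.card_eq_fintype_card, Nat.card_eq_fintype_card]
  convert! this

lemma sum_sign {ι : Type*} [Fintype ι] {R : Type*} [Ring R] [LinearOrder R] [IsStrictOrderedRing R] (m : ι → R) :
    ∑ i, (SignType.sign (m i) : ℤ) = Nat.card {i // 0 < m i} - (Nat.card {i // m i < 0} : ℤ) := by
  classical
  have h : ∀ i, (SignType.sign (m i) : ℤ) = (if 0 < m i then 1 else 0) - (if m i < 0 then 1 else 0) := by
    intro i
    rcases lt_trichotomy (m i) 0 with h | h | h
    · rw [sign_neg h]; simp [h, not_lt.2 h.le]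
    · rw [h]; simp
    · rw [sign_pos h]; simp [h, not_lt.2 h.le]
  simp_rw [h, Finset.sum_sub_distrib]
  simp [Nat.card_eq_fintype_card, Fintype.card_subtype]

lemma card_pos_neg {α R : Type*} [Fintype α] [Ring R] [LinearOrder R] [IsStrictOrderedRing R] (g : α → R)
    (hg : ∀ a, g a ≠ 0) : Nat.card {a // 0 < g a} + Nat.card {a // g a < 0} = Fintype.card α := by
  classical
  rw [Nat.card_eq_fintype_card, Nat.card_eq_fintype_card, Fintype.card_subtype, Fintype.card_subtype,
    ← Finset.card_univ, ← Finset.card_filter_add_card_filter_not (s := Finset.univ) (fun a => 0 < g a)]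
  congr 2
  ext a
  simp only [Finset.mem_filter, Finset.mem_univ, true_and, not_lt]
  exact ⟨le_of_lt, fun h => lt_of_le_of_ne h (hg a)⟩

lemma signature {ι : Type*} [Fintype ι] (hι : Fintype.card ι = Module.finrank ℚ K) (γ : K) (hγ : γ ≠ 0)
    (v : ι → K) (m : ι → ℤ) (hm : ∀ i, m i ≠ 0)
    (horth : ∀ i j, i ≠ j → Algebra.trace ℚ K (γ * (v i * v j)) = 0)
    (hdiag : ∀ i, Algebra.trace ℚ K (γ * (v i * v i)) = m i) :
    ∑ i, (SignType.sign (m i) : ℤ) = ∑ φ : K →+* ℝ, (SignType.sign (φ γ) : ℤ) := by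
  have h1 := pos_count γ v (fun i => (m i : ℚ)) horth hdiag
  have h2 := pos_count (-γ) v (fun i => (-(m i) : ℚ)) (fun i j hij => by
    rw [neg_mul, map_neg, horth i j hij, neg_zero]) (fun i => by rw [neg_mul, map_neg, hdiag])
  have h3 := card_places (K := K)
  simp only [Int.cast_pos, map_neg, Left.neg_pos_iff, Int.cast_lt_zero] at h1 h2
  have h4 := card_pos_neg m hm
  have h5 := card_pos_neg (fun φ : K →+* ℝ => φ γ) (fun φ => (map_ne_zero φ).2 hγ)
  rw [sum_sign, sum_sign]
  rw [← Nat.card_eq_fintype_card] at h4 h5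
  rw [← Nat.card_eq_fintype_card] at hι
  omega

theorem milgram (γ : K) (hγ : γ ≠ 0) (O A : AddSubgroup K)
    (hO : ∀ x, x ∈ O ↔ ∃ o : 𝓞 K, algebraMap (𝓞 K) K o = x)
    (hA : ∀ x, x ∈ A ↔ ∀ o : 𝓞 K, ∃ k : ℤ, Algebra.trace ℚ K (2 * γ * x * algebraMap (𝓞 K) K o) = k)
    (hinteg : ∀ o : 𝓞 K, ∃ k : ℤ, Algebra.trace ℚ K (γ * algebraMap (𝓞 K) K o) = k) :
    ∃ r : ℝ, 0 < r ∧ qs A O (fun x => ee (Algebra.trace ℚ K (γ * x ^ 2))) =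
      r * cexp (Real.pi * I / 4 * ((∑ φ : K →+* ℝ, (SignType.sign (φ γ) : ℤ) : ℤ) : ℂ)) := by
  let B : LinearMap.BilinForm ℚ K := (Algebra.traceForm ℚ K).compLeft (LinearMap.mulLeft ℚ γ)
  have hB : ∀ x y, B x y = Algebra.trace ℚ K (γ * (x * y)) := by
    intro x y
    simp [B, LinearMap.BilinForm.compLeft_apply, Algebra.traceForm_apply, mul_assoc]
  have hsymm : LinearMap.IsSymm B := ⟨fun x y => by simp [hB, mul_comm]⟩
  obtain ⟨v₀, hv₀⟩ := LinearMap.BilinForm.exists_orthogonal_basis hsymm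
  have hd : ∀ i, ∃ d : ℤ, d ≠ 0 ∧ ∃ o : 𝓞 K, algebraMap (𝓞 K) K o = d • v₀ i := by
    intro i
    have h1 : Algebra.IsAlgebraic ℤ ℚ := IsLocalization.isAlgebraic (R := ℤ) (S := ℚ) (M := nonZeroDivisors ℤ)
    have h2 : Algebra.IsAlgebraic ℤ K := Algebra.IsAlgebraic.trans ℤ ℚ K
    have halg : IsAlgebraic ℤ (v₀ i) := Algebra.IsAlgebraic.isAlgebraic _
    obtain ⟨d, hd, h⟩ := halg.exists_integral_multiple
    exact ⟨d, hd, ⟨d • v₀ i, h⟩, rfl⟩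
  choose d hd0 o ho using hd
  have hdu : ∀ i, IsUnit ((d i : ℚ)) := fun i => by simpa using hd0 i
  let v := v₀.isUnitSMul hdu
  have hv : ∀ i, v i = algebraMap (𝓞 K) K (o i) := by
    intro i
    rw [ho, Module.Basis.isUnitSMul_apply, Int.cast_smul_eq_zsmul]
  have horth : ∀ i j, i ≠ j → B (v i) (v j) = 0 := by
    intro i j hij
    have : B (v₀ i) (v₀ j) = 0 := hv₀ hij
    simp [v, Module.Basis.isUnitSMul_apply, this]
  have hm : ∀ i, ∃ k : ℤ, B (v i) (v i) = k := by
    intro i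
    obtain ⟨k, hk⟩ := hinteg (o i * o i)
    exact ⟨k, by rw [hB, ← hk, hv, map_mul (algebraMap (𝓞 K) K)]⟩
  choose m hm using hm
  have hb : ∀ x y, B x y = ∑ i, m i * v.repr x i * v.repr y i := by
    intro x y
    conv_lhs => rw [← v.sum_repr x, ← v.sum_repr y]
    simp only [map_sum, LinearMap.sum_apply, map_smul, LinearMap.smul_apply, smul_eq_mul]
    refine Finset.sum_congr rfl fun i _ => ?_
    rw [Finset.sum_eq_single i]
    · rw [hm]; ring
    · intro j _ hj
      rw [horth _ _ hj]; simp
    · simp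
  have hm0 : ∀ i, m i ≠ 0 := by
    intro i h0
    have hz : ∀ y, B (v i) y = 0 := by
      intro y
      rw [hb]
      refine Finset.sum_eq_zero fun j _ => ?_
      by_cases hij : i = j
      · subst hij; simp [h0]
      · simp [Finsupp.single_apply, hij]
    have hvi : v i ≠ 0 := v.ne_zero i
    have := hz ((γ * v i)⁻¹)
    rw [hB, ← mul_assoc, mul_inv_cancel₀ (mul_ne_zero hγ hvi)] at this
    have h1 : Algebra.trace ℚ K (1 : K) = Module.finrank ℚ K := by
      have := Algebra.trace_algebraMap (R := ℚ) (S := K) (1 : ℚ)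
      simpa using this
    rw [h1] at this
    have h2 : 0 < Module.finrank ℚ K := Module.finrank_pos
    norm_cast at this
    omega
  obtain ⟨r, hr, h⟩ := milgram_abstract v m hm0 (fun x y => B x y) hb O A
    (by
      intro x
      rw [hA]
      constructor
      · rintro h _ hx
        obtain ⟨o, rfl⟩ := (hO _).1 hx
        obtain ⟨k, hk⟩ := h o
        refine ⟨k, ?_⟩
        rw [hB, ← hk, show 2 * γ * x * algebraMap (𝓞 K) K o = (2:ℚ) • (γ * (x * algebraMap (𝓞 K) K o)) by
          rw [Algebra.smul_def]; simp; ring, map_smul, smul_eq_mul]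
      · intro h o
        obtain ⟨k, hk⟩ := h _ ((hO _).2 ⟨o, rfl⟩)
        refine ⟨k, ?_⟩
        rw [← hk, hB, show 2 * γ * x * algebraMap (𝓞 K) K o = (2:ℚ) • (γ * (x * algebraMap (𝓞 K) K o)) by
          rw [Algebra.smul_def]; simp; ring, map_smul, smul_eq_mul])
    (by
      intro x hx
      obtain ⟨o, rfl⟩ := (hO _).1 hx
      obtain ⟨k, hk⟩ := hinteg (o * o)
      exact ⟨k, by rw [hB, ← hk, map_mul (algebraMap (𝓞 K) K)]⟩)
    (fun i => (hO _).2 ⟨o i, (hv i).symm⟩)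
  refine ⟨r, hr, ?_⟩
  rw [← signature (by simp) γ hγ (fun i => v i) m hm0 (fun i j hij => by rw [← hB]; exact horth i j hij)
    (fun i => by rw [← hB]; exact hm i), ← h]
  refine qs_congr fun x _ => ?_
  rw [hB, sq]

end Recip

end

section
open NumberField
open scoped nonZeroDivisors
namespace Recip
set_option linter.unusedSectionVars false
variable {K : Type*} [Field K] [NumberField K]

/-- the trace dual of the ring of integers -/
noncomputable def DD (K : Type*) [Field K] [NumberField K] : FractionalIdeal (𝓞 K)⁰ K :=
  FractionalIdeal.dual ℤ ℚ 1

/-- underlying additive group -/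
def ag (I : FractionalIdeal (𝓞 K)⁰ K) : AddSubgroup K := (I : Submodule (𝓞 K) K).toAddSubgroup

@[simp] lemma mem_ag {I : FractionalIdeal (𝓞 K)⁰ K} {x : K} : x ∈ ag I ↔ x ∈ I := Iff.rfl

lemma ag_sup (I J : FractionalIdeal (𝓞 K)⁰ K) : ag (I + J) = ag I ⊔ ag J := by
  rw [ag, ← FractionalIdeal.sup_eq_add, FractionalIdeal.coe_sup, Submodule.sup_toAddSubgroup]; rfl

lemma DD_ne : DD K ≠ 0 := FractionalIdeal.dual_ne_zero _ _ one_ne_zero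

lemma mem_DD {x : K} : x ∈ DD K ↔ ∀ o : 𝓞 K, ∃ k : ℤ, Algebra.trace ℚ K (x * algebraMap (𝓞 K) K o) = k := by
  rw [DD, FractionalIdeal.mem_dual (one_ne_zero (α := FractionalIdeal (𝓞 K)⁰ K))]
  constructor
  · intro h o
    obtain ⟨k, hk⟩ := h _ (FractionalIdeal.coe_mem_one _ o)
    exact ⟨k, by rw [← Algebra.traceForm_apply, ← hk]; simp⟩
  · intro h a ha
    obtain ⟨o, rfl⟩ := (FractionalIdeal.mem_one_iff _).1 ha
    obtain ⟨k, hk⟩ := h o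
    exact ⟨k, by rw [Algebra.traceForm_apply, hk]; simp⟩

lemma trace_DD {x : K} (hx : x ∈ DD K) : ∃ k : ℤ, Algebra.trace ℚ K x = k := by
  simpa using mem_DD.1 hx 1

lemma ee_DD {x : K} (hx : x ∈ DD K) : ee (Algebra.trace ℚ K x) = 1 :=
  (ee_eq_one_iff _).2 (trace_DD hx)

lemma le_DD (I : FractionalIdeal (𝓞 K)⁰ K) (h : ∀ x ∈ I, ∃ k : ℤ, Algebra.trace ℚ K x = k) : I ≤ DD K := by
  intro x hx
  rw [mem_DD]
  intro o
  apply h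
  rw [mul_comm, ← Algebra.smul_def]
  exact Submodule.smul_mem (I : Submodule (𝓞 K) K) o hx

lemma exists_int_mul (x : K) : ∃ d : ℤ, d ≠ 0 ∧ ∃ o : 𝓞 K, algebraMap (𝓞 K) K o = d * x := by
  have h1 : Algebra.IsAlgebraic ℤ ℚ := IsLocalization.isAlgebraic (R := ℤ) (S := ℚ) (M := nonZeroDivisors ℤ)
  have h2 : Algebra.IsAlgebraic ℤ K := Algebra.IsAlgebraic.trans ℤ ℚ K
  have halg : IsAlgebraic ℤ x := Algebra.IsAlgebraic.isAlgebraic _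
  obtain ⟨d, hd, h⟩ := halg.exists_integral_multiple
  exact ⟨d, hd, ⟨d • x, h⟩, by exact zsmul_eq_mul x d⟩

lemma relIndex_ne {I J : FractionalIdeal (𝓞 K)⁰ K} (hI : I ≠ 0)  :
    (ag I).relIndex (ag J) ≠ 0 := by
  obtain ⟨i, hi, hi0⟩ : ∃ i ∈ I, i ≠ 0 := by
    by_contra! h
    exact hI (FractionalIdeal.eq_zero_iff.2 h)
  have hfg : Module.Finite (𝓞 K) (J : Submodule (𝓞 K) K) :=
    Module.Finite.iff_fg.2 (FractionalIdeal.fg_of_isNoetherianRing le_rfl J)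
  have hfg2 : Module.Finite ℤ (J : Submodule (𝓞 K) K) := Module.Finite.trans (𝓞 K) _
  have hfg3 : AddGroup.FG (ag J) := Module.Finite.iff_addGroup_fg.1 hfg2
  have hfin : Finite (ag J ⧸ (ag I).addSubgroupOf (ag J)) := by
    apply AddCommGroup.finite_of_fg_isAddTorsion
    intro q
    induction q using QuotientAddGroup.induction_on with
    | H x =>
      obtain ⟨d, hd, o, ho⟩ := exists_int_mul ((x : K) / i)
      rw [isOfFinAddOrder_iff_zsmul_eq_zero]
      refine ⟨d, hd, ?_⟩
      rw [← QuotientAddGroup.mk_zsmul, QuotientAddGroup.eq_zero_iff, AddSubgroup.mem_addSubgroupOf]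
      have : ((d • x : ag J) : K) = o • i := by
        rw [Algebra.smul_def, ho]
        push_cast
        rw [zsmul_eq_mul]
        field_simp
      rw [this]
      exact Submodule.smul_mem (I : Submodule (𝓞 K) K) o hi
  rw [AddSubgroup.relIndex, AddSubgroup.index]
  exact Nat.card_pos.ne'

end Recip

end

section
open NumberField
open scoped nonZeroDivisors
namespace Recip
set_option linter.unusedSectionVars false
variable {K : Type*} [Field K] [NumberField K]

lemma ff_sum_sq {F : Type*} [Field F] [Fintype F] [DecidableEq F] (hF : ringChar F ≠ 2) (ψ : AddChar F ℂ) (hψ : ψ ≠ 1) :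
    ∑ x, ψ (x ^ 2) = gaussSum ((quadraticChar F).ringHomComp (Int.castRingHom ℂ)) ψ := by
  classical
  rw [← Finset.sum_fiberwise (g := fun x : F => x ^ 2)]
  have : ∀ t : F, ∑ x with x ^ 2 = t, ψ (x ^ 2) = ((quadraticChar F t : ℂ) + 1) * ψ t := by
    intro t
    have h := quadraticChar_card_sqrts hF t
    rw [Finset.sum_congr rfl (g := fun _ => ψ t) (fun x hx => by rw [(Finset.mem_filter.1 hx).2])]
    rw [Finset.sum_const, nsmul_eq_mul]
    congr 1
    have h2 : (({x : F | x ^ 2 = t}.toFinset.card : ℤ) : ℂ) = ((quadraticChar F t + 1 : ℤ) : ℂ) := by rw [h]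
    push_cast at h2
    rw [← h2]
    congr 2
    ext; simp
  simp_rw [this, add_mul, Finset.sum_add_distrib, one_mul]
  rw [AddChar.sum_eq_zero_of_ne_one hψ, add_zero]
  rfl

lemma ff_sum_sq_mul {F : Type*} [Field F] [Fintype F] [DecidableEq F] (hF : ringChar F ≠ 2) (ψ : AddChar F ℂ) (hψ : ψ ≠ 1)
    (a : F) (ha : a ≠ 0) :
    ∑ x, ψ (a * x ^ 2) = (quadraticChar F a : ℂ) * ∑ x, ψ (x ^ 2) := by
  have h1 : ψ.mulShift a ≠ 1 := by
    intro h
    apply hψ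
    ext x
    have := congrArg (fun f : AddChar F ℂ => f (a⁻¹ * x)) h
    simpa [AddChar.mulShift_apply, ha] using this
  have h2 := ff_sum_sq hF _ h1
  simp only [AddChar.mulShift_apply] at h2
  rw [h2, ff_sum_sq hF _ hψ]
  rw [← gaussSum_mulShift _ ψ (Units.mk0 a ha)]
  rw [← mul_assoc]
  have : (quadraticChar F a : ℂ) * ((quadraticChar F).ringHomComp (Int.castRingHom ℂ)) (Units.mk0 a ha) = 1 := by
    simp only [Units.val_mk0, MulChar.ringHomComp_apply, eq_intCast]
    rw [← Int.cast_mul, ← sq, quadraticChar_sq_one ha]; simp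
  rw [this, one_mul]
  rfl

open Classical in
/-- Legendre symbol -/
noncomputable def leg (P : Ideal (𝓞 K)) (a : 𝓞 K) : ℤ :=
  if a ∈ P then 0 else if ∃ b, a - b ^ 2 ∈ P then 1 else -1

open Classical in
lemma leg_eq (P : Ideal (𝓞 K)) [hP : P.IsMaximal] [Fintype (𝓞 K ⧸ P)] (a : 𝓞 K) :
    letI := Ideal.Quotient.field P
    leg P a = quadraticChar (𝓞 K ⧸ P) (Ideal.Quotient.mk P a) := by
  letI := Ideal.Quotient.field P
  show leg P a = quadraticChar (𝓞 K ⧸ P) (Ideal.Quotient.mk P a) 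
  rw [leg, quadraticChar_apply, quadraticCharFun]
  have h1 : (Ideal.Quotient.mk P a = 0) ↔ a ∈ P := Ideal.Quotient.eq_zero_iff_mem
  have h2 : IsSquare (Ideal.Quotient.mk P a) ↔ ∃ b, a - b ^ 2 ∈ P := by
    constructor
    · rintro ⟨c, hc⟩
      obtain ⟨b, rfl⟩ := Ideal.Quotient.mk_surjective c
      refine ⟨b, ?_⟩
      rw [← Ideal.Quotient.eq_zero_iff_mem, map_sub, hc, map_pow]; ring
    · rintro ⟨b, hb⟩
      refine ⟨Ideal.Quotient.mk P b, ?_⟩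
      rw [← Ideal.Quotient.eq_zero_iff_mem, map_sub, map_pow] at hb
      rw [← sq]; exact sub_eq_zero.1 hb
  simp only [h1, h2]

/-- quadratic Gaussian function -/
noncomputable def fq (ω : K) (x : K) : ℂ := ee (Algebra.trace ℚ K (ω * x ^ 2))

lemma fq_add (ω x y : K) : fq ω (x + y) = fq ω x * fq ω y * ee (Algebra.trace ℚ K (2 * ω * x * y)) := by
  rw [fq, fq, fq, ← ee_add, ← ee_add, ← map_add, ← map_add]; congr 2; ring

local notation "sp" => FractionalIdeal.spanSingleton (𝓞 K)⁰

lemma leg_mul (P : Ideal (𝓞 K)) (hP : P.IsPrime) (h0 : P ≠ ⊥) (a b : 𝓞 K) : leg P (a * b) = leg P a * leg P b := by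
  classical
  have hm : P.IsMaximal := hP.isMaximal h0
  have : Finite (𝓞 K ⧸ P) := Ideal.finiteQuotientOfFreeOfNeBot P h0
  have := Fintype.ofFinite (𝓞 K ⧸ P)
  rw [leg_eq, leg_eq, leg_eq, map_mul, map_mul]

end Recip

end

section
open NumberField
open scoped nonZeroDivisors
namespace Recip
set_option linter.unusedSectionVars false
variable {K : Type*} [Field K] [NumberField K]

local notation "sp" => FractionalIdeal.spanSingleton (𝓞 K)⁰

lemma coe_ne {P : Ideal (𝓞 K)} (h : P ≠ ⊥) : (P : FractionalIdeal (𝓞 K)⁰ K) ≠ 0 :=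
  FractionalIdeal.coeIdeal_ne_zero.2 h

lemma mul_mem_fi {I J : FractionalIdeal (𝓞 K)⁰ K} {x y : K} (hx : x ∈ I) (hy : y ∈ J) : x * y ∈ I * J :=
  FractionalIdeal.mul_mem_mul hx hy

lemma smul_mem_fi {I : FractionalIdeal (𝓞 K)⁰ K} {x : K} (o : 𝓞 K) (hx : x ∈ I) : algebraMap (𝓞 K) K o * x ∈ I := by
  rw [← Algebra.smul_def]
  exact Submodule.smul_mem (I : Submodule (𝓞 K) K) o hx

lemma mem_coe' {P : Ideal (𝓞 K)} {p : 𝓞 K} (h : p ∈ P) : algebraMap (𝓞 K) K p ∈ (P : FractionalIdeal (𝓞 K)⁰ K) :=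
  FractionalIdeal.mem_coeIdeal_of_mem _ h

lemma le_of_mul_coe {e : Ideal (𝓞 K)} {I : FractionalIdeal (𝓞 K)⁰ K} : (e : FractionalIdeal (𝓞 K)⁰ K) * I ≤ I := by
  calc _ ≤ 1 * I := mul_le_mul_left FractionalIdeal.coeIdeal_le_one _
    _ = I := one_mul _

lemma mem_add_fi {I J : FractionalIdeal (𝓞 K)⁰ K} {x : K} (h : x ∈ I + J) : ∃ y ∈ I, ∃ z ∈ J, y + z = x := by
  have h' : x ∈ (I : Submodule (𝓞 K) K) ⊔ J := by
    rw [← FractionalIdeal.coe_sup, FractionalIdeal.sup_eq_add]; exact h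
  exact Submodule.mem_sup.1 h'

lemma am2 : algebraMap (𝓞 K) K 2 = 2 := map_ofNat _ 2

lemma gauss_base (P : Ideal (𝓞 K)) (hP : P.IsPrime) (h0 : P ≠ ⊥) (h2 : (2 : 𝓞 K) ∉ P) (e : Ideal (𝓞 K))
    (he : ¬ e ≤ P) (ω : K) (b : FractionalIdeal (𝓞 K)⁰ K) (hb : b ≠ 0)
    (h : sp ω * b ^ 2 = P * e * DD K) (β : 𝓞 K) (hβ : β ∉ P) :
    qs (ag ((P : FractionalIdeal (𝓞 K)⁰ K)⁻¹ * b)) (ag b) (fq (algebraMap (𝓞 K) K β * ω)) =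
      leg P β * qs (ag ((P : FractionalIdeal (𝓞 K)⁰ K)⁻¹ * b)) (ag b) (fq ω) := by
  classical
  have hm : P.IsMaximal := hP.isMaximal h0
  have hfin : Finite (𝓞 K ⧸ P) := Ideal.finiteQuotientOfFreeOfNeBot P h0
  have := Fintype.ofFinite (𝓞 K ⧸ P)
  letI := Ideal.Quotient.field P
  have hP0 := coe_ne (K := K) h0
  set A := (P : FractionalIdeal (𝓞 K)⁰ K)⁻¹ * b with hA
  have hPA : (P : FractionalIdeal (𝓞 K)⁰ K) * A = b := by rw [hA, mul_inv_cancel_left₀ hP0]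
  have hbA : b ≤ A := by rw [← hPA]; exact le_of_mul_coe
  have hne : b ≠ A := by
    intro hh
    rw [← hh] at hPA
    have : (P : FractionalIdeal (𝓞 K)⁰ K) = 1 := mul_right_cancel₀ hb (hPA.trans (one_mul b).symm)
    rw [FractionalIdeal.coeIdeal_eq_one] at this
    exact hm.ne_top (by rw [this]; exact Ideal.one_eq_top)
  obtain ⟨x0, hx0, hx0b⟩ := SetLike.exists_of_lt (lt_of_le_of_ne hbA hne)
  have hPx : ∀ p ∈ P, algebraMap (𝓞 K) K p * x0 ∈ b := by
    intro p hp
    rw [← hPA]; exact mul_mem_fi (mem_coe' hp) hx0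
  have hωA : sp ω * A * b ≤ DD K := by
    have : sp ω * A * b = e * DD K := by
      rw [hA, show sp ω * ((P : FractionalIdeal (𝓞 K)⁰ K)⁻¹ * b) * b = (P : FractionalIdeal (𝓞 K)⁰ K)⁻¹ * (sp ω * b ^ 2) by ring, h,
        mul_assoc, inv_mul_cancel_left₀ hP0]
    rw [this]; exact le_of_mul_coe
  have hωm : ∀ x ∈ A, ∀ y ∈ b, ω * x * y ∈ DD K := fun x hx y hy =>
    hωA (mul_mem_fi (mul_mem_fi (FractionalIdeal.mem_spanSingleton_self _ ω) hx) hy)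
  have hE : sp x0 + b = A := by
    have hle : sp x0 + b ≤ A := by
      rw [← FractionalIdeal.sup_eq_add]
      exact sup_le (FractionalIdeal.spanSingleton_le_iff_mem.2 hx0) hbA
    have hT : (P : FractionalIdeal (𝓞 K)⁰ K) * b⁻¹ * (sp x0 + b) ≤ 1 := by
      calc _ ≤ (P : FractionalIdeal (𝓞 K)⁰ K) * b⁻¹ * A := mul_le_mul_right hle _
        _ = 1 := by rw [hA, mul_mul_mul_comm, mul_inv_cancel₀ hP0, inv_mul_cancel₀ hb, one_mul]
    obtain ⟨I, hI⟩ := FractionalIdeal.le_one_iff_exists_coeIdeal.1 hT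
    have hPI : P ≤ I := by
      rw [← FractionalIdeal.coeIdeal_le_coeIdeal K, hI]
      calc (P : FractionalIdeal (𝓞 K)⁰ K) = (P : FractionalIdeal (𝓞 K)⁰ K) * b⁻¹ * b := by
            rw [inv_mul_cancel_right₀ hb]
        _ ≤ _ := mul_le_mul_right (by rw [← FractionalIdeal.sup_eq_add]; exact le_sup_right) _
    have hcase : sp x0 + b = A * I := by
      rw [hI, hA, show (P : FractionalIdeal (𝓞 K)⁰ K)⁻¹ * b * ((P : FractionalIdeal (𝓞 K)⁰ K) * b⁻¹ * (sp x0 + b)) = ((P : FractionalIdeal (𝓞 K)⁰ K)⁻¹ * P) * (b * b⁻¹) * (sp x0 + b) by ring,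
        mul_inv_cancel₀ hb, inv_mul_cancel₀ hP0, one_mul, one_mul]
    rcases (Ideal.isMaximal_def.1 hm).le_iff.1 hPI with h1 | h1
    · rw [hcase, h1, FractionalIdeal.coeIdeal_top, mul_one]
    · exfalso
      apply hx0b
      rw [h1, mul_comm, hPA] at hcase
      rw [← hcase, ← FractionalIdeal.sup_eq_add]
      exact (le_sup_left : sp x0 ≤ sp x0 ⊔ b) (FractionalIdeal.mem_spanSingleton_self _ x0)
  let s : (𝓞 K ⧸ P) → K := fun q => algebraMap (𝓞 K) K (Quotient.out q) * x0
  have hout : ∀ q : 𝓞 K ⧸ P, Ideal.Quotient.mk P (Quotient.out q) = q := fun q => Quotient.out_eq q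
  have hreps : IsReps (ag A) (ag b) s := by
    refine ⟨fun q => smul_mem_fi _ hx0, ?_, ?_⟩
    · intro i j hij
      rw [mem_ag] at hij
      by_contra hne'
      have hnP : Quotient.out i - Quotient.out j ∉ P := by
        intro hh
        apply hne'
        rw [← hout i, ← hout j]
        exact Ideal.Quotient.eq.2 hh
      obtain ⟨y, p, hp, hy⟩ := hm.exists_inv hnP
      apply hx0b
      have e1 : x0 = algebraMap (𝓞 K) K y * (s i - s j) + algebraMap (𝓞 K) K p * x0 := by
        have := congrArg (algebraMap (𝓞 K) K) hy
        simp only [map_add, map_mul, map_sub, map_one] at this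
        simp only [s]
        linear_combination -x0 * this
      rw [e1]
      exact Submodule.add_mem (b : Submodule (𝓞 K) K) (smul_mem_fi y hij) (hPx p hp)
    · intro a ha
      rw [mem_ag, ← hE] at ha
      obtain ⟨y, hy, z, hz, rfl⟩ := mem_add_fi ha
      obtain ⟨o, rfl⟩ := (FractionalIdeal.mem_spanSingleton _).1 hy
      refine ⟨Ideal.Quotient.mk P o, ?_⟩
      have : o - Quotient.out (Ideal.Quotient.mk P o) ∈ P := by
        rw [← Ideal.Quotient.eq, hout]
      have h3 := hPx _ this
      rw [mem_ag]
      have e1 : o • x0 + z - s (Ideal.Quotient.mk P o) = algebraMap (𝓞 K) K (o - Quotient.out (Ideal.Quotient.mk P o)) * x0 + z := by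
        simp only [s, Algebra.smul_def, map_sub]; ring
      rw [e1]
      exact Submodule.add_mem (b : Submodule (𝓞 K) K) h3 hz
  have hper : ∀ ω' : K, (∃ c : 𝓞 K, ω' = algebraMap (𝓞 K) K c * ω) → Per (ag A) (ag b) (fq ω') := by
    rintro _ ⟨c, rfl⟩ x hx y hy
    rw [mem_ag] at hx hy
    rw [fq_add]
    have e1 : fq (algebraMap (𝓞 K) K c * ω) y = 1 := by
      apply ee_DD
      rw [show algebraMap (𝓞 K) K c * ω * y ^ 2 = algebraMap (𝓞 K) K c * (ω * y * y) by ring]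
      exact smul_mem_fi _ (hωm y (hbA hy) y hy)
    have e2 : ee (Algebra.trace ℚ K (2 * (algebraMap (𝓞 K) K c * ω) * x * y)) = 1 := by
      apply ee_DD
      rw [show 2 * (algebraMap (𝓞 K) K c * ω) * x * y = algebraMap (𝓞 K) K (2 * c) * (ω * x * y) by rw [map_mul, am2]; ring]
      exact smul_mem_fi _ (hωm x hx y hy)
    rw [e1, e2, mul_one, mul_one]
  have hφ : ∀ o o' : 𝓞 K, o - o' ∈ P → ee (Algebra.trace ℚ K (ω * x0 ^ 2 * algebraMap (𝓞 K) K o)) =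
      ee (Algebra.trace ℚ K (ω * x0 ^ 2 * algebraMap (𝓞 K) K o')) := by
    intro o o' hoo
    have := ee_DD (hωm x0 hx0 _ (hPx _ hoo))
    rw [show ω * x0 ^ 2 * algebraMap (𝓞 K) K o = ω * x0 ^ 2 * algebraMap (𝓞 K) K o' + ω * x0 * (algebraMap (𝓞 K) K (o - o') * x0) by
      rw [map_sub]; ring, map_add, ee_add, this, mul_one]
  let ψ : AddChar (𝓞 K ⧸ P) ℂ :=
    { toFun := fun q => ee (Algebra.trace ℚ K (ω * x0 ^ 2 * algebraMap (𝓞 K) K (Quotient.out q)))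
      map_zero_eq_one' := by
        rw [hφ _ 0 (by rw [← Ideal.Quotient.eq, hout, map_zero])]
        simpa using ee_int 0
      map_add_eq_mul' := fun q r => by
        rw [hφ _ (Quotient.out q + Quotient.out r) (by rw [← Ideal.Quotient.eq, map_add, hout, hout, hout])]
        rw [map_add, mul_add, map_add, ee_add] }
  have hψ : ∀ o : 𝓞 K, ψ (Ideal.Quotient.mk P o) = ee (Algebra.trace ℚ K (ω * x0 ^ 2 * algebraMap (𝓞 K) K o)) := by
    intro o
    exact hφ _ _ (by rw [← Ideal.Quotient.eq, hout])
  have hψ1 : ψ ≠ 1 := by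
    intro hh
    have h3 : ω * x0 ^ 2 ∈ DD K := by
      rw [mem_DD]
      intro o
      rw [← ee_eq_one_iff, ← hψ, hh, AddChar.one_apply]
    have h4 : sp ω * A ^ 2 ≤ DD K := by
      rw [sq, ← mul_assoc]
      nth_rewrite 2 [← hE]
      rw [mul_add, ← FractionalIdeal.sup_eq_add]
      refine sup_le ?_ hωA
      rw [mul_right_comm, ← hE, mul_add, ← FractionalIdeal.sup_eq_add]
      refine sup_le ?_ ?_
      · rw [FractionalIdeal.spanSingleton_mul_spanSingleton, FractionalIdeal.spanSingleton_mul_spanSingleton,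
          FractionalIdeal.spanSingleton_le_iff_mem, mul_assoc, ← sq]
        exact h3
      · refine le_trans (mul_le_mul_left (mul_le_mul_right (FractionalIdeal.spanSingleton_le_iff_mem.2 hx0) _) _) hωA
    apply he
    rw [← FractionalIdeal.coeIdeal_le_coeIdeal K]
    have h5 : sp ω * A ^ 2 = (P : FractionalIdeal (𝓞 K)⁰ K)⁻¹ * e * DD K := by
      rw [hA, mul_pow, mul_left_comm, h, sq, show (P : FractionalIdeal (𝓞 K)⁰ K)⁻¹ * (P : FractionalIdeal (𝓞 K)⁰ K)⁻¹ * (P * e * DD K) = (P : FractionalIdeal (𝓞 K)⁰ K)⁻¹ * ((P : FractionalIdeal (𝓞 K)⁰ K)⁻¹ * P) * e * DD K by ring,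
        inv_mul_cancel₀ hP0, mul_one]
    rw [h5] at h4
    have h6 := mul_le_mul_right (mul_le_mul_left h4 (DD K)⁻¹) (P : FractionalIdeal (𝓞 K)⁰ K)
    rwa [mul_inv_cancel_right₀ DD_ne, mul_inv_cancel₀ DD_ne, mul_one, mul_inv_cancel_left₀ hP0] at h6
  have hchar : ringChar (𝓞 K ⧸ P) ≠ 2 := by
    intro hh
    apply h2
    rw [← Ideal.Quotient.eq_zero_iff_mem]
    have := ringChar.Nat.cast_ringChar (R := 𝓞 K ⧸ P)
    rw [hh] at this
    rw [show (2 : 𝓞 K) = ((2 : ℕ) : 𝓞 K) by norm_num, map_natCast]; exact this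
  have hβ0 : Ideal.Quotient.mk P β ≠ 0 := fun hh => hβ (Ideal.Quotient.eq_zero_iff_mem.1 hh)
  have hmain := ff_sum_sq_mul hchar ψ hψ1 _ hβ0
  rw [qs_eq_sum hreps _ (hper _ ⟨β, rfl⟩), qs_eq_sum hreps _ (hper _ ⟨1, by simp⟩), leg_eq]
  convert hmain using 2
  · rename_i q _
    conv_rhs => rw [← hout q, ← map_pow, ← map_mul, hψ]
    simp only [fq, s]
    congr 2
    rw [map_mul, map_pow]; ring
  · refine Finset.sum_congr rfl fun q _ => ?_
    conv_rhs => rw [← hout q, ← map_pow, hψ]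
    simp only [fq, s]
    congr 2
    rw [map_pow]; ring

end Recip

end

section
open NumberField
open scoped nonZeroDivisors
namespace Recip
set_option linter.unusedSectionVars false
variable {K : Type*} [Field K] [NumberField K]

local notation "sp" => FractionalIdeal.spanSingleton (𝓞 K)⁰
local notation "FI" => FractionalIdeal (𝓞 K)⁰ K

lemma le_inv_mul {I : Ideal (𝓞 K)} (hI : I ≠ ⊥) (b : FI) : b ≤ (I : FI)⁻¹ * b := by
  calc b = (I : FI) * ((I : FI)⁻¹ * b) := by rw [mul_inv_cancel_left₀ (coe_ne hI)]
    _ ≤ _ := le_of_mul_coe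

lemma fq_of_le {ω : K} {b : FI} (h : sp ω * b ^ 2 ≤ DD K) {x : K} (hx : x ∈ b) : fq ω x = 1 := by
  apply ee_DD
  apply h
  rw [sq, sq]
  exact mul_mem_fi (FractionalIdeal.mem_spanSingleton_self _ ω) (mul_mem_fi hx hx)

lemma qs_split (I J : Ideal (𝓞 K)) (hI : I ≠ ⊥) (hJ : J ≠ ⊥) (hIJ : I ⊔ J = ⊤) (ω : K) (b : FI) (hb : b ≠ 0)
    (h1 : sp (2 * ω) * ((I : FI) * J)⁻¹ * b ^ 2 ≤ DD K) (h2 : sp ω * b ^ 2 ≤ DD K) :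
    qs (ag (((I : FI) * J)⁻¹ * b)) (ag b) (fq ω) =
      qs (ag ((I : FI)⁻¹ * b)) (ag b) (fq ω) * qs (ag ((J : FI)⁻¹ * b)) (ag b) (fq ω) := by
  have hsum : ((I : FI) * J)⁻¹ * b = (I : FI)⁻¹ * b + (J : FI)⁻¹ * b := by
    have h : (I : FI) + J = 1 := by
      rw [← FractionalIdeal.coeIdeal_sup, hIJ, FractionalIdeal.coeIdeal_top]
    have hI' := coe_ne (K := K) hI
    have hJ' := coe_ne (K := K) hJ
    calc ((I : FI) * J)⁻¹ * b = ((I : FI) * J)⁻¹ * (I + J) * b := by rw [h, mul_one]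
      _ = _ := by
        rw [mul_inv, mul_add, show (I : FI)⁻¹ * (J : FI)⁻¹ * I = ((I : FI)⁻¹ * I) * (J : FI)⁻¹ by ring, mul_assoc (I : FI)⁻¹ (J : FI)⁻¹ J,
          inv_mul_cancel₀ hI', inv_mul_cancel₀ hJ']
        ring
  rw [hsum, ag_sup]
  refine qs_mul (le_inv_mul hI b) (le_inv_mul hJ b) ?_ (relIndex_ne hb) (relIndex_ne hb) _ ?_ ?_
  · rintro x ⟨hx1, hx2⟩
    obtain ⟨i, hi, j, hj, hij⟩ := Submodule.mem_sup.1 ((Ideal.eq_top_iff_one _).1 hIJ)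
    have h3 : algebraMap (𝓞 K) K i * x ∈ b := by
      have := mul_mem_fi (mem_coe' hi) hx1
      rwa [mul_inv_cancel_left₀ (coe_ne hI)] at this
    have h4 : algebraMap (𝓞 K) K j * x ∈ b := by
      have := mul_mem_fi (mem_coe' hj) hx2
      rwa [mul_inv_cancel_left₀ (coe_ne hJ)] at this
    have : x = algebraMap (𝓞 K) K i * x + algebraMap (𝓞 K) K j * x := by
      rw [← add_mul, ← map_add, hij, map_one, one_mul]
    rw [this]
    exact Submodule.add_mem (b : Submodule (𝓞 K) K) h3 h4
  · intro x hx y hy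
    rw [fq_add]
    have : ee (Algebra.trace ℚ K (2 * ω * x * y)) = 1 := by
      apply ee_DD
      apply h1
      have := mul_mem_fi (mul_mem_fi (FractionalIdeal.mem_spanSingleton_self (𝓞 K)⁰ (2 * ω)) hx) hy
      convert this using 1
      rw [mul_inv]; ring
    rw [this, mul_one]
  · intro x hx
    exact fq_of_le h2 hx

lemma qs_descend (P c e : Ideal (𝓞 K)) (hP : P.IsPrime) (h0 : P ≠ ⊥) (hc : c ≠ ⊥) (h2 : (2 : 𝓞 K) ∉ P) (he : ¬ e ≤ P) 
    (ω : K) (b : FI) (hb : b ≠ 0) (h : sp ω * b ^ 2 = (P : FI) * (P * c) * e * DD K) :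
    qs (ag (((P : FI) * (P * c))⁻¹ * b)) (ag b) (fq ω) =
      ((ag b).relIndex (ag ((P : FI)⁻¹ * b)) : ℂ) * qs (ag ((c : FI)⁻¹ * ((P : FI)⁻¹ * b))) (ag ((P : FI)⁻¹ * b)) (fq ω) := by
  have hP' := coe_ne (K := K) h0
  have hc' := coe_ne (K := K) hc
  have hm : P.IsMaximal := hP.isMaximal h0
  have hH : sp ω * ((P : FI)⁻¹ * b) ^ 2 = (c : FI) * e * DD K := by
    rw [mul_pow, mul_left_comm, h]
    rw [show ((P : FI)⁻¹) ^ 2 * ((P : FI) * (P * c) * e * DD K) = ((P : FI)⁻¹ * P) ^ 2 * (c * e * DD K) by ring, inv_mul_cancel₀ hP', one_pow, one_mul]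
  have hHD : sp ω * ((P : FI)⁻¹ * b) ^ 2 ≤ DD K := by
    rw [hH, mul_assoc]; exact le_trans le_of_mul_coe le_of_mul_coe
  have hAb : sp ω * (((P : FI) * (P * c))⁻¹ * b) * b ≤ DD K := by
    rw [show sp ω * (((P : FI) * (P * c))⁻¹ * b) * b = ((P : FI) * (P * c))⁻¹ * (sp ω * b ^ 2) by ring, h, mul_assoc (_ * _) (e : FI), inv_mul_cancel_left₀
      (mul_ne_zero hP' (mul_ne_zero hP' hc'))]
    exact le_of_mul_coe
  refine qs_iso (le_inv_mul h0 b) ?_ (relIndex_ne hb) (fq ω) (fun x y => ee (Algebra.trace ℚ K (2 * ω * x * y))) ?_ ?_ ?_ ?_ ?_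
  · show (P : FI)⁻¹ * b ≤ ((P : FI) * (P * c))⁻¹ * b
    rw [mul_inv, mul_comm _ ((P : FI) * c)⁻¹, mul_assoc, ← FractionalIdeal.coeIdeal_mul]
    exact le_inv_mul (mul_ne_zero h0 hc) _
  · intro x hx y hy
    rw [fq_add, fq_of_le hHD hy, mul_one]
  · intro x hx y hy z hz
    rw [← ee_add, ← map_add]; congr 2; ring
  · intro x hx y hy
    apply ee_DD
    rw [show 2 * ω * x * y = algebraMap (𝓞 K) K 2 * (ω * x * y) by rw [am2]; ring]
    exact smul_mem_fi _ (hAb (mul_mem_fi (mul_mem_fi (FractionalIdeal.mem_spanSingleton_self _ ω) hx) hy))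
  · intro x
    simp only [mem_ag]
    have key : (((P : FI) * (P * c))⁻¹ * b) = (P : FI)⁻¹ * ((c : FI)⁻¹ * ((P : FI)⁻¹ * b)) := by
      rw [mul_inv, mul_inv]; ring
    constructor
    · intro hx
      refine ⟨?_, ?_⟩
      · rw [key]
        exact le_inv_mul h0 _ hx
      · intro y hy
        apply ee_DD
        rw [show 2 * ω * x * y = algebraMap (𝓞 K) K 2 * (ω * x * y) by rw [am2]; ring]
        apply smul_mem_fi
        have h3 := mul_mem_fi (mul_mem_fi (FractionalIdeal.mem_spanSingleton_self (𝓞 K)⁰ ω) hx) hy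
        rw [show sp ω * ((c : FI)⁻¹ * ((P : FI)⁻¹ * b)) * ((P : FI)⁻¹ * b) = (c : FI)⁻¹ * (sp ω * ((P : FI)⁻¹ * b) ^ 2) by ring, hH, mul_assoc (c : FI), inv_mul_cancel_left₀ hc'] at h3
        exact le_of_mul_coe h3
    · rintro ⟨hx, hy⟩
      have h3 : sp (2 * ω) * sp x * ((P : FI)⁻¹ * b) ≤ DD K := by
        apply le_DD
        intro z hz
        rw [FractionalIdeal.spanSingleton_mul_spanSingleton] at hz
        obtain ⟨y, hy', rfl⟩ := FractionalIdeal.mem_singleton_mul.1 hz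
        exact (ee_eq_one_iff _).1 (hy y hy')
      set Y : FI := sp x * (P * (P * c)) * b⁻¹ with hY
      have hY1 : Y ≤ 1 := by
        have : sp x ≤ ((P : FI) * (P * c))⁻¹ * b := FractionalIdeal.spanSingleton_le_iff_mem.2 hx
        calc Y ≤ (((P : FI) * (P * c))⁻¹ * b) * (P * (P * c)) * b⁻¹ := by
                rw [hY]; gcongr
          _ = 1 := by
            rw [show (((P : FI) * (P * c))⁻¹ * b) * (P * (P * c)) * b⁻¹ = (((P : FI) * (P * c))⁻¹ * (P * (P * c))) * (b * b⁻¹) by ring, mul_inv_cancel₀ hb,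
              inv_mul_cancel₀ (mul_ne_zero hP' (mul_ne_zero hP' hc')), one_mul]
      have hY2 : sp (2 : K) * (e : FI) * Y ≤ (P : FI) := by
        have h4 : sp (2 * ω) * sp x * ((P : FI)⁻¹ * b) = sp (2 : K) * (e : FI) * Y * (P : FI)⁻¹ * DD K := by
          rw [← FractionalIdeal.spanSingleton_mul_spanSingleton]
          have h5 : sp ω * b = (P : FI) * (P * c) * e * DD K * b⁻¹ := by
            rw [← h, sq, ← mul_assoc, mul_inv_cancel_right₀ hb]
          calc _ = sp (2 : K) * sp x * (P : FI)⁻¹ * (sp ω * b) := by ring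
            _ = _ := by rw [h5, hY]; ring
        rw [h4] at h3
        have h6 := mul_le_mul_left (mul_le_mul_left h3 (DD K)⁻¹) (P : FI)
        rwa [mul_inv_cancel_right₀ DD_ne, mul_inv_cancel₀ DD_ne, one_mul, inv_mul_cancel_right₀ hP'] at h6
      have hcop : Ideal.span {2} * e ⊔ P = ⊤ := by
        by_contra hne
        have h8 := hm.eq_of_le hne le_sup_right
        have h9 : Ideal.span {2} * e ≤ P := by
          conv_rhs => rw [h8]
          exact le_sup_left
        rcases (hP.mul_le).1 h9 with h10 | h10
        · exact h2 (h10 (Ideal.mem_span_singleton_self _))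
        · exact he h10
      have hY3 : Y ≤ (P : FI) := by
        have h7 : sp (2 : K) * (e : FI) + (P : FI) = 1 := by
          rw [← FractionalIdeal.coeIdeal_top, ← hcop, FractionalIdeal.coeIdeal_sup, FractionalIdeal.coeIdeal_mul, FractionalIdeal.coeIdeal_span_singleton, am2]
        calc Y = (sp (2 : K) * (e : FI) + (P : FI)) * Y := by rw [h7, one_mul]
          _ = sp (2 : K) * (e : FI) * Y + (P : FI) * Y := by ring
          _ ≤ (P : FI) := by
            rw [← FractionalIdeal.sup_eq_add]
            refine sup_le hY2 ?_
            calc (P : FI) * Y ≤ (P : FI) * 1 := by gcongr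
              _ = (P : FI) := mul_one _
      rw [← FractionalIdeal.spanSingleton_le_iff_mem]
      calc sp x = Y * (P : FI)⁻¹ * ((P : FI) * c)⁻¹ * b := by
            rw [hY, show sp x * ((P:FI) * (P * c)) * b⁻¹ * (P : FI)⁻¹ * ((P : FI) * c)⁻¹ * b = sp x * ((P : FI) * (P : FI)⁻¹) * (((P : FI) * c) * ((P : FI) * c)⁻¹) * (b * b⁻¹) by ring,
              mul_inv_cancel₀ hb, mul_inv_cancel₀ hP', mul_inv_cancel₀ (mul_ne_zero hP' hc'), mul_one, mul_one, mul_one]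
        _ ≤ (P : FI) * (P : FI)⁻¹ * ((P : FI) * c)⁻¹ * b := by gcongr
        _ = _ := by rw [mul_inv_cancel₀ hP', one_mul, mul_inv]; ring
  · show (P : FI)⁻¹ * b ≤ ((c : FI)⁻¹ * ((P : FI)⁻¹ * b))
    exact le_inv_mul hc _

end Recip

end

section
open NumberField
open scoped nonZeroDivisors
namespace Recip
set_option linter.unusedSectionVars false
variable {K : Type*} [Field K] [NumberField K]

local notation "sp" => FractionalIdeal.spanSingleton (𝓞 K)⁰
local notation "FI" => FractionalIdeal (𝓞 K)⁰ K

open UniqueFactorizationMonoid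

/-- Jacobi symbol -/
noncomputable def Jac (a : 𝓞 K) (I : Ideal (𝓞 K)) : ℤ := ((normalizedFactors I).map (fun P => leg P a)).prod

lemma Jac_one (a : 𝓞 K) : Jac a ⊤ = 1 := by
  rw [Jac, ← Ideal.one_eq_top, normalizedFactors_one]; simp

lemma Jac_mul (a : 𝓞 K) {I J : Ideal (𝓞 K)} (hI : I ≠ ⊥) (hJ : J ≠ ⊥) : Jac a (I * J) = Jac a I * Jac a J := by
  rw [Jac, normalizedFactors_mul hI hJ, Multiset.map_add, Multiset.prod_add]; rfl

lemma Jac_prime (a : 𝓞 K) {P : Ideal (𝓞 K)} (hP : P.IsPrime) (h0 : P ≠ ⊥) : Jac a P = leg P a := by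
  rw [Jac, normalizedFactors_irreducible (Ideal.prime_of_isPrime h0 hP).irreducible]; simp

lemma mem_nf {I P : Ideal (𝓞 K)} (h : P ∈ normalizedFactors I) : P.IsPrime ∧ P ≠ ⊥ ∧ I ≤ P := by
  have := prime_of_normalized_factor P h
  exact ⟨Ideal.isPrime_of_prime this, this.ne_zero, Ideal.dvd_iff_le.1 (dvd_of_mem_normalizedFactors h)⟩

lemma Jac_mul_left (a b : 𝓞 K) (I : Ideal (𝓞 K)) : Jac (a * b) I = Jac a I * Jac b I := by
  rw [Jac, Jac, Jac, ← Multiset.prod_map_mul]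
  congr 1
  refine Multiset.map_congr rfl fun P hP => ?_
  obtain ⟨h1, h2, -⟩ := mem_nf hP
  exact leg_mul P h1 h2 a b

lemma leg_sq {P : Ideal (𝓞 K)} {a : 𝓞 K} (h : a ∉ P) : leg P a * leg P a = 1 := by
  rw [leg, if_neg h]; split_ifs <;> norm_num

lemma Jac_sq (a : 𝓞 K) (I : Ideal (𝓞 K)) (h : ∀ P : Ideal (𝓞 K), P.IsPrime → I ≤ P → a ∉ P) : Jac a I * Jac a I = 1 := by
  rw [Jac, ← Multiset.prod_map_mul]
  apply Multiset.prod_eq_one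
  intro x hx
  obtain ⟨P, hP, rfl⟩ := Multiset.mem_map.1 hx
  obtain ⟨h1, h2, h3⟩ := mem_nf hP
  exact leg_sq (h P h1 h3)

lemma Jac_congr {a b : 𝓞 K} {I : Ideal (𝓞 K)} (h : a - b ∈ I) : Jac a I = Jac b I := by
  rw [Jac, Jac]
  congr 1
  refine Multiset.map_congr rfl fun P hP => ?_
  obtain ⟨h1, h2, h3⟩ := mem_nf hP
  have h' := h3 h
  have e1 : a ∈ P ↔ b ∈ P := by
    constructor
    · intro ha; have := P.sub_mem ha h'; simpa using this
    · intro ha; have := P.add_mem ha h'; simpa using this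
  have e2 : (∃ c, a - c ^ 2 ∈ P) ↔ ∃ c, b - c ^ 2 ∈ P := by
    constructor
    · rintro ⟨c, hc⟩; exact ⟨c, by have := P.sub_mem hc h'; simpa using this⟩
    · rintro ⟨c, hc⟩; exact ⟨c, by have := P.add_mem hc h'; simpa using this⟩
  unfold leg
  by_cases ha : b ∈ P
  · rw [if_pos ha, if_pos (e1.2 ha)]
  · rw [if_neg ha, if_neg (fun hh => ha (e1.1 hh))]
    by_cases hs : ∃ c, b - c ^ 2 ∈ P
    · rw [if_pos hs, if_pos (e2.2 hs)]
    · rw [if_neg hs, if_neg (fun hh => hs (e2.1 hh))]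

lemma qs_self {b : FI} (f : K → ℂ) (hf : Per (ag b) (ag b) f) (h0 : f 0 = 1) : qs (ag b) (ag b) f = 1 := by
  have : IsReps (ag b) (ag b) (fun _ : Fin 1 => (0 : K)) := 
    ⟨fun _ => (ag b).zero_mem, fun _ _ _ => Subsingleton.elim _ _, fun a ha => ⟨0, by simpa using ha⟩⟩
  rw [qs_eq_sum this f hf]; simp [h0]

lemma gauss_S (n : ℕ) : ∀ (c : Ideal (𝓞 K)) (hn : Multiset.card (normalizedFactors c) = n) (hc : c ≠ ⊥) (e : Ideal (𝓞 K)) (β : 𝓞 K)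
    (hcop : ∀ P : Ideal (𝓞 K), P.IsPrime → c ≤ P → (2 : 𝓞 K) ∉ P ∧ ¬ e ≤ P ∧ β ∉ P) (ω : K) (b : FI) (hb : b ≠ 0)
    (h : sp ω * b ^ 2 = (c : FI) * e * DD K),
    qs (ag ((c : FI)⁻¹ * b)) (ag b) (fq (algebraMap (𝓞 K) K β * ω)) =
      Jac β c * qs (ag ((c : FI)⁻¹ * b)) (ag b) (fq ω) := by
  induction n using Nat.strong_induction_on with
  | _ n ih =>
  intro c hn hc e β hcop ω b hb h
  have hle : ∀ I J : Ideal (𝓞 K), (I : FI) * J * DD K ≤ DD K := fun I J => by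
    rw [mul_assoc]; exact le_trans le_of_mul_coe le_of_mul_coe
  have hβω : ∀ (c : Ideal (𝓞 K)) (X Y : FI), sp ω * Y ^ 2 = X * (e : FI) * DD K → sp (algebraMap (𝓞 K) K β * ω) * Y ^ 2 = X * ((Ideal.span {β} * e : Ideal (𝓞 K)) : FI) * DD K := by
    intro c X Y h
    rw [← FractionalIdeal.spanSingleton_mul_spanSingleton, mul_assoc, h, FractionalIdeal.coeIdeal_mul,
      FractionalIdeal.coeIdeal_span_singleton]
    ring
  by_cases htop : c = ⊤
  · subst htop
    rw [Jac_one, FractionalIdeal.coeIdeal_top, inv_one, one_mul]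
    have : ∀ ω' : K, sp ω' * b ^ 2 ≤ DD K → qs (ag b) (ag b) (fq ω') = 1 := by
      intro ω' hω
      have h1 : ∀ x ∈ b, fq ω' x = 1 := fun x hx => fq_of_le hω hx
      apply qs_self
      · intro x hx y hy
        rw [h1 _ ((ag b).add_mem hx hy), h1 _ hx]
      · exact h1 0 b.zero_mem
    rw [this, this]
    · simp
    · rw [h]; exact hle _ _
    · rw [hβω ⊤ _ _ h]; exact hle _ _
  obtain ⟨P, hmax, hcP⟩ := Ideal.exists_le_maximal c htop
  have hP : P.IsPrime := hmax.isPrime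
  have h0 : P ≠ ⊥ := fun hh => hc (by rw [hh] at hcP; exact le_bot_iff.1 hcP)
  obtain ⟨c', rfl⟩ := Ideal.dvd_iff_le.2 hcP
  have hc' : c' ≠ ⊥ := fun hh => hc (by rw [hh]; exact Ideal.mul_bot P)
  obtain ⟨h2, he, hβ⟩ := hcop P hP hcP
  rw [normalizedFactors_mul h0 hc', Multiset.card_add, normalizedFactors_irreducible (Ideal.prime_of_isPrime h0 hP).irreducible,
    Multiset.card_singleton] at hn
  by_cases hc'P : c' ≤ P
  · obtain ⟨c'', rfl⟩ := Ideal.dvd_iff_le.2 hc'P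
    have hc'' : c'' ≠ ⊥ := fun hh => hc' (by rw [hh]; exact Ideal.mul_bot P)
    rw [normalizedFactors_mul h0 hc'', Multiset.card_add, normalizedFactors_irreducible (Ideal.prime_of_isPrime h0 hP).irreducible,
      Multiset.card_singleton] at hn
    rw [Jac_mul _ h0 hc', Jac_mul _ h0 hc'', Jac_prime _ hP h0, ← mul_assoc (leg P β), leg_sq hβ, one_mul]
    simp only [FractionalIdeal.coeIdeal_mul] at h ⊢
    rw [qs_descend P c'' e hP h0 hc'' h2 he ω b hb h]
    rw [qs_descend P c'' (Ideal.span {β} * e) hP h0 hc'' h2 (by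
      intro hh
      rcases (hP.mul_le).1 hh with h10 | h10
      · exact hβ (h10 (Ideal.mem_span_singleton_self _))
      · exact he h10) _ b hb (hβω ⊤ _ _ h)]
    rw [ih _ (by omega) c'' rfl hc'' e β (fun Q hQ hcQ => hcop Q hQ (le_trans (le_trans Ideal.mul_le_right Ideal.mul_le_right) hcQ)) ω
      ((P : FI)⁻¹ * b) (mul_ne_zero (inv_ne_zero (coe_ne h0)) hb) (by
        rw [mul_pow, mul_left_comm, h]
        rw [show ((P : FI)⁻¹) ^ 2 * ((P : FI) * (P * c'') * e * DD K) = ((P : FI)⁻¹ * P) ^ 2 * (c'' * e * DD K) by ring, inv_mul_cancel₀ (coe_ne h0), one_pow, one_mul])]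
    ring
  · have hcop' : P ⊔ c' = ⊤ := by
      by_contra hne
      have h8 := hmax.eq_of_le hne le_sup_left
      apply hc'P
      rw [h8]; exact le_sup_right
    have hsplit : ∀ ω' : K, (∃ f : Ideal (𝓞 K), sp ω' * b ^ 2 = ((P * c' : Ideal (𝓞 K)) : FI) * f * DD K) →
        qs (ag (((P * c' : Ideal (𝓞 K)) : FI)⁻¹ * b)) (ag b) (fq ω') =
        qs (ag ((P : FI)⁻¹ * b)) (ag b) (fq ω') * qs (ag ((c' : FI)⁻¹ * b)) (ag b) (fq ω') := by
      rintro ω' ⟨f, hf⟩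
      rw [FractionalIdeal.coeIdeal_mul]
      apply qs_split P c' h0 hc' hcop' ω' b hb
      · rw [FractionalIdeal.coeIdeal_mul] at hf
        rw [← FractionalIdeal.spanSingleton_mul_spanSingleton, show sp (2 : K) * sp ω' * ((P : FI) * c')⁻¹ * b ^ 2 = sp (2 : K) * (((P : FI) * c')⁻¹ * (sp ω' * b ^ 2)) by ring, hf,
          mul_assoc _ (f : FI), inv_mul_cancel_left₀ (mul_ne_zero (coe_ne h0) (coe_ne hc')), ← am2, ← FractionalIdeal.coeIdeal_span_singleton, ← mul_assoc]
        exact hle _ _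
      · rw [hf]; exact hle _ _
    rw [hsplit ω ⟨e, h⟩, hsplit _ ⟨_, hβω ⊤ _ _ h⟩, Jac_mul _ h0 hc', Jac_prime _ hP h0]
    rw [FractionalIdeal.coeIdeal_mul] at h
    rw [gauss_base P hP h0 h2 (c' * e) (by
      intro hh
      rcases (hP.mul_le).1 hh with h10 | h10
      · exact hc'P h10
      · exact he h10) ω b hb (by rw [h, FractionalIdeal.coeIdeal_mul]; ring) β hβ]
    rw [ih _ (by omega) c' rfl hc' (P * e) β (fun Q hQ hcQ => by
      obtain ⟨h5, h6, h7⟩ := hcop Q hQ (le_trans Ideal.mul_le_right hcQ)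
      refine ⟨h5, ?_, h7⟩
      intro hh
      rcases (hQ.mul_le).1 hh with h10 | h10
      · have := hmax.eq_of_le hQ.ne_top h10
        exact hc'P (this ▸ hcQ)
      · exact h6 h10) ω b hb (by rw [h, FractionalIdeal.coeIdeal_mul]; ring)]
    push_cast
    ring

end Recip

end

section
open NumberField
open scoped nonZeroDivisors
namespace Recip
set_option linter.unusedSectionVars false
variable {K : Type*} [Field K] [NumberField K]

local notation "sp" => FractionalIdeal.spanSingleton (𝓞 K)⁰
local notation "FI" => FractionalIdeal (𝓞 K)⁰ K

lemma sp_alg (a : 𝓞 K) : sp (algebraMap (𝓞 K) K a) = ((Ideal.span {a} : Ideal (𝓞 K)) : FI) := by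
  rw [FractionalIdeal.coeIdeal_span_singleton]

lemma exists_coprime_ideal (a : FI) (ha : a ≠ 0) (N : Ideal (𝓞 K)) (hN : N ≠ ⊥) :
    ∃ β : K, β ≠ 0 ∧ ∃ b : Ideal (𝓞 K), sp β * a = (b : FI) ∧ IsCoprime b N := by
  have hden : ∀ I : FI, algebraMap (𝓞 K) K (I.den : 𝓞 K) ≠ 0 := fun I => by
    have := nonZeroDivisors.ne_zero I.den.2
    simp
  by_cases hT : N = ⊤
  · refine ⟨algebraMap (𝓞 K) K (a.den : 𝓞 K), hden a, a.num, FractionalIdeal.den_mul_self_eq_num' _ _ a, ?_⟩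
    rw [hT, Ideal.isCoprime_iff_sup_eq]; simp
  set c : Ideal (𝓞 K) := (a⁻¹).num with hc
  set d : K := algebraMap (𝓞 K) K ((a⁻¹).den : 𝓞 K) with hd
  have hd0 : d ≠ 0 := hden _
  have hcd : sp d * a⁻¹ = (c : FI) := FractionalIdeal.den_mul_self_eq_num' _ _ a⁻¹
  have hsd : sp d ≠ 0 := FractionalIdeal.spanSingleton_ne_zero_iff.2 hd0
  have hc0 : (c : FI) ≠ 0 := by rw [← hcd]; exact mul_ne_zero hsd (inv_ne_zero ha)
  have hc0' : c ≠ ⊥ := by rintro h; apply hc0; rw [h]; simp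
  obtain ⟨x, hx⟩ := IsDedekindDomain.exists_sup_span_eq (I := N * c) (J := c) Ideal.mul_le_right (mul_ne_zero hN hc0')
  have hxc : Ideal.span {x} ≤ c := by rw [← hx]; exact le_sup_right
  obtain ⟨b, hb⟩ := Ideal.dvd_iff_le.2 hxc
  have hx0 : x ≠ 0 := by
    rintro rfl
    rw [Ideal.span_singleton_eq_bot.2 rfl, sup_bot_eq] at hx
    apply hT
    have : N * c = 1 * c := by rw [hx, one_mul]
    have := mul_right_cancel₀ hc0' this
    rwa [Ideal.one_eq_top] at this
  refine ⟨algebraMap (𝓞 K) K x * d⁻¹, mul_ne_zero (by simpa using hx0) (inv_ne_zero hd0), b, ?_, ?_⟩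
  · have h1 : sp (algebraMap (𝓞 K) K x) = (c : FI) * b := by rw [sp_alg, hb, FractionalIdeal.coeIdeal_mul]
    rw [← FractionalIdeal.spanSingleton_mul_spanSingleton, h1, ← hcd, ← FractionalIdeal.spanSingleton_inv]
    field_simp
  · rw [Ideal.isCoprime_iff_sup_eq]
    have : (b ⊔ N) * c = 1 * c := by
      rw [one_mul, Ideal.sup_mul, mul_comm b c, ← hb, sup_comm, hx]
    have := mul_right_cancel₀ hc0' this
    rwa [Ideal.one_eq_top] at this

lemma cop_prime {I J : Ideal (𝓞 K)} (h : IsCoprime I J) {P : Ideal (𝓞 K)} (hP : P.IsPrime) (hI : I ≤ P) : ¬ J ≤ P := by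
  intro hJ
  rw [Ideal.isCoprime_iff_sup_eq] at h
  exact hP.ne_top (top_le_iff.1 (h ▸ sup_le hI hJ))

lemma cop_of_prime {I J : Ideal (𝓞 K)} (h : ∀ P : Ideal (𝓞 K), P.IsPrime → I ≤ P → ¬ J ≤ P) : IsCoprime I J := by
  rw [Ideal.isCoprime_iff_sup_eq]
  by_contra hne
  obtain ⟨M, hM, hle⟩ := Ideal.exists_le_maximal _ hne
  exact h M hM.isPrime (le_sup_left.trans hle) (le_sup_right.trans hle)
end Recip

end

section
open NumberField
open scoped nonZeroDivisors
namespace Recip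
set_option linter.unusedSectionVars false
variable {K : Type*} [Field K] [NumberField K]

local notation "sp" => FractionalIdeal.spanSingleton (𝓞 K)⁰
local notation "FI" => FractionalIdeal (𝓞 K)⁰ K
local notation "am" => algebraMap (𝓞 K) K

lemma mem_one_fi (x : K) : x ∈ (1 : FI) ↔ ∃ o : 𝓞 K, am o = x := by
  rw [FractionalIdeal.mem_one_iff]

/-- partial Gauss sums -/
noncomputable def TT (δ : K) (I : Ideal (𝓞 K)) (a : 𝓞 K) : ℂ :=
  qs (ag ((I : FI)⁻¹ * 1)) (ag (1 : FI)) (fq (am a * δ))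

noncomputable def GG (δ : K) (d : Ideal (𝓞 K)) (a : 𝓞 K) : ℂ := TT δ (Ideal.span {2} * Ideal.span {a} * d) a

lemma le_DD_of_mul (I : Ideal (𝓞 K)) : (I : FI) * DD K ≤ DD K := le_of_mul_coe ..

lemma GG_milgram {δ : K} {d : Ideal (𝓞 K)} (hd : sp δ = (d : FI) * DD K) (hδ : δ ≠ 0) {a : 𝓞 K} (ha : a ≠ 0) :
    ∃ r : ℝ, 0 < r ∧ GG δ d a = r * Complex.exp (Real.pi * Complex.I / 4 *
      ((∑ φ : K →+* ℝ, (SignType.sign (φ (am a * δ)) : ℤ) : ℤ) : ℂ)) := by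
  have ha' : am a ≠ 0 := by simpa using ha
  have hspa : sp (am a) ≠ 0 := FractionalIdeal.spanSingleton_ne_zero_iff.2 ha'
  have hd0 : (d : FI) ≠ 0 := by
    intro h; rw [h, zero_mul] at hd
    exact FractionalIdeal.spanSingleton_ne_zero_iff.2 hδ hd
  have h2 : sp (2 : K) ≠ 0 := FractionalIdeal.spanSingleton_ne_zero_iff.2 two_ne_zero
  have hDD := DD_ne (K := K)
  obtain ⟨r, hr, h⟩ := milgram (am a * δ) (mul_ne_zero ha' hδ) (ag (1 : FI))
    (ag (((Ideal.span {2} * Ideal.span {a} * d : Ideal (𝓞 K)) : FI)⁻¹ * 1)) (fun x => by rw [mem_ag, mem_one_fi])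
    (fun x => by
      rw [mem_ag, mul_one]
      have : (∀ o : 𝓞 K, ∃ k : ℤ, Algebra.trace ℚ K (2 * (am a * δ) * x * am o) = k) ↔ 2 * (am a * δ) * x ∈ DD K := mem_DD.symm
      rw [this, ← FractionalIdeal.spanSingleton_le_iff_mem, ← FractionalIdeal.spanSingleton_le_iff_mem]
      simp only [FractionalIdeal.coeIdeal_mul, ← sp_alg, ← FractionalIdeal.spanSingleton_mul_spanSingleton, hd, am2]
      have h0 : sp (2 : K) * sp (am a) * (d : FI) ≠ 0 := mul_ne_zero (mul_ne_zero h2 hspa) hd0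
      rw [show sp (2 : K) * (sp (am a) * ((d : FI) * DD K)) * sp x = ((sp x) * (sp (2 : K) * sp (am a) * (d : FI))) * DD K by ring]
      constructor
      · intro h
        have := mul_le_mul_left (mul_le_mul_left h (sp (2 : K) * sp (am a) * (d : FI))) (DD K)
        rwa [inv_mul_cancel₀ h0, one_mul] at this
      · intro h
        have := mul_le_mul_left (mul_le_mul_left h ((DD K)⁻¹)) ((sp (2 : K) * sp (am a) * (d : FI))⁻¹)
        rwa [mul_inv_cancel_right₀ hDD, mul_inv_cancel₀ hDD, one_mul, mul_inv_cancel_right₀ h0] at this)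
    (fun o => by
      have : am a * δ ∈ DD K := by
        apply smul_mem_fi
        rw [← FractionalIdeal.spanSingleton_le_iff_mem, hd]
        exact le_DD_of_mul d
      exact mem_DD.1 this o)
  exact ⟨r, hr, h⟩

lemma TT_split {δ : K} {d : Ideal (𝓞 K)} (hd : sp δ = (d : FI) * DD K) (a : 𝓞 K) (I J : Ideal (𝓞 K)) (hI : I ≠ ⊥) (hJ : J ≠ ⊥)
    (hIJ : IsCoprime I J) (h : Ideal.span {2} * Ideal.span {a} * d ≤ I * J) : TT δ (I * J) a = TT δ I a * TT δ J a := by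
  rw [TT, TT, TT, FractionalIdeal.coeIdeal_mul]
  have h0 : (I : FI) * J ≠ 0 := mul_ne_zero (coe_ne hI) (coe_ne hJ)
  apply qs_split I J hI hJ (Ideal.isCoprime_iff_sup_eq.1 hIJ) _ _ one_ne_zero
  · rw [← FractionalIdeal.coeIdeal_le_coeIdeal K] at h
    simp only [FractionalIdeal.coeIdeal_mul, ← sp_alg, am2] at h
    have := mul_le_mul_left (mul_le_mul_left h ((I : FI) * J)⁻¹) (DD K)
    rw [mul_inv_cancel₀ h0, one_mul] at this
    simp only [← FractionalIdeal.spanSingleton_mul_spanSingleton, hd]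
    refine le_trans (le_of_eq ?_) this
    ring
  · rw [one_pow, mul_one, ← FractionalIdeal.spanSingleton_mul_spanSingleton, hd, ← mul_assoc, sp_alg, ← FractionalIdeal.coeIdeal_mul]
    exact le_DD_of_mul _

lemma span2_ne : (Ideal.span {2} : Ideal (𝓞 K)) ≠ ⊥ := by
  rw [Ne, Ideal.span_singleton_eq_bot]; exact two_ne_zero
lemma span_ne {a : 𝓞 K} (ha : a ≠ 0) : (Ideal.span {a} : Ideal (𝓞 K)) ≠ ⊥ := by
  rwa [Ne, Ideal.span_singleton_eq_bot]

lemma GG_formula {δ : K} {d : Ideal (𝓞 K)} (hd : sp δ = (d : FI) * DD K) (hd0 : d ≠ ⊥) (h2d : IsCoprime d (Ideal.span {2}))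
   {a b : 𝓞 K} (ha : a ≠ 0) (hb : b ≠ 0) (hca : IsCoprime (Ideal.span {a}) (Ideal.span {2} * d))
   (hcb : IsCoprime (Ideal.span {b}) (Ideal.span {2} * d)) (hab : IsCoprime (Ideal.span {a}) (Ideal.span {b})) :
   GG δ d (a * b) = TT δ (Ideal.span {2}) (a * b) * (Jac b (Ideal.span {a}) * TT δ (Ideal.span {a}) a) *
     (Jac a (Ideal.span {b}) * TT δ (Ideal.span {b}) b) * (Jac (a * b) d * TT δ d 1) := by
  have ha' := span_ne ha
  have hb' := span_ne hb
  have h2 := span2_ne (K := K)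
  have ca2 := hca.of_mul_right_left
  have cad := hca.of_mul_right_right
  have cb2 := hcb.of_mul_right_left
  have cbd := hcb.of_mul_right_right
  have e : (Ideal.span {2} * Ideal.span {a * b} * d : Ideal (𝓞 K)) = ((Ideal.span {2} * Ideal.span {a}) * Ideal.span {b}) * d := by
    rw [← Ideal.span_singleton_mul_span_singleton]; ring
  have hsplit : GG δ d (a * b) = TT δ (Ideal.span {2}) (a * b) * TT δ (Ideal.span {a}) (a * b) * TT δ (Ideal.span {b}) (a * b) * TT δ d (a * b) := by
    rw [GG, e, TT_split hd (a*b) _ d (mul_ne_zero (mul_ne_zero h2 ha') hb') hd0 ((h2d.symm.mul_left cad).mul_left cbd) e.le,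
      TT_split hd (a*b) _ _ (mul_ne_zero h2 ha') hb' (cb2.symm.mul_left hab) (e.le.trans Ideal.mul_le_left),
      TT_split hd (a*b) _ _ h2 ha' ca2.symm ((e.le.trans Ideal.mul_le_left).trans Ideal.mul_le_left)]
  have n2 : ∀ {I P : Ideal (𝓞 K)}, IsCoprime I (Ideal.span {2}) → P.IsPrime → I ≤ P → (2 : 𝓞 K) ∉ P := fun h hP hI h' =>
    cop_prime h hP hI ((Ideal.span_singleton_le_iff_mem _).2 h')
  rw [hsplit]
  have A1 : TT δ (Ideal.span {a}) (a * b) = Jac b (Ideal.span {a}) * TT δ (Ideal.span {a}) a := by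
    have := gauss_S _ (Ideal.span {a}) rfl ha' d b (fun P hP hI => ⟨n2 ca2 hP hI, cop_prime cad hP hI, fun h => cop_prime hab hP hI ((Ideal.span_singleton_le_iff_mem _).2 h)⟩) (am a * δ) 1 one_ne_zero
      (by rw [one_pow, mul_one, ← FractionalIdeal.spanSingleton_mul_spanSingleton, hd, sp_alg, mul_assoc])
    rw [TT, TT, ← this, map_mul]; congr 2; ring
  have A2 : TT δ (Ideal.span {b}) (a * b) = Jac a (Ideal.span {b}) * TT δ (Ideal.span {b}) b := by
    have := gauss_S _ (Ideal.span {b}) rfl hb' d a (fun P hP hI => ⟨n2 cb2 hP hI, cop_prime cbd hP hI, fun h => cop_prime hab.symm hP hI ((Ideal.span_singleton_le_iff_mem _).2 h)⟩) (am b * δ) 1 one_ne_zero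
      (by rw [one_pow, mul_one, ← FractionalIdeal.spanSingleton_mul_spanSingleton, hd, sp_alg, mul_assoc])
    rw [TT, TT, ← this, map_mul]; congr 2; ring
  have A3 : TT δ d (a * b) = Jac (a * b) d * TT δ d 1 := by
    have hc : ∀ P : Ideal (𝓞 K), P.IsPrime → d ≤ P → a * b ∉ P := fun P hP hI h => by
      rcases hP.mem_or_mem h with h | h
      · exact cop_prime cad.symm hP hI ((Ideal.span_singleton_le_iff_mem _).2 h)
      · exact cop_prime cbd.symm hP hI ((Ideal.span_singleton_le_iff_mem _).2 h)
    have := gauss_S _ d rfl hd0 ⊤ (a * b) (fun P hP hI => ⟨n2 h2d hP hI, fun h => hP.ne_top (top_le_iff.1 h), hc P hP hI⟩) δ 1 one_ne_zero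
      (by rw [one_pow, mul_one, hd]; simp)
    rw [TT, TT, map_one, one_mul, ← this]
  rw [A1, A2, A3]

lemma TT_two_congr {δ : K} {d : Ideal (𝓞 K)} (hd : sp δ = (d : FI) * DD K) {a b : 𝓞 K} (h : a - b ∈ (Ideal.span {4} : Ideal (𝓞 K))) :
    TT δ (Ideal.span {2}) a = TT δ (Ideal.span {2}) b := by
  apply qs_congr
  intro x hx
  have hδ : δ ∈ DD K := by
    rw [← FractionalIdeal.spanSingleton_le_iff_mem, hd]
    exact le_DD_of_mul d
  rw [mem_ag, mul_one] at hx
  obtain ⟨o, ho⟩ : ∃ o : 𝓞 K, am o = 2 * x := by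
    rw [← mem_one_fi]
    have := FractionalIdeal.mul_mem_mul (FractionalIdeal.mem_spanSingleton_self (𝓞 K)⁰ (2 : K)) hx
    rwa [← sp_alg, am2, mul_inv_cancel₀ (FractionalIdeal.spanSingleton_ne_zero_iff.2 two_ne_zero)] at this
  obtain ⟨k, hk⟩ := Ideal.mem_span_singleton'.1 h
  have e1 : am a * δ * x ^ 2 = am b * δ * x ^ 2 + am (k * o ^ 2) * δ := by
    have : am a = am b + am k * 4 := by
      have : a = b + k * 4 := by rw [hk]; ring
      rw [this, map_add, map_mul, map_ofNat]
    rw [map_mul, map_pow, ho, this]; ring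
  rw [fq, fq, e1, map_add, ee_add, ee_DD (smul_mem_fi _ hδ), mul_one]
end Recip

end

section
open NumberField
open scoped nonZeroDivisors
namespace Recip
set_option linter.unusedSectionVars false
variable {K : Type*} [Field K] [NumberField K]

local notation "sp" => FractionalIdeal.spanSingleton (𝓞 K)⁰
local notation "FI" => FractionalIdeal (𝓞 K)⁰ K
local notation "am" => algebraMap (𝓞 K) K

open Classical in
/-- product of Hilbert symbols at the real places -/
noncomputable def sInf (a b : K) : ℤ := ∏ φ : K →+* ℝ, if φ a < 0 ∧ φ b < 0 then (-1) else 1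

lemma sInf_pm (a b : K) : sInf a b = 1 ∨ sInf a b = -1 := by
  classical
  unfold sInf
  refine Finset.prod_induction _ (fun x : ℤ => x = 1 ∨ x = -1) ?_ (Or.inl rfl) ?_
  · rintro x y (rfl | rfl) (rfl | rfl) <;> simp
  · intro φ _; split_ifs <;> simp

lemma sInf_exp (δ a b : K) (hδ : δ ≠ 0) (ha : a ≠ 0) (hb : b ≠ 0) :
    Complex.exp (Real.pi * Complex.I / 4 * ((∑ φ : K →+* ℝ, (SignType.sign (φ (a * b * δ)) : ℤ) : ℤ) : ℂ)) *
    Complex.exp (Real.pi * Complex.I / 4 * ((∑ φ : K →+* ℝ, (SignType.sign (φ (1 * δ)) : ℤ) : ℤ) : ℂ)) =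
    sInf a b * (Complex.exp (Real.pi * Complex.I / 4 * ((∑ φ : K →+* ℝ, (SignType.sign (φ (a * δ)) : ℤ) : ℤ) : ℂ)) *
    Complex.exp (Real.pi * Complex.I / 4 * ((∑ φ : K →+* ℝ, (SignType.sign (φ (b * δ)) : ℤ) : ℤ) : ℂ))) := by
  classical
  simp only [Int.cast_sum, Finset.mul_sum, Complex.exp_sum, sInf, Int.cast_prod, ← Finset.prod_mul_distrib]
  refine Finset.prod_congr rfl fun φ _ => ?_
  have key : ∀ s : ℤ, s = 1 ∨ s = -1 → Complex.exp (Real.pi * Complex.I / 4 * (s : ℂ)) * Complex.exp (Real.pi * Complex.I / 4 * (s : ℂ)) =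
      - (Complex.exp (Real.pi * Complex.I / 4 * ((-s : ℤ) : ℂ)) * Complex.exp (Real.pi * Complex.I / 4 * ((-s : ℤ) : ℂ))) := by
    have k1 : Complex.exp (Real.pi * Complex.I / 4 * ((1 : ℤ) : ℂ)) * Complex.exp (Real.pi * Complex.I / 4 * ((1 : ℤ) : ℂ)) =
      - (Complex.exp (Real.pi * Complex.I / 4 * ((-1 : ℤ) : ℂ)) * Complex.exp (Real.pi * Complex.I / 4 * ((-1 : ℤ) : ℂ))) := by
      have hpi := Complex.exp_pi_mul_I
      rw [← Complex.exp_add, ← Complex.exp_add]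
      have : (Real.pi * Complex.I / 4 * ((1 : ℤ) : ℂ) + Real.pi * Complex.I / 4 * ((1 : ℤ) : ℂ)) =
        Real.pi * Complex.I + (Real.pi * Complex.I / 4 * ((-1 : ℤ) : ℂ) + Real.pi * Complex.I / 4 * ((-1 : ℤ) : ℂ)) := by push_cast; ring
      rw [this, Complex.exp_add, hpi, neg_one_mul]
    rintro s (rfl | rfl)
    · exact k1
    · rw [neg_neg]; linear_combination k1
  simp only [map_mul, sign_mul, SignType.coe_mul, one_mul]
  have hδ' : φ δ ≠ 0 := by simpa using hδ
  have ha' : φ a ≠ 0 := by simpa using ha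
  have hb' : φ b ≠ 0 := by simpa using hb
  have hs : (SignType.sign (φ δ) : ℤ) = 1 ∨ (SignType.sign (φ δ) : ℤ) = -1 := by
    rcases lt_or_gt_of_ne hδ' with h | h
    · right; rw [sign_neg h]; rfl
    · left; rw [sign_pos h]; rfl
  generalize (SignType.sign (φ δ) : ℤ) = s at hs
  rcases lt_or_gt_of_ne ha' with h | h <;> rcases lt_or_gt_of_ne hb' with h' | h' <;>
    simp only [sign_neg, sign_pos, h, h', h.not_gt, h'.not_gt, and_self, and_false, false_and, if_true, if_false, SignType.coe_neg_one, SignType.coe_one]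
  · rw [show ((-1 : ℤ) * -1 * s) = s by ring, show ((-1 : ℤ) * s) = -s by ring, key s hs]; push_cast; ring
  · rw [show ((-1 : ℤ) * 1 * s) = -1 * s by ring, show ((1 : ℤ) * s) = s by ring]; push_cast; ring
  · rw [show ((1 : ℤ) * -1 * s) = -1 * s by ring, show ((1 : ℤ) * s) = s by ring]; push_cast; ring
  · rw [show ((1 : ℤ) * 1 * s) = s by ring, show ((1 : ℤ) * s) = s by ring]; push_cast; ring

lemma Jac_pm {a : 𝓞 K} {I : Ideal (𝓞 K)} (h : IsCoprime (Ideal.span {a}) I) : Jac a I = 1 ∨ Jac a I = -1 := by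
  have := Jac_sq a I (fun P hP hI hm => cop_prime h.symm hP hI ((Ideal.span_singleton_le_iff_mem _).2 hm))
  exact mul_self_eq_one_iff.1 this

variable (K) in
theorem recip : ∃ d : Ideal (𝓞 K), d ≠ ⊥ ∧ IsCoprime d (Ideal.span {2}) ∧ ∃ B : 𝓞 K → 𝓞 K → ℤ,
    (∀ a a' b b' : 𝓞 K, a - a' ∈ (Ideal.span {4} : Ideal (𝓞 K)) → b - b' ∈ (Ideal.span {4} : Ideal (𝓞 K)) → B a b = B a' b') ∧
    ∀ a b : 𝓞 K, a ≠ 0 → b ≠ 0 → IsCoprime (Ideal.span {a}) (Ideal.span {2} * d) →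
      IsCoprime (Ideal.span {b}) (Ideal.span {2} * d) → IsCoprime (Ideal.span {a}) (Ideal.span {b}) →
      Jac b (Ideal.span {a}) * Jac a (Ideal.span {b}) = sInf (algebraMap (𝓞 K) K a) (algebraMap (𝓞 K) K b) * B a b := by
  have hDD := DD_ne (K := K)
  obtain ⟨δ, hδ, d, hd, h2d⟩ := exists_coprime_ideal ((DD K)⁻¹) (inv_ne_zero hDD) (Ideal.span {2}) span2_ne
  have hd' : sp δ = (d : FI) * DD K := by rw [← hd, inv_mul_cancel_right₀ hDD]
  have hd0 : d ≠ ⊥ := by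
    rintro rfl
    have h0 : sp δ = 0 := by rw [hd']; simp
    exact FractionalIdeal.spanSingleton_ne_zero_iff.2 hδ h0
  let g : 𝓞 K → ℂ := fun a => TT δ (Ideal.span {2}) a
  refine ⟨d, hd0, h2d, fun a b => if 0 < (g (a * b) * g 1 / (g a * g b)).re then 1 else -1, ?_, ?_⟩
  · intro a a' b b' h h'
    have e1 : g a = g a' := TT_two_congr hd' h
    have e2 : g b = g b' := TT_two_congr hd' h'
    have e3 : g (a * b) = g (a' * b') := TT_two_congr hd' (by
      have : a * b - a' * b' = a * (b - b') + b' * (a - a') := by ring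
      rw [this]
      exact add_mem (Ideal.mul_mem_left _ _ h') (Ideal.mul_mem_left _ _ h))
    simp only [e1, e2, e3]
  · intro a b ha hb hca hcb hab
    have h1 : IsCoprime (Ideal.span {1} : Ideal (𝓞 K)) (Ideal.span {2} * d) := by
      rw [Ideal.span_singleton_one, Ideal.isCoprime_iff_sup_eq]; simp
    have ht : ∀ I : Ideal (𝓞 K), IsCoprime I (Ideal.span {1} : Ideal (𝓞 K)) := fun I => by
      rw [Ideal.span_singleton_one, Ideal.isCoprime_iff_sup_eq]; simp
    have T1 : TT δ (Ideal.span {1}) 1 = 1 := by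
      rw [TT, Ideal.span_singleton_one]
      have : ((⊤ : Ideal (𝓞 K)) : FI)⁻¹ * 1 = 1 := by simp
      rw [this]
      have hq : ∀ x ∈ (1 : FI), fq (am 1 * δ) x = 1 := fun x hx => fq_of_le (K := K) (ω := am 1 * δ) (b := 1)
        (by rw [map_one, one_mul, one_pow, mul_one, hd']; exact le_DD_of_mul d) hx
      refine qs_self _ (fun x hx y hy => ?_) (hq 0 (FractionalIdeal.zero_mem _))
      rw [hq x (mem_ag.1 hx), hq _ (mem_ag.1 (add_mem hx hy))]
    have j1 : ∀ I : Ideal (𝓞 K), I ≠ ⊥ → Jac 1 I = 1 := fun I hI => by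
      have := Jac_sq 1 I (fun P hP _ h => hP.ne_top (Ideal.eq_top_of_isUnit_mem _ h isUnit_one))
      rwa [← Jac_mul_left, one_mul] at this
    have F1 := GG_formula hd' hd0 h2d ha hb hca hcb hab
    have F2 := GG_formula hd' hd0 h2d ha one_ne_zero hca h1 (ht _)
    have F3 := GG_formula hd' hd0 h2d hb one_ne_zero hcb h1 (ht _)
    have F4 := GG_formula hd' hd0 h2d one_ne_zero one_ne_zero h1 h1 (ht _)
    simp only [mul_one, T1, j1 _ (span_ne ha), j1 _ (span_ne hb), j1 _ hd0] at F1 F2 F3 F4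
    have hJ1 : ∀ x : 𝓞 K, Jac x (Ideal.span {1}) = 1 := fun x => by rw [Ideal.span_singleton_one, Jac_one]
    simp only [hJ1, Int.cast_one, one_mul, mul_one, Jac_mul_left, Int.cast_mul] at F1 F2 F3 F4
    obtain ⟨r1, hr1, M1⟩ := GG_milgram hd' hδ (mul_ne_zero ha hb)
    obtain ⟨r2, hr2, M2⟩ := GG_milgram hd' hδ ha
    obtain ⟨r3, hr3, M3⟩ := GG_milgram hd' hδ hb
    obtain ⟨r4, hr4, M4⟩ := GG_milgram hd' hδ (one_ne_zero (α := 𝓞 K))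
    have nz : ∀ (r : ℝ) (z : ℂ), 0 < r → (r : ℂ) * Complex.exp z ≠ 0 := fun r z hr => mul_ne_zero (by exact_mod_cast hr.ne') (Complex.exp_ne_zero _)
    have N1 : GG δ d (a * b) ≠ 0 := by rw [M1]; exact nz _ _ hr1
    have N2 : GG δ d a ≠ 0 := by rw [M2]; exact nz _ _ hr2
    have N3 : GG δ d b ≠ 0 := by rw [M3]; exact nz _ _ hr3
    have N4 : GG δ d 1 ≠ 0 := by rw [M4]; exact nz _ _ hr4
    have E := sInf_exp δ (am a) (am b) hδ (by simpa using ha) (by simpa using hb)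
    rw [map_mul] at M1
    rw [map_one] at M4
    have main : GG δ d (a * b) * GG δ d 1 * (r2 * r3) = (r1 * r4) * sInf (am a) (am b) * (GG δ d a * GG δ d b) := by
      rw [M1, M2, M3, M4]
      linear_combination (r1 * r4 * r2 * r3 : ℂ) * E
    have hg : ∀ x, TT δ (Ideal.span {2}) x = g x := fun _ => rfl
    simp only [hg] at F1 F2 F3 F4
    rw [F1] at N1; rw [F2] at N2; rw [F3] at N3; rw [F4] at N4
    rw [F1, F2, F3, F4] at main
    have P2 := Jac_pm (hab)
    have P1 := Jac_pm (hab.symm)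
    have JJ : Jac b (Ideal.span {a}) * Jac a (Ideal.span {b}) = 1 ∨ Jac b (Ideal.span {a}) * Jac a (Ideal.span {b}) = -1 := by
      rcases P1 with h | h <;> rcases P2 with h' | h' <;> rw [h, h'] <;> simp
    have hs := sInf_pm (am a) (am b)
    simp only [ne_eq, mul_eq_zero, not_or] at N1 N2 N3 N4
    have rat : g (a * b) * g 1 / (g a * g b) * ((Jac b (Ideal.span {a}) * Jac a (Ideal.span {b}) : ℤ) : ℂ) * (r2 * r3) = (r1 * r4) * sInf (am a) (am b) := by
      have n1 := N2.1.1; have n2 := N3.1.1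
      rw [div_mul_eq_mul_div, div_mul_eq_mul_div, div_eq_iff (mul_ne_zero n1 n2)]
      apply mul_right_cancel₀ (b := TT δ (Ideal.span {a}) a * TT δ (Ideal.span {b}) b * Jac a d * Jac b d * TT δ d 1 ^ 2)
      · have := N2.1.2; have := N3.1.2; have := N2.2.1; have := N2.2.2; have := N3.2.1
        positivity
      · push_cast
        linear_combination main
    set Q := g (a * b) * g 1 / (g a * g b)
    set jj := Jac b (Ideal.span {a}) * Jac a (Ideal.span {b})
    set s := sInf (am a) (am b)
    have hQ : Q.re * jj * (r2 * r3) = r1 * r4 * s := by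
      have := congrArg Complex.re rat
      have e1 : Q * (jj : ℂ) * (r2 * r3) = Q * ((jj * (r2 * r3) : ℝ) : ℂ) := by push_cast; ring
      have e2 : (r1 : ℂ) * r4 * s = ((r1 * r4 * s : ℝ) : ℂ) := by push_cast; ring
      rw [e1, e2, Complex.re_mul_ofReal, Complex.ofReal_re] at this
      rw [← this]; ring
    have p1 : 0 < r2 * r3 := mul_pos hr2 hr3
    have p2 : 0 < r1 * r4 := mul_pos hr1 hr4
    show jj = s * (if 0 < Q.re then 1 else -1)
    rcases JJ with h | h <;> rcases hs with h' | h' <;> rw [h, h'] at hQ ⊢ <;> push_cast at hQ <;> split_ifs with hp <;> norm_num <;> nlinarith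
end Recip

end

section
open NumberField
open scoped nonZeroDivisors ENNReal
namespace Recip
set_option linter.unusedSectionVars false
section

/-- weight of an ideal -/
noncomputable def wt {K : Type*} [Field K] [NumberField K] (s : ℝ) (I : Ideal (𝓞 K)) : ℝ≥0∞ := ENNReal.ofReal ((Ideal.absNorm I : ℝ) ^ (-s))

/-- zeta function as an extended real sum -/
noncomputable def EE (K : Type*) [Field K] [NumberField K] (s : ℝ) : ℝ≥0∞ := ∑' I : Ideal (𝓞 K), wt s I

variable (K : Type*) [Field K] [NumberField K]

lemma EE_eq (s : ℝ) (hs : 0 < s)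
    (h : LSeriesSummable (fun n ↦ (Nat.card {I : Ideal (𝓞 K) // Ideal.absNorm I = n} : ℂ)) s) :
    EE K s = ENNReal.ofReal (dedekindZeta K s).re := by
  have hterm : ∀ n : ℕ, LSeries.term (fun n ↦ (Nat.card {I : Ideal (𝓞 K) // Ideal.absNorm I = n} : ℂ)) s n =
      ((Nat.card {I : Ideal (𝓞 K) // Ideal.absNorm I = n} * (n : ℝ) ^ (-s) : ℝ) : ℂ) := by
    intro n
    rcases eq_or_ne n 0 with rfl | hn
    · rw [LSeries.term_zero]; simp [Real.zero_rpow (neg_ne_zero.2 hs.ne')]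
    · rw [LSeries.term_of_ne_zero hn, Complex.ofReal_mul, Complex.ofReal_natCast, Complex.ofReal_cpow (Nat.cast_nonneg _),
        Complex.ofReal_neg, Complex.cpow_neg, Complex.ofReal_natCast, div_eq_mul_inv]
  have hsum : Summable (fun n : ℕ => (Nat.card {I : Ideal (𝓞 K) // Ideal.absNorm I = n} * (n : ℝ) ^ (-s) : ℝ)) := by
    rw [← Complex.summable_ofReal]
    exact h.congr fun n => by rw [hterm n]
  have hz : (dedekindZeta K s).re = ∑' n : ℕ, (Nat.card {I : Ideal (𝓞 K) // Ideal.absNorm I = n} * (n : ℝ) ^ (-s) : ℝ) := by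
    rw [dedekindZeta, LSeries, tsum_congr hterm, ← Complex.ofReal_tsum, Complex.ofReal_re]
  rw [hz, ENNReal.ofReal_tsum_of_nonneg (fun n => by positivity) hsum, EE,
    ← (Equiv.sigmaFiberEquiv (fun I : Ideal (𝓞 K) => Ideal.absNorm I)).tsum_eq, ENNReal.tsum_sigma']
  refine tsum_congr fun n => ?_
  have hfin : Finite {I : Ideal (𝓞 K) // Ideal.absNorm I = n} := Ideal.finite_setOfPred_absNorm_eq n
  have : Fintype {I : Ideal (𝓞 K) // Ideal.absNorm I = n} := Fintype.ofFinite _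
  rw [tsum_fintype]
  have : ∀ I : {I : Ideal (𝓞 K) // Ideal.absNorm I = n}, wt s ((Equiv.sigmaFiberEquiv (fun I : Ideal (𝓞 K) => Ideal.absNorm I)) ⟨n, I⟩) = ENNReal.ofReal ((n : ℝ) ^ (-s)) := by
    rintro ⟨I, rfl⟩; rfl
  rw [Finset.sum_congr rfl fun I _ => this I, Finset.sum_const, ENNReal.ofReal_mul (by positivity), nsmul_eq_mul,
    ENNReal.ofReal_natCast, Finset.card_univ, ← Nat.card_eq_fintype_card]

lemma EE_asymp : Filter.Tendsto (fun s : ℝ => (s - 1) * (EE K s).toReal) (nhdsWithin 1 (Set.Ioi 1)) (nhds (dedekindZeta_residue K)) ∧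
    ∀ᶠ s : ℝ in nhdsWithin (1 : ℝ) (Set.Ioi 1), EE K s ≠ ⊤ := by
  have h := (Complex.continuous_re.tendsto _).comp (tendsto_sub_one_mul_dedekindZeta_nhdsGT K)
  have h' : Filter.Tendsto (fun s : ℝ => (s - 1) * (dedekindZeta K s).re) (nhdsWithin 1 (Set.Ioi 1)) (nhds (dedekindZeta_residue K)) := by
    refine (h.congr fun s => ?_)
    have : ((s : ℂ) - 1) = ((s - 1 : ℝ) : ℂ) := by push_cast; rfl
    rw [Function.comp, this, Complex.re_ofReal_mul]
  have hev : ∀ᶠ s : ℝ in nhdsWithin (1 : ℝ) (Set.Ioi 1), 0 < (dedekindZeta K s).re ∧ EE K s = ENNReal.ofReal (dedekindZeta K s).re := by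
    filter_upwards [h'.eventually (lt_mem_nhds (dedekindZeta_residue_pos K)), self_mem_nhdsWithin] with s hs hs1
    have hs1 : (1 : ℝ) < s := hs1
    have hp : 0 < (dedekindZeta K s).re := by
      by_contra hn
      push Not at hn
      nlinarith
    refine ⟨hp, EE_eq K s (by linarith) ?_⟩
    by_contra hn
    have : dedekindZeta K s = 0 := by
      rw [dedekindZeta, LSeries]; exact tsum_eq_zero_of_not_summable hn
    rw [this] at hp; simp at hp
  constructor
  · refine h'.congr' ?_
    filter_upwards [hev] with s ⟨h1, h2⟩
    rw [h2, ENNReal.toReal_ofReal h1.le]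
  · filter_upwards [hev] with s ⟨h1, h2⟩
    rw [h2]; exact ENNReal.ofReal_ne_top
end
end Recip

end

section
open NumberField
open scoped nonZeroDivisors ENNReal
namespace Recip
set_option linter.unusedSectionVars false
section
variable {K : Type*} [Field K] [NumberField K]
open UniqueFactorizationMonoid

lemma wt_mul (s : ℝ) (I J : Ideal (𝓞 K)) : wt s (I * J) = wt s I * wt s J := by
  rw [wt, wt, wt, map_mul, Nat.cast_mul, Real.mul_rpow (by positivity) (by positivity), ENNReal.ofReal_mul (by positivity)]

lemma wt_le {s : ℝ} (hs : 1 ≤ s) {P : Ideal (𝓞 K)} (hP : P.IsPrime) (h0 : P ≠ ⊥) : wt s P ≤ 2⁻¹ := by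
  have h2 : 2 ≤ Ideal.absNorm P := by
    have h1 : Ideal.absNorm P ≠ 0 := by rwa [Ne, Ideal.absNorm_eq_zero_iff]
    have h1 : Ideal.absNorm P ≠ 1 := by rw [Ne, Ideal.absNorm_eq_one_iff]; exact hP.ne_top
    omega
  have : ((Ideal.absNorm P : ℝ) ^ (-s)) ≤ 2⁻¹ := by
    have h2' : (2 : ℝ) ≤ Ideal.absNorm P := by exact_mod_cast h2
    rw [← Real.rpow_neg_one 2]
    calc ((Ideal.absNorm P : ℝ) ^ (-s)) ≤ (2 : ℝ) ^ (-s) := Real.rpow_le_rpow_of_nonpos (by norm_num) h2' (by linarith)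
      _ ≤ _ := Real.rpow_le_rpow_of_exponent_le (by norm_num) (by linarith)
  calc wt s P ≤ ENNReal.ofReal 2⁻¹ := ENNReal.ofReal_le_ofReal this
    _ = 2⁻¹ := by rw [ENNReal.ofReal_inv_of_pos (by norm_num)]; simp

open Classical in
/-- sum over ideals avoiding a finite set of primes -/
noncomputable def ZZ (s : ℝ) (S : Finset (Ideal (𝓞 K))) : ℝ≥0∞ :=
  ∑' I : Ideal (𝓞 K), if ∀ P ∈ S, ¬ I ≤ P then wt s I else 0

lemma ZZ_le (s : ℝ) (S : Finset (Ideal (𝓞 K))) : ZZ s S ≤ EE K s := by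
  classical
  refine ENNReal.tsum_le_tsum fun I => ?_
  split_ifs <;> simp

open Classical in
lemma ZZ_step {s : ℝ} (hs : 1 ≤ s) (S : Finset (Ideal (𝓞 K))) {P : Ideal (𝓞 K)} (hP : P.IsPrime) (h0 : P ≠ ⊥) :
    ZZ s S ≤ ZZ s (insert P S) + 2⁻¹ * ZZ s S := by
  have h1 : ZZ s S = ZZ s (insert P S) + ∑' I : Ideal (𝓞 K), if (∀ P ∈ S, ¬ I ≤ P) ∧ I ≤ P then wt s I else 0 := by
    rw [ZZ, ZZ, ← ENNReal.tsum_add]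
    refine tsum_congr fun I => ?_
    by_cases h : ∀ P ∈ S, ¬ I ≤ P
    · by_cases h' : I ≤ P
      · simp [h']
      · simp [h']
    · rw [if_neg h, if_neg (fun h' => h fun Q hQ => h' Q (Finset.mem_insert_of_mem hQ)), if_neg (fun h' => h h'.1), add_zero]
  conv_lhs => rw [h1]
  gcongr
  have hinj : Function.Injective (fun J : Ideal (𝓞 K) => P * J) := mul_right_injective₀ h0
  rw [← hinj.tsum_eq, ZZ, ← ENNReal.tsum_mul_left]
  · refine ENNReal.tsum_le_tsum fun J => ?_
    by_cases h : (∀ Q ∈ S, ¬ P * J ≤ Q) ∧ P * J ≤ P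
    · rw [if_pos h, if_pos (fun Q hQ hJ => h.1 Q hQ (Ideal.mul_le_right.trans hJ)), wt_mul]
      gcongr
      exact wt_le hs hP h0
    · rw [if_neg h]; simp
  · intro I hI
    rw [Function.mem_support] at hI
    have : I ≤ P := by
      by_contra hn
      apply hI; rw [if_neg]; tauto
    obtain ⟨J, rfl⟩ := Ideal.dvd_iff_le.2 this
    exact ⟨J, rfl⟩

lemma ZZ_ge {s : ℝ} (hs : 1 ≤ s) (hfin : EE K s ≠ ⊤) (S : Finset (Ideal (𝓞 K))) (hS : ∀ P ∈ S, P.IsPrime ∧ P ≠ ⊥) :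
    EE K s ≤ 2 ^ S.card * ZZ s S := by
  classical
  induction S using Finset.induction_on with
  | empty => simp [EE, ZZ]
  | insert P S hPS ih =>
    have h1 := ih (fun Q hQ => hS Q (Finset.mem_insert_of_mem hQ))
    obtain ⟨hP, h0⟩ := hS P (Finset.mem_insert_self _ _)
    have h2 := ZZ_step hs S hP h0
    have hf : ZZ s S ≠ ⊤ := ne_top_of_le_ne_top hfin (ZZ_le s S)
    have h3 : ZZ s S ≤ 2 * ZZ s (insert P S) := by
      have h4 : 2⁻¹ * ZZ s S + 2⁻¹ * ZZ s S = ZZ s S := by rw [← add_mul, ENNReal.inv_two_add_inv_two, one_mul]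
      have h5 : 2⁻¹ * ZZ s S ≠ ⊤ := ENNReal.mul_ne_top (by simp) hf
      have h6 : 2⁻¹ * ZZ s S ≤ ZZ s (insert P S) := by
        nth_rewrite 1 [← h4] at h2
        exact (ENNReal.add_le_add_iff_right h5).1 h2
      calc ZZ s S = 2 * (2⁻¹ * ZZ s S) := by rw [← mul_assoc, ENNReal.mul_inv_cancel (by simp) (by simp), one_mul]
        _ ≤ _ := by gcongr
    rw [Finset.card_insert_of_notMem hPS, pow_succ, mul_assoc]
    exact h1.trans (by gcongr)

lemma wt_prod (s : ℝ) (m : Multiset (Ideal (𝓞 K))) : wt s m.prod = (m.map (wt s)).prod := by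
  induction m using Multiset.induction_on with
  | empty => simp [wt]
  | cons a m ih => rw [Multiset.prod_cons, wt_mul, ih, Multiset.map_cons, Multiset.prod_cons]

lemma nf_prod {m : Multiset (Ideal (𝓞 K))} (hm : ∀ P ∈ m, P.IsPrime ∧ P ≠ ⊥) : normalizedFactors m.prod = m := by
  refine normalizedFactors_prod_of_prime fun P hP => ?_
  exact Ideal.prime_of_isPrime (hm P hP).2 (hm P hP).1

lemma ZZ_sq {L : Type*} [Field L] [NumberField L] (s : ℝ) (S : Finset (Ideal (𝓞 K))) (hSn : S.Nonempty)
    (Q₁ Q₂ : Ideal (𝓞 K) → Ideal (𝓞 L)) (cm : Ideal (𝓞 L) → Ideal (𝓞 K))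
    (hQ : ∀ P : Ideal (𝓞 K), P.IsPrime → P ≠ ⊥ → P ∉ S → ((Q₁ P).IsPrime ∧ Q₁ P ≠ ⊥ ∧ cm (Q₁ P) = P ∧ Ideal.absNorm (Q₁ P) = Ideal.absNorm P) ∧
      ((Q₂ P).IsPrime ∧ Q₂ P ≠ ⊥ ∧ cm (Q₂ P) = P ∧ Ideal.absNorm (Q₂ P) = Ideal.absNorm P) ∧ Q₁ P ≠ Q₂ P) :
    ZZ s S * ZZ s S ≤ EE L s := by
  classical
  let A := {I : Ideal (𝓞 K) | ∀ P ∈ S, ¬ I ≤ P}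
  have hZ : ZZ s S = ∑' I : A, wt s (I : Ideal (𝓞 K)) := by
    rw [ZZ, tsum_subtype A (wt s)]
    refine tsum_congr fun I => ?_
    rw [Set.indicator_apply]; rfl
  have hA0 : ∀ I : A, (I : Ideal (𝓞 K)) ≠ ⊥ := fun I h => by
    obtain ⟨P, hP⟩ := hSn
    exact I.2 P hP (h ▸ bot_le)
  have hnf : ∀ I : A, ∀ P ∈ normalizedFactors (I : Ideal (𝓞 K)), P.IsPrime ∧ P ≠ ⊥ ∧ P ∉ S := by
    intro I P hP
    have h1 := prime_of_normalized_factor P hP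
    exact ⟨Ideal.isPrime_of_prime h1, h1.ne_zero, fun h => I.2 P h (Ideal.dvd_iff_le.1 (dvd_of_mem_normalizedFactors hP))⟩
  have hprod : ∀ I : A, (normalizedFactors (I : Ideal (𝓞 K))).prod = I := fun I => Ideal.prod_normalizedFactors_eq_self (hA0 I)
  let M : A × A → Multiset (Ideal (𝓞 L)) := fun p => (normalizedFactors (p.1 : Ideal (𝓞 K))).map Q₁ + (normalizedFactors (p.2 : Ideal (𝓞 K))).map Q₂
  have hM : ∀ p, ∀ Q ∈ M p, Q.IsPrime ∧ Q ≠ ⊥ := by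
    intro p Q hQ'
    rcases Multiset.mem_add.1 hQ' with h | h <;> obtain ⟨P, hP, rfl⟩ := Multiset.mem_map.1 h
    · obtain ⟨a, b, c⟩ := hnf _ P hP; exact ⟨(hQ P a b c).1.1, (hQ P a b c).1.2.1⟩
    · obtain ⟨a, b, c⟩ := hnf _ P hP; exact ⟨(hQ P a b c).2.1.1, (hQ P a b c).2.1.2.1⟩
  have hf1 : ∀ p, ((M p).filter (fun Q => Q = Q₁ (cm Q))) = (normalizedFactors (p.1 : Ideal (𝓞 K))).map Q₁ := by
    intro p
    rw [Multiset.filter_add, Multiset.filter_eq_self.2, Multiset.filter_eq_nil.2, add_zero]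
    · intro Q h; obtain ⟨P, hP, rfl⟩ := Multiset.mem_map.1 h
      obtain ⟨a, b, c⟩ := hnf _ P hP
      rw [(hQ P a b c).2.1.2.2.1]; exact (hQ P a b c).2.2.symm
    · intro Q h; obtain ⟨P, hP, rfl⟩ := Multiset.mem_map.1 h
      obtain ⟨a, b, c⟩ := hnf _ P hP
      rw [(hQ P a b c).1.2.2.1]
  have hf2 : ∀ p, ((M p).filter (fun Q => ¬ Q = Q₁ (cm Q))) = (normalizedFactors (p.2 : Ideal (𝓞 K))).map Q₂ := by
    intro p
    rw [Multiset.filter_add, Multiset.filter_eq_nil.2, Multiset.filter_eq_self.2, zero_add]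
    · intro Q h; obtain ⟨P, hP, rfl⟩ := Multiset.mem_map.1 h
      obtain ⟨a, b, c⟩ := hnf _ P hP
      rw [(hQ P a b c).2.1.2.2.1]; exact (hQ P a b c).2.2.symm
    · intro Q h; obtain ⟨P, hP, rfl⟩ := Multiset.mem_map.1 h
      obtain ⟨a, b, c⟩ := hnf _ P hP
      rw [(hQ P a b c).1.2.2.1]; simp
  have hc1 : ∀ I : A, ((normalizedFactors (I : Ideal (𝓞 K))).map Q₁).map cm = normalizedFactors (I : Ideal (𝓞 K)) := by
    intro I
    rw [Multiset.map_map, Multiset.map_congr rfl (g := id), Multiset.map_id]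
    intro P hP
    obtain ⟨a, b, c⟩ := hnf _ P hP
    exact (hQ P a b c).1.2.2.1
  have hc2 : ∀ I : A, ((normalizedFactors (I : Ideal (𝓞 K))).map Q₂).map cm = normalizedFactors (I : Ideal (𝓞 K)) := by
    intro I
    rw [Multiset.map_map, Multiset.map_congr rfl (g := id), Multiset.map_id]
    intro P hP
    obtain ⟨a, b, c⟩ := hnf _ P hP
    exact (hQ P a b c).2.1.2.2.1
  have hinj : Function.Injective (fun p : A × A => (M p).prod) := by
    intro p q hpq
    have hMM : M p = M q := by
      rw [← nf_prod (hM p), ← nf_prod (hM q)]; exact congrArg _ hpq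
    refine Prod.ext (Subtype.ext ?_) (Subtype.ext ?_)
    · rw [← hprod, ← hprod q.1, ← hc1, ← hc1 q.1, ← hf1, ← hf1, hMM]
    · rw [← hprod, ← hprod q.2, ← hc2, ← hc2 q.2, ← hf2, ← hf2, hMM]
  have hwt : ∀ p : A × A, wt s (M p).prod = wt s (p.1 : Ideal (𝓞 K)) * wt s (p.2 : Ideal (𝓞 K)) := by
    intro p
    rw [wt_prod, Multiset.map_add, Multiset.prod_add]
    conv_rhs => rw [← hprod p.1, ← hprod p.2, wt_prod, wt_prod]
    rw [Multiset.map_map, Multiset.map_map]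
    congr 2
    · refine Multiset.map_congr rfl fun P hP => ?_
      obtain ⟨a, b, c⟩ := hnf _ P hP
      rw [Function.comp, wt, wt, (hQ P a b c).1.2.2.2]
    · refine Multiset.map_congr rfl fun P hP => ?_
      obtain ⟨a, b, c⟩ := hnf _ P hP
      rw [Function.comp, wt, wt, (hQ P a b c).2.1.2.2.2]
  have h2 : ZZ s S * ZZ s S = ∑' p : A × A, wt s (M p).prod := by
    rw [tsum_congr hwt, ENNReal.tsum_prod', hZ, ← ENNReal.tsum_mul_right]
    refine tsum_congr fun I => ?_
    exact ENNReal.tsum_mul_left.symm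
  rw [h2]
  exact ENNReal.tsum_comp_le_tsum_of_injective hinj _

/-- Contradiction: not almost all primes split completely in a quadratic extension. -/
lemma not_all_split (K L : Type*) [Field K] [NumberField K] [Field L] [NumberField L] (S : Finset (Ideal (𝓞 K))) (hSn : S.Nonempty)
    (hS : ∀ P ∈ S, P.IsPrime ∧ P ≠ ⊥)
    (Q₁ Q₂ : Ideal (𝓞 K) → Ideal (𝓞 L)) (cm : Ideal (𝓞 L) → Ideal (𝓞 K))
    (hQ : ∀ P : Ideal (𝓞 K), P.IsPrime → P ≠ ⊥ → P ∉ S → ((Q₁ P).IsPrime ∧ Q₁ P ≠ ⊥ ∧ cm (Q₁ P) = P ∧ Ideal.absNorm (Q₁ P) = Ideal.absNorm P) ∧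
      ((Q₂ P).IsPrime ∧ Q₂ P ≠ ⊥ ∧ cm (Q₂ P) = P ∧ Ideal.absNorm (Q₂ P) = Ideal.absNorm P) ∧ Q₁ P ≠ Q₂ P) : False := by
  obtain ⟨hK, hKf⟩ := EE_asymp K
  obtain ⟨hL, hLf⟩ := EE_asymp L
  have hbound : ∀ᶠ s : ℝ in nhdsWithin (1 : ℝ) (Set.Ioi 1), ((s - 1) * (EE K s).toReal) ^ 2 ≤ (4 ^ S.card * (s - 1)) * ((s - 1) * (EE L s).toReal) := by
    filter_upwards [hKf, hLf, self_mem_nhdsWithin] with s h1 h2 h3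
    have h3 : (1 : ℝ) < s := h3
    have e1 := ZZ_ge h3.le h1 S hS
    have e2 := ZZ_sq s S hSn Q₁ Q₂ cm hQ
    have e3 : EE K s * EE K s ≤ 4 ^ S.card * EE L s := by
      calc EE K s * EE K s ≤ (2 ^ S.card * ZZ s S) * (2 ^ S.card * ZZ s S) := by gcongr
        _ = (2 ^ S.card * 2 ^ S.card) * (ZZ s S * ZZ s S) := by ring
        _ = 4 ^ S.card * (ZZ s S * ZZ s S) := by rw [← mul_pow]; norm_num
        _ ≤ _ := by gcongr
    have e4 : (EE K s).toReal * (EE K s).toReal ≤ 4 ^ S.card * (EE L s).toReal := by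
      have := ENNReal.toReal_mono (ENNReal.mul_ne_top (by simp) h2) e3
      simpa [ENNReal.toReal_mul] using this
    have : 0 ≤ (s - 1) ^ 2 := sq_nonneg _
    nlinarith [mul_le_mul_of_nonneg_left e4 this]
  have t1 : Filter.Tendsto (fun s : ℝ => (4 ^ S.card * (s - 1))) (nhdsWithin 1 (Set.Ioi 1)) (nhds 0) := by
    have : Filter.Tendsto (fun s : ℝ => (4 ^ S.card * (s - 1))) (nhds 1) (nhds (4 ^ S.card * (1 - 1))) :=
      (continuous_const.mul (continuous_id.sub continuous_const)).tendsto 1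
    rw [sub_self, mul_zero] at this
    exact this.mono_left nhdsWithin_le_nhds
  have h0 := le_of_tendsto_of_tendsto (hK.pow 2) (t1.mul hL) hbound
  have := dedekindZeta_residue_pos K
  rw [zero_mul] at h0
  nlinarith
end
end Recip

end

section
open NumberField
open scoped nonZeroDivisors ENNReal
namespace Recip
set_option linter.unusedSectionVars false
section
variable {K L : Type*} [Field K] [NumberField K] [Field L] [NumberField L] [Algebra K L]

lemma split_prime (hfr : Module.finrank K L = 2) (θ : 𝓞 L) (z : 𝓞 K) (hθ : θ ^ 2 = algebraMap (𝓞 K) (𝓞 L) z)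
    (σ : 𝓞 L ≃ₐ[𝓞 K] 𝓞 L) (hσ : σ θ = -θ) (P : Ideal (𝓞 K)) (hP : P.IsPrime) (h0 : P ≠ ⊥) (hz : z ∉ P) (h2 : (2 : 𝓞 K) ∉ P)
    (c : 𝓞 K) (hc : z - c ^ 2 ∈ P) : ∃ Q₁ Q₂ : Ideal (𝓞 L),
      (Q₁.IsPrime ∧ Q₁ ≠ ⊥ ∧ Q₁.comap (algebraMap (𝓞 K) (𝓞 L)) = P ∧ Ideal.absNorm Q₁ = Ideal.absNorm P) ∧
      (Q₂.IsPrime ∧ Q₂ ≠ ⊥ ∧ Q₂.comap (algebraMap (𝓞 K) (𝓞 L)) = P ∧ Ideal.absNorm Q₂ = Ideal.absNorm P) ∧ Q₁ ≠ Q₂ := by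
  classical
  obtain ⟨Q, hQ, hQP⟩ : ∃ Q : Ideal (𝓞 L), Q.IsPrime ∧ Q.LiesOver P := Ideal.exists_isPrime_liesOver_of_faithfullyFlat P
  have hcm : Q.comap (algebraMap (𝓞 K) (𝓞 L)) = P := (hQP.over).symm
  let Q2 := Q.comap σ
  have hQ2 : Q2.IsPrime := Ideal.IsPrime.comap σ
  have hcm2 : Q2.comap (algebraMap (𝓞 K) (𝓞 L)) = P := by
    ext x
    rw [Ideal.mem_comap, Ideal.mem_comap, AlgEquiv.commutes, ← Ideal.mem_comap, hcm]
  have hQ2P : Q2.LiesOver P := ⟨hcm2.symm⟩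
  have hne : Q ≠ Q2 := by
    intro heq
    have hs : ∀ x, x ∈ Q → σ x ∈ Q := fun x hx => by
      rw [heq] at hx; exact hx
    have hm : ∀ e : 𝓞 K, θ - algebraMap (𝓞 K) (𝓞 L) e ∈ Q → 2 * e ∈ P := by
      intro e he
      have h1 := hs _ he
      rw [map_sub, hσ, AlgEquiv.commutes] at h1
      have h3 := neg_mem (add_mem he h1)
      rw [← hcm, Ideal.mem_comap, map_mul, map_ofNat]
      convert h3 using 1
      ring
    have hprod : (θ - algebraMap (𝓞 K) (𝓞 L) c) * (θ - algebraMap (𝓞 K) (𝓞 L) (-c)) ∈ Q := by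
      have : z - c ^ 2 ∈ Q.comap (algebraMap (𝓞 K) (𝓞 L)) := hcm ▸ hc
      rw [Ideal.mem_comap, map_sub, map_pow, ← hθ] at this
      convert this using 1
      rw [map_neg]; ring
    have h2c : 2 * c ∈ P := by
      rcases hQ.mem_or_mem hprod with h | h
      · exact hm c h
      · have := neg_mem (hm _ h); simpa using this
    rcases hP.mem_or_mem h2c with h | h
    · exact h2 h
    · apply hz
      have := add_mem hc (Ideal.mul_mem_left P c h)
      convert this using 1; ring
  have : Fintype (P.primesOver (𝓞 L)) := (Algebra.QuasiFinite.finite_primesOver P).fintype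
  have hsum := Ideal.sum_ramification_inertia_eq_finrank P (𝓞 L)
  rw [← IsFractionRing.finrank_eq (𝓞 K) K (𝓞 L) L, hfr] at hsum
  let q1 : P.primesOver (𝓞 L) := ⟨Q, hQ, hQP⟩
  let q2 : P.primesOver (𝓞 L) := ⟨Q2, hQ2, hQ2P⟩
  have hq : q1 ≠ q2 := fun h => hne (congrArg Subtype.val h)
  have hle : ∑ q ∈ ({q1, q2} : Finset (P.primesOver (𝓞 L))), q.1.ramificationIdx (𝓞 K) * q.1.inertiaDeg (𝓞 K) ≤ 2 := by
    rw [← hsum]; exact Finset.sum_le_sum_of_subset (Finset.subset_univ _)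
  rw [Finset.sum_pair hq] at hle
  have p1 : 0 < Q.ramificationIdx (𝓞 K) := Ideal.ramificationIdx_pos Q (𝓞 K)
  have p2 : 0 < Q2.ramificationIdx (𝓞 K) := Ideal.ramificationIdx_pos Q2 (𝓞 K)
  have p3 : 0 < Q.inertiaDeg (𝓞 K) := Ideal.inertiaDeg_pos Q (𝓞 K)
  have p4 : 0 < Q2.inertiaDeg (𝓞 K) := Ideal.inertiaDeg_pos Q2 (𝓞 K)
  have hle' : Q.ramificationIdx (𝓞 K) * Q.inertiaDeg (𝓞 K) + Q2.ramificationIdx (𝓞 K) * Q2.inertiaDeg (𝓞 K) ≤ 2 := hle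
  have f1 : Q.inertiaDeg (𝓞 K) = 1 := by nlinarith
  have f2 : Q2.inertiaDeg (𝓞 K) = 1 := by nlinarith
  have n1 := Ideal.absNorm_pow_inertiaDeg P Q
  have n2 := Ideal.absNorm_pow_inertiaDeg P Q2
  rw [f1, pow_one] at n1
  rw [f2, pow_one] at n2
  have hb : ∀ Q' : Ideal (𝓞 L), Q'.comap (algebraMap (𝓞 K) (𝓞 L)) = P → Q' ≠ ⊥ := by
    rintro Q' h rfl
    apply h0
    rw [← h, ← RingHom.ker_eq_comap_bot, (RingHom.injective_iff_ker_eq_bot _).1 (FaithfulSMul.algebraMap_injective (𝓞 K) (𝓞 L))]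
  exact ⟨Q, Q2, ⟨hQ, hb _ hcm, hcm, n1.symm⟩, ⟨hQ2, hb _ hcm2, hcm2, n2.symm⟩, hne⟩
end

lemma inert_aux {K L : Type*} [Field K] [NumberField K] [Field L] [NumberField L] [Algebra K L] (hfr : Module.finrank K L = 2) (θ : L) (z : 𝓞 K)
    (hθ : θ ^ 2 = algebraMap K L (algebraMap (𝓞 K) K z)) (hz : z ≠ 0)
    (τ : L ≃ₐ[K] L) (hσ : τ θ = -θ) (N : Ideal (𝓞 K)) (hN : N ≠ ⊥) :
    ∃ P : Ideal (𝓞 K), P.IsPrime ∧ P ≠ ⊥ ∧ ¬ N ≤ P ∧ leg P z = -1 := by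
  classical
  have hθint : IsIntegral ℤ θ := by
    apply IsIntegral.of_pow (n := 2) (by norm_num)
    rw [hθ]
    exact (z.2.map (algebraMap K L : K →+* L).toIntAlgHom)
  let θ' : 𝓞 L := ⟨θ, hθint⟩
  have hθ' : θ' ^ 2 = algebraMap (𝓞 K) (𝓞 L) z := by
    apply RingOfIntegers.ext
    exact hθ
  let σ : 𝓞 L ≃ₐ[𝓞 K] 𝓞 L := RingOfIntegers.mapAlgEquiv τ
  have hσ' : σ θ' = -θ' := by
    apply RingOfIntegers.ext
    exact hσ
  by_contra hcon
  push Not at hcon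
  let M := N * Ideal.span {2 * z}
  have hM : M ≠ ⊥ := mul_ne_zero hN (span_ne (mul_ne_zero two_ne_zero hz))
  have hfin : {P : Ideal (𝓞 K) | M ≤ P}.Finite := by
    have : Fintype {P : Ideal (𝓞 K) // P ∣ M} := UniqueFactorizationMonoid.fintypeSubtypeDvd M hM
    have h2 : {P : Ideal (𝓞 K) | M ≤ P} = {P | P ∣ M} := by
      ext P; exact Ideal.dvd_iff_le.symm
    rw [h2]; exact Set.finite_coe_iff.1 (Finite.of_fintype {P : Ideal (𝓞 K) // P ∣ M})
  obtain ⟨P₀, hP₀⟩ : ∃ P : Ideal (𝓞 K), P.IsPrime ∧ P ≠ ⊥ := by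
    obtain ⟨P, hP⟩ := Ideal.exists_maximal (𝓞 K)
    refine ⟨P, hP.isPrime, ?_⟩
    exact Ring.ne_bot_of_isMaximal_of_not_isField hP (RingOfIntegers.not_isField K)
  let S : Finset (Ideal (𝓞 K)) := insert P₀ (hfin.toFinset.filter (fun P => P.IsPrime ∧ P ≠ ⊥))
  have hS : ∀ P ∈ S, P.IsPrime ∧ P ≠ ⊥ := by
    intro P hP
    rcases Finset.mem_insert.1 hP with rfl | hP
    · exact hP₀
    · exact (Finset.mem_filter.1 hP).2
  have hsp : ∀ P : Ideal (𝓞 K), ∃ Q : Ideal (𝓞 L) × Ideal (𝓞 L), P.IsPrime → P ≠ ⊥ → P ∉ S → 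
      (Q.1.IsPrime ∧ Q.1 ≠ ⊥ ∧ Q.1.comap (algebraMap (𝓞 K) (𝓞 L)) = P ∧ Ideal.absNorm Q.1 = Ideal.absNorm P) ∧
      (Q.2.IsPrime ∧ Q.2 ≠ ⊥ ∧ Q.2.comap (algebraMap (𝓞 K) (𝓞 L)) = P ∧ Ideal.absNorm Q.2 = Ideal.absNorm P) ∧ Q.1 ≠ Q.2 := by
    intro P
    by_cases h : P.IsPrime ∧ P ≠ ⊥ ∧ P ∉ S
    · obtain ⟨hP, h0, hPS⟩ := h
      have hMP : ¬ M ≤ P := fun h => hPS (Finset.mem_insert_of_mem (Finset.mem_filter.2 ⟨hfin.mem_toFinset.2 h, hP, h0⟩))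
      have h1 : ¬ N ≤ P := fun h => hMP (Ideal.mul_le_left.trans h)
      have h2 : 2 * z ∉ P := fun h => hMP (Ideal.mul_le_right.trans ((Ideal.span_singleton_le_iff_mem _).2 h))
      have h3 : z ∉ P := fun h => h2 (Ideal.mul_mem_left _ _ h)
      have h4 : (2 : 𝓞 K) ∉ P := fun h => h2 (Ideal.mul_mem_right _ _ h)
      have h5 := hcon P hP h0 h1
      have h6 : ∃ c, z - c ^ 2 ∈ P := by
        by_contra hn
        apply h5
        rw [leg, if_neg h3, if_neg hn]
      obtain ⟨c, hc⟩ := h6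
      obtain ⟨Q1, Q2, hQ⟩ := split_prime hfr θ' z hθ' σ hσ' P hP h0 h3 h4 c hc
      exact ⟨(Q1, Q2), fun _ _ _ => hQ⟩
    · exact ⟨(⊥, ⊥), fun a b c => absurd ⟨a, b, c⟩ h⟩
  choose Q hQ using hsp
  exact not_all_split K L S (Finset.insert_nonempty _ _) hS (fun P => (Q P).1) (fun P => (Q P).2) _ hQ

lemma inert_prime {K : Type*} [Field K] [NumberField K] (z : 𝓞 K) (hz : ¬ IsSquare (algebraMap (𝓞 K) K z)) (N : Ideal (𝓞 K)) (hN : N ≠ ⊥) :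
    ∃ P : Ideal (𝓞 K), P.IsPrime ∧ P ≠ ⊥ ∧ ¬ N ≤ P ∧ leg P z = -1 := by
  set a : K := algebraMap (𝓞 K) K z with ha
  have hirr : Irreducible (Polynomial.X ^ 2 - Polynomial.C a : Polynomial K) := by
    apply X_pow_sub_C_irreducible_of_prime Nat.prime_two
    intro b hb; exact hz ⟨b, by rw [← hb, sq]⟩
  have : Fact (Irreducible (Polynomial.X ^ 2 - Polynomial.C a : Polynomial K)) := ⟨hirr⟩
  let L := AdjoinRoot (Polynomial.X ^ 2 - Polynomial.C a : Polynomial K)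
  have hne : (Polynomial.X ^ 2 - Polynomial.C a : Polynomial K) ≠ 0 := hirr.ne_zero
  have hfd : FiniteDimensional K L := (AdjoinRoot.powerBasis hne).finite
  have hfr : Module.finrank K L = 2 := by
    rw [(AdjoinRoot.powerBasis hne).finrank, AdjoinRoot.powerBasis_dim]; simp
  have hcz : CharZero L := charZero_of_injective_algebraMap (algebraMap K L).injective
  have hfdQ : FiniteDimensional ℚ L := Module.Finite.trans K L
  have hNF : NumberField L := ⟨⟩
  have hroot : (AdjoinRoot.root _ : L) ^ 2 = algebraMap K L a := by
    have := AdjoinRoot.eval₂_root (Polynomial.X ^ 2 - Polynomial.C a : Polynomial K)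
    rw [Polynomial.eval₂_sub, Polynomial.eval₂_pow, Polynomial.eval₂_X, Polynomial.eval₂_C, sub_eq_zero] at this
    exact this
  let f : L →ₐ[K] L := AdjoinRoot.liftAlgHom _ (Algebra.ofId K L) (-(AdjoinRoot.root _ : L)) (by
    rw [Polynomial.eval₂_sub, Polynomial.eval₂_pow, Polynomial.eval₂_X, Polynomial.eval₂_C, neg_sq, hroot]
    simp [Algebra.ofId_apply])
  let τ : L ≃ₐ[K] L := AlgEquiv.ofBijective f (Algebra.IsAlgebraic.algHom_bijective f)
  refine inert_aux hfr (AdjoinRoot.root _ : L) z hroot ?_ τ ?_ N hN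
  · rintro rfl; exact hz ⟨0, by simp [ha]⟩
  · rw [AlgEquiv.ofBijective_apply]
    exact AdjoinRoot.liftAlgHom_root _ _ _ _
end Recip

end

section
namespace Recip
section
variable {F A B : Type*} [Field F] [AddCommGroup A] [Module F A] [FiniteDimensional F A]
  [AddCommGroup B] [Module F B] [FiniteDimensional F B]

/-- Lagrangian bookkeeping: an isotropic subspace of a sum of two symmetric spaces. -/
lemma lagrangian (bA : LinearMap.BilinForm F A) (bB : LinearMap.BilinForm F B)
    (sA : ∀ x y, bA x y = bA y x) (sB : ∀ x y, bB x y = bB y x) (nA : bA.Nondegenerate)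
    (W : Submodule F (A × B))
    (hW : ∀ x ∈ W, ∀ y ∈ W, bA x.1 y.1 + bB x.2 y.2 = 0)
    (R ρ ν : ℕ)
    (h1 : ν * 2 ^ (Module.finrank F (W ⊓ (⊥ : Submodule F A).prod (LinearMap.ker bB) : Submodule F (A × B))) ≤ 2 ^ ρ)
    (h2 : 2 ^ (R + ρ) ≤ ν * 2 ^ (Module.finrank F W))
    (h3 : Module.finrank F A + Module.finrank F B ≤ 2 * R) :
    ν = 2 ^ ρ ∧ Module.finrank F (W ⊓ (⊤ : Submodule F A).prod ⊥ : Submodule F (A × B)) +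
      Module.finrank F (W.map (LinearMap.fst F A B)) = Module.finrank F A := by
  let b : LinearMap.BilinForm F (A × B) :=
    bA.compl₁₂ (LinearMap.fst F A B) (LinearMap.fst F A B) +
    bB.compl₁₂ (LinearMap.snd F A B) (LinearMap.snd F A B)
  have hb : ∀ x y, b x y = bA x.1 y.1 + bB x.2 y.2 := fun x y => rfl
  have hbr : b.IsRefl := by
    intro x y h
    rw [hb] at h ⊢
    rw [sA, sB, h]
  have nA' : ∀ x, (∀ y, bA x y = 0) → x = 0 := fun x hx => nA.1 x hx
  have htop : b.orthogonal ⊤ = (⊥ : Submodule F A).prod (LinearMap.ker bB) := by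
    ext ⟨x, y⟩
    rw [LinearMap.BilinForm.mem_orthogonal_iff, Submodule.mem_prod, LinearMap.mem_ker, Submodule.mem_bot]
    constructor
    · intro h
      constructor
      · apply nA'
        intro a
        have := h (a, 0) trivial
        rw [hb] at this
        simpa [sA a x] using this
      · ext c
        have := h (0, c) trivial
        rw [hb] at this
        simpa [sB c y] using this
    · rintro ⟨h, h'⟩ ⟨a, c⟩ -
      simp only at h h'
      rw [hb, sB, h', h]
      simp
  have hle : W ≤ b.orthogonal W := by
    intro x hx
    rw [LinearMap.BilinForm.mem_orthogonal_iff]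
    intro y hy
    exact hW y hy x hx
  have e1 := LinearMap.BilinForm.finrank_add_finrank_orthogonal hbr W
  rw [htop, Module.finrank_prod] at e1
  have e2 := Submodule.finrank_mono hle
  set k := Module.finrank F (W ⊓ (⊥ : Submodule F A).prod (LinearMap.ker bB) : Submodule F (A × B)) with hk
  set w := Module.finrank F W with hw
  have hwk : R + k ≤ w := by
    have h4 : ν * 2 ^ k * 2 ^ (R + k) ≤ ν * 2 ^ k * 2 ^ w := by
      calc ν * 2 ^ k * 2 ^ (R + k) ≤ 2 ^ ρ * 2 ^ (R + k) := Nat.mul_le_mul_right _ h1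
        _ = 2 ^ (R + ρ) * 2 ^ k := by ring
        _ ≤ ν * 2 ^ w * 2 ^ k := Nat.mul_le_mul_right _ h2
        _ = _ := by ring
    have hν : 0 < ν := by
      rcases Nat.eq_zero_or_pos ν with h | h
      · subst h; simp at h2
      · exact h
    have h5 := Nat.le_of_mul_le_mul_left h4 (by positivity)
    exact (Nat.pow_le_pow_iff_right (by norm_num)).1 h5
  have k0 : k = 0 := by omega
  have w0 : w = R := by omega
  have heq : W = b.orthogonal W := Submodule.eq_of_le_of_finrank_eq hle (by omega)
  constructor
  · rw [k0] at h1; rw [w0] at h2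
    apply le_antisymm (by simpa using h1)
    rw [pow_add, mul_comm] at h2
    exact Nat.le_of_mul_le_mul_right h2 (by positivity)
  · have e3 := LinearMap.BilinForm.finrank_orthogonal nA (W.map (LinearMap.fst F A B))
    have e4 := Submodule.finrank_le (W.map (LinearMap.fst F A B))
    have e5 : W ⊓ (⊤ : Submodule F A).prod ⊥ = (bA.orthogonal (W.map (LinearMap.fst F A B))).map (LinearMap.inl F A B) := by
      ext ⟨x, y⟩
      rw [Submodule.mem_inf, Submodule.mem_prod, Submodule.mem_map]
      constructor
      · rintro ⟨h, -, h'⟩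
        refine ⟨x, ?_, by simp only [Submodule.mem_bot] at h'; rw [h']; rfl⟩
        rw [LinearMap.BilinForm.mem_orthogonal_iff]
        rintro _ ⟨⟨p, q⟩, hp, rfl⟩
        have := hW _ hp _ h
        simp only [Submodule.mem_bot] at h'
        rw [h'] at this
        simpa using this
      · rintro ⟨a, ha, h⟩
        simp only [LinearMap.inl_apply, Prod.mk.injEq] at h
        obtain ⟨rfl, rfl⟩ := h
        refine ⟨?_, trivial, by simp⟩
        rw [heq, LinearMap.BilinForm.mem_orthogonal_iff]
        intro p hp
        rw [LinearMap.BilinForm.mem_orthogonal_iff] at ha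
        rw [hb]
        have := ha p.1 ⟨p, hp, rfl⟩
        simp [this]
    rw [e5, (Submodule.equivMapOfInjective (LinearMap.inl F A B) LinearMap.inl_injective (bA.orthogonal (W.map (LinearMap.fst F A B)))).symm.finrank_eq]
    omega
end
end Recip

end

section
open NumberField
open scoped nonZeroDivisors
namespace Recip
set_option linter.unusedSectionVars false
section
variable (K : Type*) [Field K] [NumberField K]

/-- squares in `(O/4)ˣ` -/
def sq4 : Subgroup (𝓞 K ⧸ Ideal.span {(4 : 𝓞 K)})ˣ := (powMonoidHom 2 : (𝓞 K ⧸ Ideal.span {(4 : 𝓞 K)})ˣ →* _).range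

def V2 : Type _ := Additive ((𝓞 K ⧸ Ideal.span {(4 : 𝓞 K)})ˣ ⧸ sq4 K)

noncomputable instance : AddCommGroup (V2 K) := inferInstanceAs (AddCommGroup (Additive _))

lemma V2_two (x : V2 K) : 2 • x = 0 := by
  change Additive ((𝓞 K ⧸ Ideal.span {(4 : 𝓞 K)})ˣ ⧸ sq4 K) at x
  change ((Additive.toMul x) ^ 2 : (𝓞 K ⧸ Ideal.span {(4 : 𝓞 K)})ˣ ⧸ sq4 K) = 1
  obtain ⟨u, hu⟩ := QuotientGroup.mk_surjective (Additive.toMul x)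
  rw [← hu, ← QuotientGroup.mk_pow, QuotientGroup.eq_one_iff]
  exact ⟨u, rfl⟩

noncomputable instance : Module (ZMod 2) (V2 K) := AddCommGroup.zmodModule (V2_two K)

instance : Finite (𝓞 K ⧸ Ideal.span {(4 : 𝓞 K)}) :=
  Ideal.finiteQuotientOfFreeOfNeBot _ (span_ne (by norm_num))

instance : Finite (V2 K) := inferInstanceAs (Finite ((𝓞 K ⧸ Ideal.span {(4 : 𝓞 K)})ˣ ⧸ sq4 K))

variable {K}
abbrev q4 (a : 𝓞 K) : 𝓞 K ⧸ Ideal.span {(4 : 𝓞 K)} := Ideal.Quotient.mk _ a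

variable (K) in
def uc (u : (𝓞 K ⧸ Ideal.span {(4 : 𝓞 K)})ˣ) : V2 K := Additive.ofMul (QuotientGroup.mk (s := sq4 K) u)

lemma uc_mul (u v) : uc K (u * v) = uc K u + uc K v := rfl

lemma uc_zero (u) : uc K u = 0 ↔ u ∈ sq4 K := QuotientGroup.eq_one_iff _

lemma uc_surj (v : V2 K) : ∃ u, uc K u = v := QuotientGroup.mk_surjective (s := sq4 K) (Additive.toMul v)

open Classical in
noncomputable def cl (a : 𝓞 K) : V2 K :=
  if h : IsUnit (q4 a) then uc K h.unit else 0

lemma cop_sup {I J : Ideal (𝓞 K)} : IsCoprime I J ↔ ∃ i ∈ I, ∃ j ∈ J, i + j = 1 := Ideal.isCoprime_iff_exists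

lemma span4 : Ideal.span {(4 : 𝓞 K)} = Ideal.span {(2 : 𝓞 K)} * Ideal.span {(2 : 𝓞 K)} := by
  rw [Ideal.span_singleton_mul_span_singleton]; norm_num

lemma cop4 {I : Ideal (𝓞 K)} (h : IsCoprime I (Ideal.span {2})) : IsCoprime I (Ideal.span {(4 : 𝓞 K)}) := by
  rw [span4]; exact h.mul_right h

lemma odd_unit {a : 𝓞 K} (h : IsCoprime (Ideal.span {a}) (Ideal.span {(2 : 𝓞 K)})) : IsUnit (q4 a) := by
  obtain ⟨i, hi, j, hj, hij⟩ := cop_sup.1 (cop4 h)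
  obtain ⟨c, rfl⟩ := Ideal.mem_span_singleton'.1 hi
  apply IsUnit.of_mul_eq_one (q4 c)
  rw [← map_mul, ← map_one (Ideal.Quotient.mk _), Ideal.Quotient.eq]
  rw [← hij]
  have : a * c - (c * a + j) = -j := by ring
  rw [this]; exact neg_mem hj

lemma unit_odd {a : 𝓞 K} (h : IsUnit (q4 a)) : IsCoprime (Ideal.span {a}) (Ideal.span {(2 : 𝓞 K)}) := by
  obtain ⟨c, hc⟩ := h.exists_right_inv
  obtain ⟨c, rfl⟩ := Ideal.Quotient.mk_surjective c
  rw [← map_mul, ← map_one (Ideal.Quotient.mk _), Ideal.Quotient.eq] at hc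
  rw [cop_sup]
  refine ⟨a * c, Ideal.mul_mem_right _ _ (Ideal.mem_span_singleton_self a), 1 - a * c, ?_, by ring⟩
  have := neg_mem hc
  rw [span4] at this
  have := Ideal.mul_le_left this
  convert this using 1; ring

lemma span2_ne_top : Ideal.span {(2 : 𝓞 K)} ≠ ⊤ := by
  intro h
  have h1 := congrArg Ideal.absNorm h
  rw [Ideal.absNorm_span_singleton, Ideal.absNorm_top] at h1
  have h2 : Algebra.norm ℤ (2 : 𝓞 K) = 2 ^ Module.finrank ℤ (𝓞 K) := by
    have := Algebra.norm_algebraMap (S := 𝓞 K) (2 : ℤ)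
    simpa using this
  rw [h2, Int.natAbs_pow, RingOfIntegers.rank] at h1
  have : 0 < Module.finrank ℚ K := Module.finrank_pos
  have h3 := Nat.one_lt_pow this.ne' (show 1 < (2 : ℤ).natAbs by norm_num)
  omega

lemma odd_ne {a : 𝓞 K} (h : IsCoprime (Ideal.span {a}) (Ideal.span {(2 : 𝓞 K)})) : a ≠ 0 := by
  rintro rfl
  rw [Ideal.span_singleton_zero] at h
  apply span2_ne_top (K := K)
  simpa [Ideal.isCoprime_iff_sup_eq] using h

lemma odd_mul {a b : 𝓞 K} {I : Ideal (𝓞 K)} (h : IsCoprime (Ideal.span {a}) I) (h' : IsCoprime (Ideal.span {b}) I) : 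
    IsCoprime (Ideal.span {a * b}) I := by
  rw [← Ideal.span_singleton_mul_span_singleton]; exact h.mul_left h'

lemma cl_mul {a b : 𝓞 K} (h : IsCoprime (Ideal.span {a}) (Ideal.span {(2 : 𝓞 K)})) (h' : IsCoprime (Ideal.span {b}) (Ideal.span {(2 : 𝓞 K)})) :
    cl (a * b) = cl a + cl b := by
  unfold cl
  rw [dif_pos (odd_unit h), dif_pos (odd_unit h'), dif_pos (odd_unit (odd_mul h h'))]
  have : (odd_unit (odd_mul h h')).unit = (odd_unit h).unit * (odd_unit h').unit := by
    ext; simp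
  rw [this, uc_mul]

lemma cl_congr {a b : 𝓞 K} (h : a - b ∈ Ideal.span {(4 : 𝓞 K)}) : cl a = cl b := by
  have : q4 a = q4 b := (Ideal.Quotient.eq).2 h
  classical
  have key : ∀ x y : 𝓞 K ⧸ Ideal.span {(4 : 𝓞 K)}, x = y →
      (if h : IsUnit x then uc K h.unit else 0) = (if h : IsUnit y then uc K h.unit else 0) := by
    rintro x _ rfl; rfl
  exact key _ _ this

lemma cl_eq_zero {a : 𝓞 K} (h : IsCoprime (Ideal.span {a}) (Ideal.span {(2 : 𝓞 K)})) :
    cl a = 0 ↔ ∃ c, a - c ^ 2 ∈ Ideal.span {(4 : 𝓞 K)} := by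
  unfold cl
  rw [dif_pos (odd_unit h)]
  rw [uc_zero]
  constructor
  · rintro ⟨u, hu⟩
    obtain ⟨c, hc⟩ := Ideal.Quotient.mk_surjective (u : 𝓞 K ⧸ Ideal.span {(4 : 𝓞 K)})
    refine ⟨c, ?_⟩
    rw [← Ideal.Quotient.eq, map_pow, hc]
    have := congrArg Units.val hu
    simpa using this.symm
  · rintro ⟨c, hc⟩
    rw [← Ideal.Quotient.eq, map_pow] at hc
    have hu : IsUnit (q4 c) := by
      have := odd_unit h
      rw [q4, hc] at this
      exact (isUnit_pow_iff two_ne_zero).1 this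
    refine ⟨hu.unit, ?_⟩
    ext
    simp [hc]

lemma cl_surj (v : V2 K) (N : Ideal (𝓞 K)) (hN : IsCoprime N (Ideal.span {(2 : 𝓞 K)})) :
    ∃ a, IsCoprime (Ideal.span {a}) (Ideal.span {(2 : 𝓞 K)} * N) ∧ cl a = v := by
  obtain ⟨u, hu⟩ := uc_surj v
  obtain ⟨c, hc⟩ := Ideal.Quotient.mk_surjective (u : 𝓞 K ⧸ Ideal.span {(4 : 𝓞 K)})
  obtain ⟨i, hi, j, hj, hij⟩ := cop_sup.1 (cop4 hN)
  have e1 : q4 (j + c * i) = u := by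
    rw [← hc, Ideal.Quotient.eq]
    have : j + c * i - c = j - c * j := by linear_combination c * hij
    rw [this]; exact sub_mem hj (Ideal.mul_mem_left _ _ hj)
  have hun : IsUnit (q4 (j + c * i)) := e1 ▸ u.isUnit
  refine ⟨j + c * i, (unit_odd hun).mul_right ?_, ?_⟩
  · rw [cop_sup]
    refine ⟨_, Ideal.mem_span_singleton_self _, i - c * i, sub_mem hi (Ideal.mul_mem_left _ _ hi), ?_⟩
    rw [← hij]; ring
  · unfold cl
    rw [dif_pos hun]
    have : hun.unit = u := by ext; exact e1
    rw [this]
    exact hu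
end
end Recip

end

section
open NumberField
open scoped nonZeroDivisors
namespace Recip
set_option linter.unusedSectionVars false
section
variable {K : Type*} [Field K] [NumberField K]

local notation "sp2" => (Ideal.span {(2 : 𝓞 K)})
local notation "am" => algebraMap (𝓞 K) K

def sg (x : ZMod 2) : ℤ := if x = 0 then 1 else -1

lemma sg_add (x y : ZMod 2) : sg (x + y) = sg x * sg y := by revert x y; decide
lemma sg_inj {x y : ZMod 2} (h : sg x = sg y) : x = y := by revert x y; decide
lemma sg_one {x : ZMod 2} : sg x = 1 ↔ x = 0 := by revert x; decide

def gs (n : ℤ) : ZMod 2 := if n = 1 then 0 else 1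
lemma sg_gs {n : ℤ} (h : n = 1 ∨ n = -1) : sg (gs n) = n := by
  rcases h with rfl | rfl <;> decide

lemma pm_mul {a b : ℤ} (ha : a = 1 ∨ a = -1) (hb : b = 1 ∨ b = -1) : a * b = 1 ∨ a * b = -1 := by
  rcases ha with rfl | rfl <;> rcases hb with rfl | rfl <;> simp

lemma pm_sq {a : ℤ} (ha : a = 1 ∨ a = -1) : a * a = 1 := by
  rcases ha with rfl | rfl <;> simp

lemma sInf_symm (a b : K) : sInf a b = sInf b a := by
  unfold sInf
  simp only [and_comm]

lemma sInf_mul_left {a a' : K} (b : K) (ha : a ≠ 0) (ha' : a' ≠ 0) : sInf (a * a') b = sInf a b * sInf a' b := by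
  unfold sInf
  rw [← Finset.prod_mul_distrib]
  refine Finset.prod_congr rfl fun φ _ => ?_
  have h1 : φ a ≠ 0 := (map_ne_zero φ).2 ha
  have h2 : φ a' ≠ 0 := (map_ne_zero φ).2 ha'
  rw [map_mul]
  by_cases hb : φ b < 0
  · rcases lt_or_gt_of_ne h1 with h1 | h1 <;> rcases lt_or_gt_of_ne h2 with h2 | h2
    · simp [hb, h1, h2, (mul_pos_of_neg_of_neg h1 h2).not_gt]
    · simp [hb, h1, h2.not_gt, mul_neg_of_neg_of_pos h1 h2]
    · simp [hb, h2, h1.not_gt, mul_neg_of_pos_of_neg h1 h2]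
    · simp [hb, h1.not_gt, h2.not_gt, (mul_pos h1 h2).not_gt]
  · simp [hb]

lemma cong_odd {a b : 𝓞 K} (h : a - b ∈ Ideal.span {(4 : 𝓞 K)}) (ha : IsCoprime (Ideal.span {a}) sp2) :
    IsCoprime (Ideal.span {b}) sp2 := by
  apply unit_odd
  have : q4 a = q4 b := (Ideal.Quotient.eq).2 h
  rw [← this]; exact odd_unit ha

lemma odd_lift {a : 𝓞 K} (ha : IsCoprime (Ideal.span {a}) sp2) (N : Ideal (𝓞 K)) (hN : IsCoprime N sp2) :
    ∃ b, a - b ∈ Ideal.span {(4 : 𝓞 K)} ∧ IsCoprime (Ideal.span {b}) sp2 ∧ IsCoprime (Ideal.span {b}) N := by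
  obtain ⟨i, hi, j, hj, hij⟩ := cop_sup.1 (cop4 hN)
  have h1 : a - (j + a * i) ∈ Ideal.span {(4 : 𝓞 K)} := by
    have : a - (j + a * i) = a * j - j := by linear_combination -a * hij
    rw [this]; exact sub_mem (Ideal.mul_mem_left _ _ hj) hj
  refine ⟨j + a * i, h1, cong_odd h1 ha, ?_⟩
  rw [cop_sup]
  refine ⟨_, Ideal.mem_span_singleton_self _, i - a * i, sub_mem hi (Ideal.mul_mem_left _ _ hi), ?_⟩
  rw [← hij]; ring

lemma cl_eq {a b : 𝓞 K} (ha : IsCoprime (Ideal.span {a}) sp2) (hb : IsCoprime (Ideal.span {b}) sp2) (h : cl a = cl b) :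
    ∃ c, IsCoprime (Ideal.span {c}) sp2 ∧ a * c ^ 2 - b ∈ Ideal.span {(4 : 𝓞 K)} := by
  have h1 : cl (a * b) = 0 := by
    rw [cl_mul ha hb, h, ← two_nsmul]; exact V2_two K _
  obtain ⟨e, he⟩ := (cl_eq_zero (odd_mul ha hb)).1 h1
  obtain ⟨f, hf⟩ := Ideal.Quotient.mk_surjective (((odd_unit ha).unit⁻¹ : (𝓞 K ⧸ Ideal.span {(4 : 𝓞 K)})ˣ) : 𝓞 K ⧸ Ideal.span {(4 : 𝓞 K)})
  have hf1 : q4 a * q4 f = 1 := by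
    rw [q4, q4, hf]; exact (odd_unit ha).mul_val_inv
  rw [← Ideal.Quotient.eq] at he
  have key : q4 (a * (e * f) ^ 2) = q4 b := by
    simp only [q4, map_mul, map_pow] at he hf1 ⊢
    linear_combination (Ideal.Quotient.mk (Ideal.span {(4 : 𝓞 K)}) b * (Ideal.Quotient.mk (Ideal.span {(4 : 𝓞 K)}) a * Ideal.Quotient.mk (Ideal.span {(4 : 𝓞 K)}) f + 1)) * hf1 - (Ideal.Quotient.mk (Ideal.span {(4 : 𝓞 K)}) a * (Ideal.Quotient.mk (Ideal.span {(4 : 𝓞 K)}) f) ^ 2) * he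
  refine ⟨e * f, ?_, (Ideal.Quotient.eq).1 key⟩
  apply unit_odd
  have h3 : IsUnit (q4 b) := odd_unit hb
  rw [← key, q4, map_mul, map_pow] at h3
  exact (isUnit_pow_iff two_ne_zero).1 (isUnit_of_mul_isUnit_right h3)

variable (K) in
theorem recip2 : ∃ d : Ideal (𝓞 K), d ≠ ⊥ ∧ IsCoprime d sp2 ∧ ∃ b : LinearMap.BilinForm (ZMod 2) (V2 K),
    (∀ x y, b x y = b y x) ∧
    ∀ a a', IsCoprime (Ideal.span {a}) (sp2 * d) → IsCoprime (Ideal.span {a'}) (sp2 * d) →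
      IsCoprime (Ideal.span {a}) (Ideal.span {a'}) →
      Jac a' (Ideal.span {a}) * Jac a (Ideal.span {a'}) = sInf (am a) (am a') * sg (b (cl a) (cl a')) := by
  obtain ⟨d, hd, hd2, B, hB, hrec⟩ := recip K
  have am0 : ∀ {a : 𝓞 K}, IsCoprime (Ideal.span {a}) sp2 → am a ≠ 0 := fun h => by
    simpa using odd_ne h
  have hrec' : ∀ a a', IsCoprime (Ideal.span {a}) (sp2 * d) → IsCoprime (Ideal.span {a'}) (sp2 * d) →
      IsCoprime (Ideal.span {a}) (Ideal.span {a'}) → B a a' = Jac a' (Ideal.span {a}) * Jac a (Ideal.span {a'}) * sInf (am a) (am a') := by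
    intro a a' h h' h''
    rw [hrec a a' (odd_ne (IsCoprime.of_mul_right_left h)) (odd_ne (IsCoprime.of_mul_right_left h')) h h' h'']
    have := pm_sq (sInf_pm (am a) (am a'))
    linear_combination (- B a a') * this
  have Bpm : ∀ a a', IsCoprime (Ideal.span {a}) sp2 → IsCoprime (Ideal.span {a'}) sp2 → B a a' = 1 ∨ B a a' = -1 := by
    intro a a' h h'
    obtain ⟨a0, ha0, c1, c2⟩ := odd_lift h d hd2
    obtain ⟨b0, hb0, c3, c4⟩ := odd_lift h' (d * Ideal.span {a0}) (hd2.mul_left c1)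
    have c5 := IsCoprime.of_mul_right_left c4
    have c6 := IsCoprime.of_mul_right_right c4
    rw [hB a a0 a' b0 ha0 hb0, hrec' a0 b0 (c1.mul_right c2) (c3.mul_right c5) c6.symm]
    exact pm_mul (pm_mul (Jac_pm c6) (Jac_pm c6.symm)) (sInf_pm _ _)
  have Bsymm : ∀ a a', IsCoprime (Ideal.span {a}) sp2 → IsCoprime (Ideal.span {a'}) sp2 → B a a' = B a' a := by
    intro a a' h h'
    obtain ⟨a0, ha0, c1, c2⟩ := odd_lift h d hd2
    obtain ⟨b0, hb0, c3, c4⟩ := odd_lift h' (d * Ideal.span {a0}) (hd2.mul_left c1)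
    have c5 := IsCoprime.of_mul_right_left c4
    have c6 := IsCoprime.of_mul_right_right c4
    rw [hB a a0 a' b0 ha0 hb0, hB a' b0 a a0 hb0 ha0, hrec' a0 b0 (c1.mul_right c2) (c3.mul_right c5) c6.symm,
      hrec' b0 a0 (c3.mul_right c5) (c1.mul_right c2) c6, sInf_symm]
    ring
  have Bmul : ∀ a a' b, IsCoprime (Ideal.span {a}) sp2 → IsCoprime (Ideal.span {a'}) sp2 → IsCoprime (Ideal.span {b}) sp2 →
      B (a * a') b = B a b * B a' b := by
    intro a a' b h h' hb
    obtain ⟨b0, hb0, c1, c2⟩ := odd_lift hb d hd2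
    obtain ⟨a0, ha0, c3, c4⟩ := odd_lift h (d * Ideal.span {b0}) (hd2.mul_left c1)
    obtain ⟨a1, ha1, c5, c6⟩ := odd_lift h' (d * Ideal.span {b0}) (hd2.mul_left c1)
    have hcong : a * a' - a0 * a1 ∈ Ideal.span {(4 : 𝓞 K)} := by
      have : a * a' - a0 * a1 = a * (a' - a1) + a1 * (a - a0) := by ring
      rw [this]; exact add_mem (Ideal.mul_mem_left _ _ ha1) (Ideal.mul_mem_left _ _ ha0)
    have c4l := IsCoprime.of_mul_right_left c4
    have c4r := IsCoprime.of_mul_right_right c4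
    have c6l := IsCoprime.of_mul_right_left c6
    have c6r := IsCoprime.of_mul_right_right c6
    have cb := c1.mul_right c2
    have c0 := c3.mul_right c4l
    have c0' := c5.mul_right c6l
    rw [hB a a0 b b0 ha0 hb0, hB a' a1 b b0 ha1 hb0, hB _ _ b b0 hcong hb0,
      hrec' _ _ c0 cb c4r, hrec' _ _ c0' cb c6r, hrec' _ _ (odd_mul c0 c0') cb (odd_mul c4r c6r),
      map_mul, sInf_mul_left _ (am0 c3) (am0 c5), Jac_mul_left, ← Ideal.span_singleton_mul_span_singleton,
      Jac_mul _ (span_ne (odd_ne c3)) (span_ne (odd_ne c5))]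
    ring
  have Bcl : ∀ a a' b, IsCoprime (Ideal.span {a}) sp2 → IsCoprime (Ideal.span {a'}) sp2 → IsCoprime (Ideal.span {b}) sp2 →
      cl a = cl a' → B a b = B a' b := by
    intro a a' b h h' hb hcl
    obtain ⟨c, hc, hca⟩ := cl_eq h h' hcl
    rw [← hB (a * c ^ 2) a' b b hca (by simp), Bmul _ _ _ h (by rw [sq]; exact odd_mul hc hc) hb, sq, Bmul _ _ _ hc hc hb,
      pm_sq (Bpm c b hc hb), mul_one]
  have hl : ∀ v : V2 K, ∃ a, IsCoprime (Ideal.span {a}) sp2 ∧ cl a = v := by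
    intro v
    obtain ⟨a, ha, h⟩ := cl_surj v ⊤ (by rw [← Ideal.one_eq_top]; exact isCoprime_one_left)
    exact ⟨a, IsCoprime.of_mul_right_left ha, h⟩
  choose l hl1 hl2 using hl
  have hbl : ∀ a a', IsCoprime (Ideal.span {a}) sp2 → IsCoprime (Ideal.span {a'}) sp2 → B (l (cl a)) (l (cl a')) = B a a' := by
    intro a a' h h'
    rw [Bcl _ a _ (hl1 _) h (hl1 _) (hl2 _), Bsymm _ _ h (hl1 _), Bcl _ a' _ (hl1 _) h' h (hl2 _), Bsymm _ _ h' h]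
  let bf : V2 K → V2 K → ZMod 2 := fun x y => gs (B (l x) (l y))
  have bfs : ∀ x y, bf x y = bf y x := fun x y => by
    simp only [bf]; rw [Bsymm _ _ (hl1 _) (hl1 _)]
  have bfa : ∀ x x' y, bf (x + x') y = bf x y + bf x' y := by
    intro x x' y
    apply sg_inj
    rw [sg_add, sg_gs (Bpm _ _ (hl1 _) (hl1 _)), sg_gs (Bpm _ _ (hl1 _) (hl1 _)), sg_gs (Bpm _ _ (hl1 _) (hl1 _)),
      ← Bmul _ _ _ (hl1 _) (hl1 _) (hl1 _)]
    apply Bcl _ _ _ (hl1 _) (odd_mul (hl1 _) (hl1 _)) (hl1 _)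
    rw [hl2, cl_mul (hl1 _) (hl1 _), hl2, hl2]
  let b1 : V2 K → (V2 K →ₗ[ZMod 2] ZMod 2) := fun x =>
    (AddMonoidHom.mk' (bf x) (fun y y' => by rw [bfs, bfa, bfs y, bfs y'])).toZModLinearMap 2
  let b : LinearMap.BilinForm (ZMod 2) (V2 K) :=
    (AddMonoidHom.mk' b1 (fun x x' => by ext y; exact bfa x x' y)).toZModLinearMap 2
  have hb : ∀ x y, b x y = bf x y := fun x y => rfl
  refine ⟨d, hd, hd2, b, fun x y => by rw [hb, hb, bfs], ?_⟩
  intro a a' h h' h''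
  have h1 := IsCoprime.of_mul_right_left h
  have h2 := IsCoprime.of_mul_right_left h'
  rw [hb, hrec a a' (odd_ne h1) (odd_ne h2) h h' h'']
  congr 1
  rw [sg_gs (Bpm _ _ (hl1 _) (hl1 _)), hbl a a' h1 h2]
end
end Recip

end

section
open NumberField
open scoped nonZeroDivisors
namespace Recip
set_option linter.unusedSectionVars false

lemma card_mod_sq (G : Type*) [CommGroup G] [Finite G] :
    (powMonoidHom 2 : G →* G).range.index = Nat.card {c : G // c ^ 2 = 1} := by
  have h1 := Subgroup.card_mul_index (powMonoidHom 2 : G →* G).range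
  have h2 := Subgroup.card_mul_index (powMonoidHom 2 : G →* G).ker
  rw [Subgroup.index_ker] at h2
  have h3 : Nat.card (powMonoidHom 2 : G →* G).ker = Nat.card {c : G // c ^ 2 = 1} := rfl
  rw [h3] at h2
  have h4 : 0 < Nat.card (powMonoidHom 2 : G →* G).range := Nat.card_pos
  rw [← h2, mul_comm] at h1
  exact Nat.eq_of_mul_eq_mul_right h4 h1

section
variable (K : Type*) [Field K] [NumberField K]

lemma absNorm_two : Ideal.absNorm (Ideal.span {(2 : 𝓞 K)}) = 2 ^ Module.finrank ℚ K := by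
  rw [Ideal.absNorm_span_singleton]
  have h2 : Algebra.norm ℤ (2 : 𝓞 K) = 2 ^ Module.finrank ℤ (𝓞 K) := by
    have := Algebra.norm_algebraMap (S := 𝓞 K) (2 : ℤ)
    simpa using this
  rw [h2, Int.natAbs_pow, RingOfIntegers.rank]; rfl

lemma sqrt_one_mod_four {x : 𝓞 K} (h : x ^ 2 - 1 ∈ Ideal.span {(4 : 𝓞 K)}) : ∃ s : 𝓞 K, x = 1 + 2 * s := by
  obtain ⟨k, hk⟩ := Ideal.mem_span_singleton'.1 h
  have hinteg : IsIntegral (𝓞 K) ((algebraMap (𝓞 K) K x - 1) / 2) := by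
    refine ⟨Polynomial.X ^ 2 + Polynomial.X - Polynomial.C k, by monicity!, ?_⟩
    have hk' : algebraMap (𝓞 K) K k * 4 = algebraMap (𝓞 K) K x ^ 2 - 1 := by
      have := congrArg (algebraMap (𝓞 K) K) hk
      rwa [map_mul, map_sub, map_pow, map_one, map_ofNat] at this
    simp only [Polynomial.eval₂_sub, Polynomial.eval₂_add, Polynomial.eval₂_pow, Polynomial.eval₂_X, Polynomial.eval₂_C]
    linear_combination (-1 / 4) * hk'
  obtain ⟨s, hs⟩ := IsIntegrallyClosed.isIntegral_iff.1 hinteg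
  refine ⟨s, ?_⟩
  apply RingOfIntegers.ext
  change algebraMap (𝓞 K) K x = algebraMap (𝓞 K) K (1 + 2 * s)
  rw [map_add, map_mul, map_one, map_ofNat, hs]
  ring

lemma finrank_V2 : Module.finrank (ZMod 2) (V2 K) ≤ Module.finrank ℚ K := by
  have h1 : Nat.card (V2 K) ≤ 2 ^ Module.finrank ℚ K := by
    change (powMonoidHom 2 : (𝓞 K ⧸ Ideal.span {(4 : 𝓞 K)})ˣ →* _).range.index ≤ _
    rw [card_mod_sq, ← absNorm_two, Ideal.absNorm_apply, Submodule.cardQuot_apply]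
    have hx : ∀ u : {c : (𝓞 K ⧸ Ideal.span {(4 : 𝓞 K)})ˣ // c ^ 2 = 1}, ∃ s : 𝓞 K, (u.1 : 𝓞 K ⧸ Ideal.span {(4 : 𝓞 K)}) = Ideal.Quotient.mk _ (1 + 2 * s) := by
      intro u
      obtain ⟨x, hx⟩ := Ideal.Quotient.mk_surjective (u.1 : 𝓞 K ⧸ Ideal.span {(4 : 𝓞 K)})
      have : x ^ 2 - 1 ∈ Ideal.span {(4 : 𝓞 K)} := by
        rw [← Ideal.Quotient.eq, map_pow, map_one, hx]
        have := congrArg Units.val u.2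
        simpa using this
      obtain ⟨s, rfl⟩ := sqrt_one_mod_four K this
      exact ⟨s, hx.symm⟩
    choose s hs using hx
    have : Finite (𝓞 K ⧸ Ideal.span {(2 : 𝓞 K)}) := Ideal.finiteQuotientOfFreeOfNeBot _ span2_ne
    refine Nat.card_le_card_of_injective (fun u => (Ideal.Quotient.mk (Ideal.span {(2 : 𝓞 K)}) (s u))) ?_
    intro u v h
    apply Subtype.ext
    apply Units.ext
    rw [hs, hs, Ideal.Quotient.eq]
    have h2 := (Ideal.Quotient.eq).1 h
    rw [span4]
    have := Ideal.mul_mem_mul (Ideal.mem_span_singleton_self (2 : 𝓞 K)) h2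
    convert this using 1; ring
  rw [Module.natCard_eq_pow_finrank (K := ZMod 2), Nat.card_zmod] at h1
  exact (Nat.pow_le_pow_iff_right (by norm_num)).1 h1
end
end Recip

end

section
open NumberField
open scoped nonZeroDivisors
namespace Recip
set_option linter.unusedSectionVars false
section
variable {K : Type*} [Field K] [NumberField K]

local notation "sp2" => (Ideal.span {(2 : 𝓞 K)})
local notation "am" => algebraMap (𝓞 K) K
local notation "FI" => FractionalIdeal (𝓞 K)⁰ K

lemma am_ne {a : 𝓞 K} (h : a ≠ 0) : am a ≠ 0 := by simpa using h

lemma exists_rep {z : Kˣ} (hz : z ∈ singularSubgroup K) (N : Ideal (𝓞 K)) (hN : N ≠ ⊥) :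
    ∃ (β : Kˣ) (a : 𝓞 K) (I : Ideal (𝓞 K)), am a = z * β ^ 2 ∧ IsCoprime (Ideal.span {a}) N ∧ Ideal.span {a} = I * I := by
  obtain ⟨J, hJ⟩ := hz
  have hJ0 : J ≠ 0 := by
    rintro rfl
    rw [zero_pow two_ne_zero, FractionalIdeal.spanSingleton_eq_zero_iff] at hJ
    exact z.ne_zero hJ
  obtain ⟨β, hβ, b, hb, hcop⟩ := exists_coprime_ideal J hJ0 N hN
  have e1 : FractionalIdeal.spanSingleton (𝓞 K)⁰ ((z : K) * β ^ 2) = ((b * b : Ideal (𝓞 K)) : FI) := by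
    rw [← FractionalIdeal.spanSingleton_mul_spanSingleton, hJ, FractionalIdeal.coeIdeal_mul, ← hb, ← FractionalIdeal.spanSingleton_pow]
    ring
  have h2 : (z : K) * β ^ 2 ∈ ((b * b : Ideal (𝓞 K)) : FI) := by
    rw [← e1]; exact FractionalIdeal.mem_spanSingleton_self _ _
  obtain ⟨a, -, ha⟩ := (FractionalIdeal.mem_coeIdeal _).1 h2
  have e2 : Ideal.span {a} = b * b := by
    rw [← ha, sp_alg] at e1
    exact FractionalIdeal.coeIdeal_injective e1
  exact ⟨Units.mk0 β hβ, a, b, ha, by rw [e2]; exact hcop.mul_left hcop, e2⟩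

lemma rep_unique {z : Kˣ} {a a' : 𝓞 K} {β β' : Kˣ} (h : am a = z * β ^ 2) (h' : am a' = z * β' ^ 2)
    (ha : IsCoprime (Ideal.span {a}) sp2) (ha' : IsCoprime (Ideal.span {a'}) sp2) : cl a = cl a' := by
  have e : ((z : K) * β * β') ^ 2 = am (a * a') := by
    rw [map_mul, h, h']; ring
  have hinteg : IsIntegral (𝓞 K) ((z : K) * β * β') := by
    apply IsIntegral.of_pow (n := 2) (by norm_num)
    rw [e]; exact isIntegral_algebraMap
  obtain ⟨s, hs⟩ := IsIntegrallyClosed.isIntegral_iff.1 hinteg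
  rw [← hs, ← map_pow] at e
  have e' := FaithfulSMul.algebraMap_injective (𝓞 K) K e
  have h0 : cl (a * a') = 0 := (cl_eq_zero (odd_mul ha ha')).2 ⟨s, by rw [e']; simp⟩
  rw [cl_mul ha ha'] at h0
  have h1 := V2_two K (cl a')
  rw [two_nsmul] at h1
  exact add_right_cancel (h0.trans h1.symm)

lemma exists_odd_rep {z : Kˣ} (hz : z ∈ singularSubgroup K) :
    ∃ (a : 𝓞 K), IsCoprime (Ideal.span {a}) sp2 ∧ ∃ β : Kˣ, am a = z * β ^ 2 := by
  obtain ⟨β, a, I, h1, h2, -⟩ := exists_rep hz sp2 span2_ne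
  exact ⟨a, h2, β, h1⟩

noncomputable def gcl (z : singularSubgroup K) : V2 K := cl (exists_odd_rep z.2).choose

lemma gcl_eq (z : singularSubgroup K) {a : 𝓞 K} {β : Kˣ} (h : am a = (z : Kˣ) * β ^ 2)
    (ha : IsCoprime (Ideal.span {a}) sp2) : gcl z = cl a := by
  obtain ⟨h1, β', h2⟩ := (exists_odd_rep z.2).choose_spec
  exact rep_unique h2 h h1 ha

lemma gcl_mul (z w : singularSubgroup K) : gcl (z * w) = gcl z + gcl w := by
  obtain ⟨a, h1, β, h2⟩ := exists_odd_rep z.2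
  obtain ⟨a', h1', β', h2'⟩ := exists_odd_rep w.2
  rw [gcl_eq z h2 h1, gcl_eq w h2' h1', ← cl_mul h1 h1']
  apply gcl_eq _ (β := β * β') _ (odd_mul h1 h1')
  rw [map_mul, h2, h2']; push_cast; ring

open Classical in
noncomputable def sgnv (z : Kˣ) : (K →+* ℝ) → ZMod 2 := fun φ => if φ z < 0 then 1 else 0

lemma sgnv_mul (z w : Kˣ) : sgnv (z * w) = sgnv z + sgnv w := by
  funext φ
  have h1 : φ z ≠ 0 := (map_ne_zero φ).2 z.ne_zero
  have h2 : φ w ≠ 0 := (map_ne_zero φ).2 w.ne_zero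
  simp only [sgnv, Pi.add_apply, Units.val_mul, map_mul]
  rcases lt_or_gt_of_ne h1 with h1 | h1 <;> rcases lt_or_gt_of_ne h2 with h2 | h2
  · simp only [h1, h2, (mul_pos_of_neg_of_neg h1 h2).not_gt, if_true, if_false]; decide
  · simp [h1, h2.not_gt, mul_neg_of_neg_of_pos h1 h2]
  · simp [h2, h1.not_gt, mul_neg_of_pos_of_neg h1 h2]
  · simp [h1.not_gt, h2.not_gt, (mul_pos h1 h2).not_gt]

lemma sgnv_zero {z : Kˣ} : sgnv z = 0 ↔ ∀ φ : K →+* ℝ, 0 < φ z := by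
  rw [funext_iff]
  refine forall_congr' fun φ => ?_
  have h1 : φ z ≠ 0 := (map_ne_zero φ).2 z.ne_zero
  rcases lt_or_gt_of_ne h1 with h1 | h1
  · simp [sgnv, h1, h1.not_gt]
  · simp [sgnv, h1, h1.not_gt]

lemma sgnv_sq (z : Kˣ) : sgnv (z ^ 2) = 0 := by
  rw [sgnv_zero]; intro φ
  rw [Units.val_pow_eq_pow_val, map_pow]
  exact pow_pos_of_ne_zero_aux φ z
where pow_pos_of_ne_zero_aux (φ : K →+* ℝ) (z : Kˣ) : 0 < φ z ^ 2 := by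
        have : φ z ≠ 0 := (map_ne_zero φ).2 z.ne_zero
        positivity

lemma mem_pos {z : Kˣ} : z ∈ posModSquares K ↔ sgnv z = 0 := by
  constructor
  · rintro ⟨x, hx⟩
    have := sgnv_zero.2 hx
    rwa [sgnv_mul, sgnv_sq, add_zero] at this
  · intro h
    exact ⟨1, by simpa using sgnv_zero.1 h⟩

/-- the localisation map at infinity and `2` -/
noncomputable def FF : singularSubgroup K →* Multiplicative (((K →+* ℝ) → ZMod 2) × V2 K) :=
  MonoidHom.mk' (fun z => Multiplicative.ofAdd (sgnv (z : Kˣ), gcl z)) (fun z w => by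
    rw [← ofAdd_add, Prod.mk_add_mk, ← sgnv_mul, ← gcl_mul]; rfl)

lemma sInf_eq (z w : Kˣ) : sInf (z : K) (w : K) = sg (∑ φ, sgnv z φ * sgnv w φ) := by
  classical
  have key : ∀ s : Finset (K →+* ℝ), (∏ φ ∈ s, if φ (z : K) < 0 ∧ φ (w : K) < 0 then (-1 : ℤ) else 1) = sg (∑ φ ∈ s, sgnv z φ * sgnv w φ) := by
    intro s
    induction s using Finset.induction_on with
    | empty => rfl
    | insert φ s h ih =>
      rw [Finset.prod_insert h, Finset.sum_insert h, sg_add, ih]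
      congr 1
      by_cases h1 : φ (z : K) < 0 <;> by_cases h2 : φ (w : K) < 0 <;> simp [sgnv, h1, h2, sg]
  exact key _

lemma isotropic (d : Ideal (𝓞 K)) (hd : d ≠ ⊥) (b : LinearMap.BilinForm (ZMod 2) (V2 K))
    (hb : ∀ a a', IsCoprime (Ideal.span {a}) (sp2 * d) → IsCoprime (Ideal.span {a'}) (sp2 * d) →
      IsCoprime (Ideal.span {a}) (Ideal.span {a'}) →
      Jac a' (Ideal.span {a}) * Jac a (Ideal.span {a'}) = sInf (am a) (am a') * sg (b (cl a) (cl a')))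
    (z w : singularSubgroup K) : ∑ φ, sgnv (z : Kˣ) φ * sgnv (w : Kˣ) φ + b (gcl z) (gcl w) = 0 := by
  have h2d : sp2 * d ≠ ⊥ := mul_ne_zero span2_ne hd
  obtain ⟨β, a, I, h1, h2, h3⟩ := exists_rep z.2 (sp2 * d) h2d
  have a0 : a ≠ 0 := odd_ne (IsCoprime.of_mul_right_left h2)
  obtain ⟨β', a', I', h1', h2', h3'⟩ := exists_rep w.2 (sp2 * d * Ideal.span {a}) (mul_ne_zero h2d (span_ne a0))
  have c1 := IsCoprime.of_mul_right_left h2'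
  have c2 := IsCoprime.of_mul_right_right h2'
  have a0' : a' ≠ 0 := odd_ne (IsCoprime.of_mul_right_left c1)
  have hI : I ≠ ⊥ := by rintro rfl; rw [Ideal.bot_mul] at h3; exact span_ne a0 h3
  have hI' : I' ≠ ⊥ := by rintro rfl; rw [Ideal.bot_mul] at h3'; exact span_ne a0' h3'
  have key := hb a a' h2 c1 c2.symm
  have e1 : am a = ((z * β ^ 2 : Kˣ) : K) := by rw [h1]; push_cast; rfl
  have e2 : am a' = ((w * β' ^ 2 : Kˣ) : K) := by rw [h1']; push_cast; rfl
  rw [← gcl_eq z h1 (IsCoprime.of_mul_right_left h2), ← gcl_eq w h1' (IsCoprime.of_mul_right_left c1), e1, e2, sInf_eq,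
    ← sg_add, sgnv_mul, sgnv_mul, sgnv_sq, sgnv_sq, add_zero, add_zero] at key
  rw [← sg_one, ← key, h3, h3', Jac_mul _ hI hI, Jac_mul _ hI' hI']
  have c3 : IsCoprime (Ideal.span {a'}) I := by rw [h3] at c2; exact IsCoprime.of_mul_right_left c2
  have c4 : IsCoprime (Ideal.span {a}) I' := by
    have := c2.symm; rw [h3'] at this; exact IsCoprime.of_mul_right_left this
  rw [pm_sq (Jac_pm c3), pm_sq (Jac_pm c4), mul_one]
end
end Recip

end

section
open NumberField
open scoped nonZeroDivisors TensorProduct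
namespace Recip
set_option linter.unusedSectionVars false
section
variable (K : Type*) [Field K] [NumberField K]

lemma ok2_pi_aux : ∃ π : 𝓞 K ⊗[ℤ] ℤ_[2] →+* 𝓞 K ⧸ Ideal.span {(4 : 𝓞 K)},
    ∀ s : 𝓞 K, π (Algebra.TensorProduct.includeLeftRingHom s) = Ideal.Quotient.mk _ s := by
  let h4 : ZMod (2 ^ 2) →+* 𝓞 K ⧸ Ideal.span {(4 : 𝓞 K)} :=
    (Ideal.Quotient.lift (Ideal.span {((4 : ℕ) : ℤ)}) (Int.castRingHom _) (by
      intro a ha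
      obtain ⟨c, rfl⟩ := Ideal.mem_span_singleton'.1 ha
      have : Ideal.Quotient.mk (Ideal.span {(4 : 𝓞 K)}) 4 = 0 :=
        Ideal.Quotient.eq_zero_iff_mem.2 (Ideal.mem_span_singleton_self _)
      rw [map_ofNat] at this
      simp [this])).comp (Int.quotientSpanEquivZMod 4).symm.toRingHom
  let π := Algebra.TensorProduct.lift (Ideal.Quotient.mk (Ideal.span {(4 : 𝓞 K)})).toIntAlgHom
    (h4.comp (PadicInt.toZModPow 2)).toIntAlgHom (fun x y => Commute.all _ _)
  refine ⟨π.toRingHom, fun s => ?_⟩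
  change π (s ⊗ₜ 1) = _
  simp [π]

lemma ok2_pi : ∃ π : OK2 K →+* 𝓞 K ⧸ Ideal.span {(4 : 𝓞 K)},
    ∀ s : 𝓞 K, π (iota K s) = Ideal.Quotient.mk _ s := by with_unfolding_all exact ok2_pi_aux K

lemma ok2_j : ∃ _ : ℤ_[2] →+* OK2 K, True := by
  with_unfolding_all exact ⟨(Algebra.TensorProduct.includeRight : ℤ_[2] →ₐ[ℤ] 𝓞 K ⊗[ℤ] ℤ_[2]).toRingHom, trivial⟩

variable {K}
local notation "am" => algebraMap (𝓞 K) K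
local notation "sp2" => (Ideal.span {(2 : 𝓞 K)})

lemma odd_norm {s : 𝓞 K} (h : IsCoprime (Ideal.span {s}) sp2) : ¬ 2 ∣ Ideal.absNorm (Ideal.span {s}) := by
  intro h2
  rw [Ideal.absNorm_apply, Submodule.cardQuot_apply] at h2
  have : Finite (𝓞 K ⧸ Ideal.span {s}) := Ideal.finiteQuotientOfFreeOfNeBot _ (span_ne (odd_ne h))
  have : Fact (Nat.Prime 2) := ⟨Nat.prime_two⟩
  obtain ⟨x, hx⟩ := exists_prime_addOrderOf_dvd_card' 2 h2
  have hx0 : x ≠ 0 := by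
    rintro rfl; rw [addOrderOf_zero] at hx; omega
  have h2x : 2 • x = 0 := by rw [← hx]; exact addOrderOf_nsmul_eq_zero x
  obtain ⟨i, hi, j, hj, hij⟩ := cop_sup.1 h
  obtain ⟨c, rfl⟩ := Ideal.mem_span_singleton'.1 hj
  apply hx0
  have h1 : Ideal.Quotient.mk (Ideal.span {s}) (c * 2) = 1 := by
    rw [← map_one (Ideal.Quotient.mk _), ← hij, map_add, Ideal.Quotient.eq_zero_iff_mem.2 hi, zero_add]
  rw [map_mul, map_ofNat] at h1
  rw [nsmul_eq_mul, Nat.cast_ofNat] at h2x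
  linear_combination (-x) * h1 + (Ideal.Quotient.mk (Ideal.span {s}) c) * h2x

lemma odd_unit2 {s : 𝓞 K} (h : IsCoprime (Ideal.span {s}) sp2) : IsUnit (iota K s) := by
  obtain ⟨j, -⟩ := ok2_j K
  set m := Ideal.absNorm (Ideal.span {s}) with hm
  have h1 : IsUnit ((m : ℕ) : ℤ_[2]) := by
    rw [PadicInt.isUnit_iff]
    by_contra hne
    have hlt : ‖((m : ℕ) : ℤ_[2])‖ < 1 := lt_of_le_of_ne (PadicInt.norm_le_one _) hne
    have : ((m : ℕ) : ℤ_[2]) = ((m : ℤ) : ℤ_[2]) := by push_cast; rfl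
    rw [this, PadicInt.norm_int_lt_one_iff_dvd] at hlt
    exact odd_norm h (by exact_mod_cast hlt)
  have h2 : IsUnit ((m : ℕ) : OK2 K) := by
    have := h1.map j
    rwa [map_natCast] at this
  obtain ⟨c, hc⟩ := Ideal.mem_span_singleton'.1 (Ideal.absNorm_mem (Ideal.span {s}))
  have h3 : iota K c * iota K s = ((m : ℕ) : OK2 K) := by
    rw [← map_mul, hc, map_natCast]
  rw [← h3] at h2
  exact isUnit_of_mul_isUnit_right h2

lemma mem_adic (z : singularSubgroup K) : (z : Kˣ) ∈ adicSquareClass K ↔ gcl z = 0 := by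
  constructor
  · rintro ⟨β, s, t, u, v, hu, hv, hz, a, y, hay⟩
    obtain ⟨π, hπ⟩ := ok2_pi K
    have hs : IsCoprime (Ideal.span {s}) sp2 := by
      apply unit_odd
      rw [q4, ← hπ, ← hu]; exact u.isUnit.map π
    have ht : IsCoprime (Ideal.span {t}) sp2 := by
      apply unit_odd
      rw [q4, ← hπ, ← hv]; exact v.isUnit.map π
    have ht0 := am_ne (odd_ne ht)
    have hrep : am (s * t) = (z : Kˣ) * ((Units.mk0 _ ht0 * β⁻¹ : Kˣ) : K) ^ 2 := by
      rw [hz, map_mul]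
      have := β.ne_zero
      push_cast
      rw [Units.val_mk0]
      field_simp
    rw [gcl_eq z hrep (odd_mul hs ht), cl_eq_zero (odd_mul hs ht)]
    obtain ⟨c, hc⟩ := Ideal.Quotient.mk_surjective (π (v * y))
    refine ⟨c, ?_⟩
    rw [← Ideal.Quotient.eq, map_pow, hc, ← hπ, map_mul (iota K), ← hu, ← hv, ← map_pow]
    have e1 : (u : OK2 K) = v * ((1 + 4 * a) * (y : OK2 K) ^ 2) := by
      rw [← hay, Units.val_mul, mul_comm, mul_assoc, Units.inv_mul, mul_one]
    have h4 : π 4 = 0 := by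
      have : π (iota K 4) = 0 := by
        rw [hπ]; exact Ideal.Quotient.eq_zero_iff_mem.2 (Ideal.mem_span_singleton_self _)
      rwa [map_ofNat (iota K) 4] at this
    have e2 : (u : OK2 K) * v = (v * y) ^ 2 + 4 * (a * (v * y) ^ 2) := by rw [e1]; ring
    rw [e2, map_add, map_mul π 4, h4, zero_mul, add_zero]
  · intro h
    obtain ⟨a, h1, β, h2⟩ := exists_odd_rep z.2
    rw [gcl_eq z h2 h1, cl_eq_zero h1] at h
    obtain ⟨c, hc⟩ := h
    obtain ⟨k, hk⟩ := Ideal.mem_span_singleton'.1 hc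
    have hc1 : IsCoprime (Ideal.span {c}) sp2 := by
      have := cong_odd hc h1
      apply unit_odd
      have h3 := odd_unit this
      rw [q4, map_pow] at h3
      exact (isUnit_pow_iff two_ne_zero).1 h3
    obtain ⟨u, hu⟩ := odd_unit2 h1
    obtain ⟨y, hy⟩ := odd_unit2 hc1
    refine ⟨β⁻¹, a, 1, u, 1, hu, by simp, ?_, iota K k * ((y⁻¹ : (OK2 K)ˣ) : OK2 K) ^ 2, y, ?_⟩
    · rw [h2, map_one]
      have := β.ne_zero
      push_cast; field_simp
    · rw [inv_one, mul_one, hu]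
      have e : a = c ^ 2 + k * 4 := by rw [hk]; ring
      have hyy : (y : OK2 K) * ((y⁻¹ : (OK2 K)ˣ) : OK2 K) = 1 := y.mul_inv
      rw [e, map_add, map_pow, map_mul, map_ofNat (iota K) 4, ← hy]
      linear_combination (-4 * iota K k * ((y : OK2 K) * ((y⁻¹ : (OK2 K)ˣ) : OK2 K) + 1)) * hyy
end
end Recip

end

section
open NumberField
open scoped nonZeroDivisors TensorProduct
namespace Recip
set_option linter.unusedSectionVars false
section
variable (K : Type*) [Field K] [NumberField K]
local notation "am" => algebraMap (𝓞 K) K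
local notation "FI" => FractionalIdeal (𝓞 K)⁰ K
local notation "pr" => toPrincipalIdeal (𝓞 K) K
local notation "ZZ" => singularSubgroup K
local notation "SQ" => squaresSubgroup K

abbrev CG := (FractionalIdeal (𝓞 K)⁰ K)ˣ ⧸ (toPrincipalIdeal (𝓞 K) K).range

lemma units_sq_lower (h : (powMonoidHom 2 : (𝓞 K)ˣ →* (𝓞 K)ˣ).range.index ≠ 0) :
    2 ^ Fintype.card (InfinitePlace K) ≤ (powMonoidHom 2 : (𝓞 K)ˣ →* (𝓞 K)ˣ).range.index := by
  set S := (powMonoidHom 2 : (𝓞 K)ˣ →* (𝓞 K)ˣ).range with hS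
  have hfin : Finite ((𝓞 K)ˣ ⧸ S) := Nat.finite_of_card_ne_zero h
  obtain ⟨ζ0, hζ0⟩ : ∃ ζ0 : Units.torsion K, ∀ ζ : Units.torsion K, ζ ^ 2 ≠ ζ0 := by
    by_contra hcon
    push Not at hcon
    have hsurj : Function.Surjective (fun ζ : Units.torsion K => ζ ^ 2) := hcon
    have hinj := Finite.injective_iff_surjective.2 hsurj
    have hm : (-1 : (𝓞 K)ˣ) ∈ Units.torsion K := by
      change IsOfFinOrder (-1 : (𝓞 K)ˣ)
      rw [isOfFinOrder_iff_pow_eq_one]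
      exact ⟨2, by norm_num, by simp⟩
    have := @hinj ⟨-1, hm⟩ 1 (by ext; simp)
    have h1 := congrArg (fun x : Units.torsion K => ((x : (𝓞 K)ˣ) : 𝓞 K)) this
    simp at h1
    norm_num [neg_eq_iff_add_eq_zero] at h1
  let X : (Fin (Units.rank K) → Fin 2) × Fin 2 → (𝓞 K)ˣ := fun e =>
    ((ζ0 ^ (e.2 : ℕ) : Units.torsion K) : (𝓞 K)ˣ) * ∏ i, (Units.fundSystem K i) ^ ((e.1 i : ℕ) : ℤ)
  have hinj : Function.Injective (fun e => (QuotientGroup.mk (X e) : (𝓞 K)ˣ ⧸ S)) := by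
    intro e e' he
    obtain ⟨w, hw⟩ := (QuotientGroup.eq).1 he
    obtain ⟨⟨ζ, f⟩, hf, -⟩ := Units.exist_unique_eq_mul_prod K w
    have hw' : X e' = X e * w ^ 2 := by
      have : w ^ 2 = (X e)⁻¹ * X e' := hw
      rw [this]; group
    have e1 : X e' = ((ζ0 ^ (e.2 : ℕ) * ζ ^ 2 : Units.torsion K) : (𝓞 K)ˣ) *
        ∏ i, (Units.fundSystem K i) ^ (((e.1 i : ℕ) : ℤ) + 2 * f i) := by
      rw [hw', hf]
      simp only [X, zpow_add, Finset.prod_mul_distrib, mul_pow, Subgroup.coe_mul, Subgroup.coe_pow]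
      rw [← Finset.prod_pow]
      have : ∀ i, Units.fundSystem K i ^ (2 * f i) = (Units.fundSystem K i ^ f i) ^ 2 := by
        intro i; rw [mul_comm, zpow_mul]; norm_cast
      simp only [this]
      rw [mul_mul_mul_comm]
    have hu := (Units.exist_unique_eq_mul_prod K (X e')).unique
      (y₁ := (ζ0 ^ (e'.2 : ℕ), fun i => ((e'.1 i : ℕ) : ℤ)))
      (y₂ := (ζ0 ^ (e.2 : ℕ) * ζ ^ 2, fun i => ((e.1 i : ℕ) : ℤ) + 2 * f i)) rfl e1
    rw [Prod.mk.injEq] at hu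
    obtain ⟨hu1, hu2⟩ := hu
    apply Prod.ext
    · funext i
      have := congrFun hu2 i
      have h1 := (e.1 i).2
      have h2 := (e'.1 i).2
      apply Fin.ext
      omega
    · generalize e.2 = x at *
      generalize e'.2 = y at *
      fin_cases x <;> fin_cases y
      · rfl
      · exfalso
        simp at hu1
        exact hζ0 ζ hu1.symm
      · exfalso
        simp at hu1
        refine hζ0 ζ⁻¹ ?_
        rw [inv_pow, eq_comm, eq_inv_iff_mul_eq_one]
        exact hu1.symm
      · rfl
  have hc := Nat.card_le_card_of_injective _ hinj
  have hr : Fintype.card (InfinitePlace K) = Units.rank K + 1 := by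
    have : 0 < Fintype.card (InfinitePlace K) := Fintype.card_pos
    unfold Units.rank; omega
  rw [hr]
  refine le_trans (le_of_eq ?_) hc
  simp [pow_succ]

lemma fi_sq {I : FI} (h : I * I = 1) : I = 1 := by
  have hle : I ≤ 1 := by
    intro x hx
    have h2 : x * x ∈ (1 : FI) := by rw [← h]; exact FractionalIdeal.mul_mem_mul hx hx
    obtain ⟨o, ho⟩ := (mem_one_fi _).1 h2
    have hinteg : IsIntegral (𝓞 K) x := by
      apply IsIntegral.of_pow (n := 2) (by norm_num)
      rw [sq, ← ho]; exact isIntegral_algebraMap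
    exact (mem_one_fi _).2 (IsIntegrallyClosed.isIntegral_iff.1 hinteg)
  apply le_antisymm hle
  calc (1 : FI) = I * I := h.symm
    _ ≤ I * 1 := by gcongr
    _ = I := mul_one I

lemma fi_sq_unit {I J : FIˣ} (h : I ^ 2 = J ^ 2) : I = J := by
  have h1 : ((I * J⁻¹ : FIˣ) : FI) * ((I * J⁻¹ : FIˣ) : FI) = 1 := by
    rw [← Units.val_mul, ← sq, mul_pow, h, inv_pow, mul_inv_cancel, Units.val_one]
  have := fi_sq K h1
  rw [Units.val_eq_one] at this
  exact mul_inv_eq_one.1 this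

lemma mem_Z {z : Kˣ} : z ∈ ZZ ↔ ∃ J : FIˣ, pr z = J ^ 2 := by
  constructor
  · rintro ⟨a, ha⟩
    have ha0 : a ≠ 0 := by
      rintro rfl
      rw [zero_pow two_ne_zero, FractionalIdeal.spanSingleton_eq_zero_iff] at ha
      exact z.ne_zero ha
    refine ⟨Units.mk0 a ha0, ?_⟩
    ext1
    rw [coe_toPrincipalIdeal, ha]; rfl
  · rintro ⟨J, hJ⟩
    refine ⟨J, ?_⟩
    rw [← coe_toPrincipalIdeal, hJ]; rfl

lemma ker_pr {x : Kˣ} : x ∈ (pr).ker ↔ x ∈ (Units.map (algebraMap (𝓞 K) K : 𝓞 K →* K)).range := by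
  have key : ∀ y : Kˣ, y ∈ (pr).ker → ∃ a : 𝓞 K, am a = y := by
    intro y hy
    rw [MonoidHom.mem_ker] at hy
    have h1 := congrArg Units.val hy
    rw [coe_toPrincipalIdeal, Units.val_one] at h1
    apply (mem_one_fi _).1
    rw [← h1]; exact FractionalIdeal.mem_spanSingleton_self _ _
  constructor
  · intro h
    obtain ⟨a, ha⟩ := key x h
    obtain ⟨b, hb⟩ := key x⁻¹ (inv_mem h)
    have hab : a * b = 1 := by
      apply FaithfulSMul.algebraMap_injective (𝓞 K) K
      rw [map_mul, ha, hb, map_one]; simp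
    exact ⟨⟨a, b, hab, by rw [mul_comm, hab]⟩, by ext; exact ha⟩
  · rintro ⟨u, rfl⟩
    rw [MonoidHom.mem_ker]
    ext1
    rw [coe_toPrincipalIdeal, Units.val_one]
    change FractionalIdeal.spanSingleton (𝓞 K)⁰ (am (u : 𝓞 K)) = 1
    rw [sp_alg, Ideal.span_singleton_eq_top.2 u.isUnit]
    exact FractionalIdeal.coeIdeal_top _

lemma sq_le_Z : SQ ≤ ZZ := by
  rintro _ ⟨x, rfl⟩
  rw [mem_Z]
  exact ⟨pr x, by simp⟩

lemma ker_le_Z : (pr).ker ≤ ZZ := by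
  intro x hx
  rw [mem_Z]
  exact ⟨1, by rw [(MonoidHom.mem_ker).1 hx]; simp⟩

lemma sel_lower (h : (SQ).relIndex ZZ ≠ 0) :
    2 ^ Fintype.card (InfinitePlace K) * Nat.card {c : CG K // c ^ 2 = 1} ≤ (SQ).relIndex ZZ := by
  have hT : (pr).ker ⊔ SQ ≤ ZZ := sup_le (ker_le_Z K) (sq_le_Z K)
  have hm := Subgroup.relIndex_mul_relIndex SQ ((pr).ker ⊔ SQ) ZZ le_sup_right hT
  rw [Subgroup.relIndex_sup_right] at hm
  have h1 : (SQ).relIndex (pr).ker ≠ 0 := fun h0 => h (by rw [← hm, h0, zero_mul])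
  have h2 : ((pr).ker ⊔ SQ).relIndex ZZ ≠ 0 := fun h0 => h (by rw [← hm, h0, mul_zero])
  have e1 : (SQ).relIndex (pr).ker = (powMonoidHom 2 : (𝓞 K)ˣ →* (𝓞 K)ˣ).range.index := by
    have : (pr).ker = (Units.map (algebraMap (𝓞 K) K : 𝓞 K →* K)).range := by
      ext x; exact ker_pr K
    rw [this, ← Subgroup.index_comap]
    congr 1
    ext u
    rw [Subgroup.mem_comap]
    constructor
    · rintro ⟨x, hx⟩
      have hx' : x ^ 2 = Units.map (algebraMap (𝓞 K) K : 𝓞 K →* K) u := hx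
      have hk : x ∈ (pr).ker := by
        rw [MonoidHom.mem_ker]
        apply fi_sq_unit
        rw [← map_pow, hx', one_pow]
        exact (MonoidHom.mem_ker).1 ((ker_pr K).2 ⟨u, rfl⟩)
      obtain ⟨v, rfl⟩ := (ker_pr K).1 hk
      refine ⟨v, ?_⟩
      rw [← map_pow] at hx'
      exact Units.map_injective (FaithfulSMul.algebraMap_injective (𝓞 K) K) hx'
    · rintro ⟨v, rfl⟩
      exact ⟨Units.map (algebraMap (𝓞 K) K : 𝓞 K →* K) v, by simp⟩
  rw [← hm]
  apply Nat.mul_le_mul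
  · rw [e1] at h1 ⊢; exact units_sq_lower K h1
  · have : Finite (ZZ ⧸ ((pr).ker ⊔ SQ).subgroupOf ZZ) := Nat.finite_of_card_ne_zero h2
    have hz : ∀ c : {c : CG K // c ^ 2 = 1}, ∃ (z : ZZ) (J : FIˣ), pr (z : Kˣ) = J ^ 2 ∧ QuotientGroup.mk J = c.1 := by
      rintro ⟨c, hc⟩
      obtain ⟨J, rfl⟩ := QuotientGroup.mk_surjective c
      rw [← QuotientGroup.mk_pow, QuotientGroup.eq_one_iff] at hc
      obtain ⟨z, hz⟩ := hc
      exact ⟨⟨z, (mem_Z K).2 ⟨J, hz⟩⟩, J, hz, rfl⟩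
    choose z J hzJ hJ using hz
    refine Nat.card_le_card_of_injective (fun c => (QuotientGroup.mk (z c) : ZZ ⧸ ((pr).ker ⊔ SQ).subgroupOf ZZ)) ?_
    intro c c' hcc
    have h3 := (QuotientGroup.eq).1 hcc
    rw [Subgroup.mem_subgroupOf] at h3
    obtain ⟨e, he, q, ⟨x, hq⟩, hprod⟩ := Subgroup.mem_sup.1 h3
    have hq' : x ^ 2 = q := hq
    apply Subtype.ext
    rw [← hJ, ← hJ, QuotientGroup.eq]
    refine ⟨x, ?_⟩
    apply fi_sq_unit
    rw [mul_pow, inv_pow, ← hzJ, ← hzJ, ← map_pow, hq', ← map_inv, ← map_mul]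
    have h4 : (((z c : Kˣ))⁻¹ * (z c' : Kˣ) : Kˣ) = e * q := hprod.symm
    rw [h4, map_mul, (MonoidHom.mem_ker).1 he, one_mul]
end
end Recip

end

section
open NumberField
open scoped nonZeroDivisors TensorProduct
namespace Recip
set_option linter.unusedSectionVars false
section
variable {K : Type*} [Field K] [NumberField K]
local notation "sp2" => (Ideal.span {(2 : 𝓞 K)})
local notation "am" => algebraMap (𝓞 K) K
local notation "FI" => FractionalIdeal (𝓞 K)⁰ K
local notation "pr" => toPrincipalIdeal (𝓞 K) K
local notation "ZZ" => singularSubgroup K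
local notation "SQ" => squaresSubgroup K

/-- The ideal class of a nonzero integral ideal. -/
noncomputable def icl (I : Ideal (𝓞 K)) (hI : I ≠ ⊥) : CG K :=
  QuotientGroup.mk (Units.mk0 (I : FI) (FractionalIdeal.coeIdeal_ne_zero.2 hI))

lemma icl_mul {I J : Ideal (𝓞 K)} (hI : I ≠ ⊥) (hJ : J ≠ ⊥) (hIJ : I * J ≠ ⊥) :
    icl (I * J) hIJ = icl I hI * icl J hJ := by
  rw [icl, icl, icl, ← QuotientGroup.mk_mul]
  congr 1
  ext1
  simp

lemma icl_one {I : Ideal (𝓞 K)} (hI : I ≠ ⊥) (h : icl I hI = 1) : ∃ α, I = Ideal.span {α} := by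
  rw [icl, QuotientGroup.eq_one_iff] at h
  obtain ⟨x, hx⟩ := h
  have h1 := congrArg Units.val hx
  rw [coe_toPrincipalIdeal, Units.val_mk0] at h1
  have h2 : (x : K) ∈ (I : FI) := by rw [← h1]; exact FractionalIdeal.mem_spanSingleton_self _ _
  obtain ⟨a, -, ha⟩ := (FractionalIdeal.mem_coeIdeal _).1 h2
  refine ⟨a, ?_⟩
  rw [← ha, sp_alg] at h1
  exact (FractionalIdeal.coeIdeal_injective h1).symm

lemma icl_surj (c : CG K) (N : Ideal (𝓞 K)) (hN : N ≠ ⊥) :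
    ∃ (I : Ideal (𝓞 K)) (hI : I ≠ ⊥), IsCoprime I N ∧ icl I hI = c := by
  obtain ⟨J, rfl⟩ := QuotientGroup.mk_surjective c
  obtain ⟨β, hβ, b, hb, hcop⟩ := exists_coprime_ideal (J : FI) J.ne_zero N hN
  have hb0 : b ≠ ⊥ := by
    rintro rfl
    have : (FractionalIdeal.spanSingleton (𝓞 K)⁰ β * (J : FI)) ≠ 0 :=
      mul_ne_zero (FractionalIdeal.spanSingleton_ne_zero_iff.2 hβ) J.ne_zero
    exact this (by rw [hb]; simp)
  refine ⟨b, hb0, hcop, ?_⟩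
  rw [icl, eq_comm, QuotientGroup.eq]
  refine ⟨Units.mk0 β hβ, ?_⟩
  rw [eq_inv_mul_iff_mul_eq]
  ext1
  rw [Units.val_mul, coe_toPrincipalIdeal, Units.val_mk0, Units.val_mk0, mul_comm, hb]

variable {d : Ideal (𝓞 K)} (hd : d ≠ ⊥)

/-- the data attached to a representative -/
structure Good (d : Ideal (𝓞 K)) (a : 𝓞 K) : Prop where
  ne : sp2 * d * Ideal.span {a} ≠ ⊥
  prin : ∀ α : 𝓞 K, IsCoprime (Ideal.span {α}) (sp2 * d * Ideal.span {a}) → Jac a (Ideal.span {α}) = 1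

lemma Good.wd {a : 𝓞 K} (h : Good d a) {I I' : Ideal (𝓞 K)} (hI : I ≠ ⊥) (hI' : I' ≠ ⊥)
    (c : IsCoprime I (sp2 * d * Ideal.span {a})) (c' : IsCoprime I' (sp2 * d * Ideal.span {a}))
    (e : icl I hI = icl I' hI') : Jac a I = Jac a I' := by
  obtain ⟨J, hJ, cJ, eJ⟩ := icl_surj (icl I hI)⁻¹ _ h.ne
  have key : ∀ (L : Ideal (𝓞 K)) (hL : L ≠ ⊥), IsCoprime L (sp2 * d * Ideal.span {a}) →
      icl L hL = icl I hI → Jac a L * Jac a J = 1 := by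
    intro L hL cL eL
    have h0 : L * J ≠ ⊥ := mul_ne_zero hL hJ
    have h1 : icl (L * J) h0 = 1 := by rw [icl_mul hL hJ, eL, eJ, mul_inv_cancel]
    obtain ⟨α, hα⟩ := icl_one h0 h1
    rw [← Jac_mul a hL hJ, hα]
    apply h.prin
    rw [← hα]; exact cL.mul_left cJ
  have k1 := key I hI c rfl
  have k2 := key I' hI' c' e.symm
  have h3 : Jac a J ≠ 0 := by rintro h3; rw [h3, mul_zero] at k1; exact zero_ne_one k1
  exact mul_right_cancel₀ h3 (k1.trans k2.symm)

lemma Good.chi {a : 𝓞 K} (h : Good d a) : ∃ χ : CG K →* ℂ, ∀ (I : Ideal (𝓞 K)) (hI : I ≠ ⊥),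
    IsCoprime I (sp2 * d * Ideal.span {a}) → χ (icl I hI) = Jac a I := by
  choose I hI cI eI using fun c : CG K => icl_surj c _ h.ne
  have w : ∀ (J : Ideal (𝓞 K)) (hJ : J ≠ ⊥), IsCoprime J (sp2 * d * Ideal.span {a}) →
    Jac a (I (icl J hJ)) = Jac a J := fun J hJ cJ => h.wd (hI _) hJ (cI _) cJ (eI _)
  refine ⟨⟨⟨fun c => (Jac a (I c) : ℂ), ?_⟩, ?_⟩, ?_⟩
  · have ht : (⊤ : Ideal (𝓞 K)) ≠ ⊥ := top_ne_bot
    have e1 : icl (⊤ : Ideal (𝓞 K)) ht = 1 := by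
      rw [icl, QuotientGroup.eq_one_iff]
      refine ⟨1, ?_⟩
      ext1; simp
    have := w ⊤ ht (by rw [← Ideal.one_eq_top]; exact isCoprime_one_left)
    rw [e1, Jac_one] at this
    rw [this]; simp
  · intro x y
    have h0 : I x * I y ≠ ⊥ := mul_ne_zero (hI x) (hI y)
    have := w (I x * I y) h0 ((cI x).mul_left (cI y))
    rw [icl_mul (hI x) (hI y), eI, eI, Jac_mul _ (hI x) (hI y)] at this
    simp only [this]; push_cast; rfl
  · intro J hJ cJ
    change (Jac a (I (icl J hJ)) : ℂ) = _
    rw [w J hJ cJ]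

/-- squares in a group -/
abbrev sqr (G : Type*) [CommGroup G] : Subgroup G := (powMonoidHom 2 : G →* G).range

lemma good_of {b : LinearMap.BilinForm (ZMod 2) (V2 K)} (hd : d ≠ ⊥)
    (hb : ∀ a a', IsCoprime (Ideal.span {a}) (sp2 * d) → IsCoprime (Ideal.span {a'}) (sp2 * d) →
      IsCoprime (Ideal.span {a}) (Ideal.span {a'}) →
      Jac a' (Ideal.span {a}) * Jac a (Ideal.span {a'}) = sInf (am a) (am a') * sg (b (cl a) (cl a')))
    (z : ZZ) (h1 : sgnv (z : Kˣ) = 0) (h2 : ∀ y, b (gcl z) y = 0) :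
    ∃ (β : Kˣ) (a : 𝓞 K), am a = (z : Kˣ) * β ^ 2 ∧ Good d a := by
  have h2d : sp2 * d ≠ ⊥ := mul_ne_zero span2_ne hd
  obtain ⟨β, a, J, ha, hc, hJ⟩ := exists_rep z.2 (sp2 * d) h2d
  have a0 : a ≠ 0 := odd_ne (IsCoprime.of_mul_right_left hc)
  have hJ0 : J ≠ ⊥ := by rintro rfl; rw [Ideal.bot_mul] at hJ; exact span_ne a0 hJ
  refine ⟨β, a, ha, mul_ne_zero h2d (span_ne a0), ?_⟩
  intro α hα
  have c1 := IsCoprime.of_mul_right_left hα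
  have c2 := IsCoprime.of_mul_right_right hα
  have α0 : α ≠ 0 := odd_ne (IsCoprime.of_mul_right_left c1)
  have key := hb a α hc c1 c2.symm
  have e1 : am a = ((z * β ^ 2 : Kˣ) : K) := by rw [ha]; push_cast; rfl
  have e2 : am α = ((Units.mk0 (am α) (am_ne α0) : Kˣ) : K) := rfl
  rw [← gcl_eq z ha (IsCoprime.of_mul_right_left hc), h2, e1, e2, sInf_eq, ← sg_add, sgnv_mul, sgnv_sq, h1] at key
  simp only [add_zero, Pi.zero_apply, zero_mul, Finset.sum_const_zero, sg_one.2 rfl] at key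
  rw [hJ, Jac_mul _ hJ0 hJ0] at key
  have c3 : IsCoprime (Ideal.span {α}) J := by rw [hJ] at c2; exact IsCoprime.of_mul_right_left c2
  rwa [pm_sq (Jac_pm c3), one_mul] at key

lemma card_dual (G : Type*) [CommGroup G] [Finite G] : Nat.card (G →* ℂˣ) = Nat.card G := by
  exact CommGroup.card_monoidHom_of_hasEnoughRootsOfUnity G ℂ

lemma dual_bound (G : Type*) [CommGroup G] [Finite G] {Q : Type*} (χ : Q → (G →* ℂ))
    (hinj : Function.Injective χ) (hsq : ∀ q c, χ q c * χ q c = 1) :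
    Finite Q ∧ Nat.card Q ≤ Nat.card {c : G // c ^ 2 = 1} := by
  have hmem : ∀ q : Q, ∀ c ∈ sqr G, (χ q).toHomUnits c = 1 := by
    rintro q _ ⟨c, rfl⟩
    ext1
    simp only [powMonoidHom_apply, map_pow, Units.val_pow_eq_pow_val, Units.val_one]
    rw [MonoidHom.coe_toHomUnits, sq, hsq]
  let X : Q → ((G ⧸ sqr G) →* ℂˣ) := fun q => QuotientGroup.lift _ (χ q).toHomUnits (hmem q)
  have hX : Function.Injective X := by
    intro q q' h
    apply hinj
    ext c
    have := DFunLike.congr_fun h (QuotientGroup.mk c)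
    exact congrArg Units.val this
  have hfin : Finite ((G ⧸ sqr G) →* ℂˣ) := by
    apply Nat.finite_of_card_ne_zero
    rw [card_dual]; exact Nat.card_pos.ne'
  refine ⟨Finite.of_injective X hX, ?_⟩
  have := Nat.card_le_card_of_injective X hX
  rw [card_dual] at this
  exact this.trans (le_of_eq (card_mod_sq G))

lemma SR_bound [Finite (CG K)] {b : LinearMap.BilinForm (ZMod 2) (V2 K)} (hd : d ≠ ⊥)
    (hb : ∀ a a', IsCoprime (Ideal.span {a}) (sp2 * d) → IsCoprime (Ideal.span {a'}) (sp2 * d) →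
      IsCoprime (Ideal.span {a}) (Ideal.span {a'}) →
      Jac a' (Ideal.span {a}) * Jac a (Ideal.span {a'}) = sInf (am a) (am a') * sg (b (cl a) (cl a')))
    (S : Subgroup ZZ) (hS : ∀ z ∈ S, sgnv (z : Kˣ) = 0 ∧ ∀ y, b (gcl z) y = 0) :
    ((SQ).subgroupOf ZZ).relIndex S ≠ 0 ∧
      ((SQ).subgroupOf ZZ).relIndex S ≤ Nat.card {c : CG K // c ^ 2 = 1} := by
  choose β a ha hg using fun z : S => good_of hd hb z.1 (hS z.1 z.2).1 (hS z.1 z.2).2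
  choose χ hχ using fun z : S => (hg z).chi
  have inj : ∀ z w : S, χ z = χ w → ((z : ZZ) : Kˣ) * ((w : ZZ) : Kˣ) ∈ SQ := by
    intro z w hzw
    have e : am (a z * a w) = (((z : ZZ) : Kˣ) * ((w : ZZ) : Kˣ) * (β z * β w) ^ 2 : Kˣ) := by
      rw [map_mul, ha, ha]; push_cast; ring
    have hs : IsSquare (am (a z * a w)) := by
      by_contra hns
      obtain ⟨P, hP, hP0, hN, hl⟩ := inert_prime (a z * a w) hns
        ((sp2 * d * Ideal.span {a z}) * (sp2 * d * Ideal.span {a w})) (mul_ne_zero (hg z).ne (hg w).ne)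
      have hm : P.IsMaximal := hP.isMaximal hP0
      have cN : IsCoprime P ((sp2 * d * Ideal.span {a z}) * (sp2 * d * Ideal.span {a w})) := by
        apply cop_of_prime
        intro Q hQ hPQ hNQ
        rw [← hm.eq_of_le hQ.ne_top hPQ] at hNQ
        exact hN hNQ
      have e1 := hχ z P hP0 (IsCoprime.of_mul_right_left cN)
      have e2 := hχ w P hP0 (IsCoprime.of_mul_right_right cN)
      rw [hzw, e2] at e1
      have e3 : Jac (a w) P = Jac (a z) P := by exact_mod_cast e1
      have c4 : IsCoprime (Ideal.span {a z}) P :=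
        (IsCoprime.of_mul_right_right (IsCoprime.of_mul_right_left cN)).symm
      have : Jac (a z * a w) P = 1 := by rw [Jac_mul_left, e3, pm_sq (Jac_pm c4)]
      rw [Jac_prime _ hP hP0, hl] at this
      norm_num at this
    obtain ⟨s, hs⟩ := hs
    rw [e] at hs
    have s0 : s ≠ 0 := by
      rintro rfl
      rw [mul_zero] at hs
      exact Units.ne_zero _ hs
    refine ⟨Units.mk0 s s0 * (β z * β w)⁻¹, ?_⟩
    have : Units.mk0 s s0 ^ 2 = ((z : ZZ) : Kˣ) * ((w : ZZ) : Kˣ) * (β z * β w) ^ 2 := by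
      ext1; rw [hs]; simp [sq]
    rw [powMonoidHom_apply, mul_pow, this, inv_pow, mul_inv_cancel_right]
  have hsq : ∀ (z : S) (c : CG K), χ z c * χ z c = 1 := by
    intro z c
    obtain ⟨I, hI, cI, rfl⟩ := icl_surj c _ (hg z).ne
    rw [hχ z I hI cI]
    have := pm_sq (Jac_pm (IsCoprime.of_mul_right_right cI).symm)
    exact_mod_cast this
  let X : (S ⧸ ((SQ).subgroupOf ZZ).subgroupOf S) → (CG K →* ℂ) := fun q => χ q.out
  have hX : Function.Injective X := by
    intro q q' h1
    have h2 := inj _ _ h1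
    rw [← QuotientGroup.out_eq' q, ← QuotientGroup.out_eq' q', QuotientGroup.eq, Subgroup.mem_subgroupOf,
      Subgroup.mem_subgroupOf]
    have h3 : ((((q.out)⁻¹ * q'.out : S) : ZZ) : Kˣ) =
        ((((q.out : S) : ZZ) : Kˣ)⁻¹) ^ 2 * ((((q.out : S) : ZZ) : Kˣ) * (((q'.out : S) : ZZ) : Kˣ)) := by
      push_cast; group
    rw [h3]
    exact mul_mem ⟨_, rfl⟩ h2
  obtain ⟨hfin', hle⟩ := dual_bound (CG K) X hX (fun q c => hsq _ c)
  exact ⟨Nat.card_pos.ne', hle⟩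
end
end Recip

end

section
open NumberField
open scoped nonZeroDivisors TensorProduct
namespace Recip
set_option linter.unusedSectionVars false
section
variable (K : Type*) [Field K] [NumberField K]
local notation "FI" => FractionalIdeal (𝓞 K)⁰ K
local notation "pr" => toPrincipalIdeal (𝓞 K) K
local notation "ZZ" => singularSubgroup K
local notation "SQ" => squaresSubgroup K

lemma weak_approx (t : (K →+* ℝ) → ℤ) : ∃ x : K, ∀ φ : K →+* ℝ, |φ x - t φ| < 1 := by
  classical
  let pl : (K →+* ℝ) → InfinitePlace K := fun φ => InfinitePlace.mk ((algebraMap ℝ ℂ).comp φ)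
  have hpl : Function.Injective pl := by
    intro φ ψ h
    have : (algebraMap ℝ ℂ).comp φ = (algebraMap ℝ ℂ).comp ψ := by
      rcases InfinitePlace.mk_eq_iff.1 h with h | h
      · exact h
      · rw [← h]
        ext x
        simp [ComplexEmbedding.conjugate]
    ext x
    have := DFunLike.congr_fun this x
    exact Complex.ofReal_injective this
  let s : InfinitePlace K → ℤ := Function.extend pl t 0
  obtain ⟨x, hx⟩ := (Metric.denseRange_iff.1 (InfinitePlace.denseRange_algebraMap_pi K))
    (fun v => ((s v : ℤ) : WithAbs v.1)) 1 one_pos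
  refine ⟨x, fun φ => ?_⟩
  have h1 := lt_of_le_of_lt (dist_le_pi_dist _ _ (pl φ)) hx
  rw [dist_comm, dist_eq_norm] at h1
  have h2 : s (pl φ) = t φ := hpl.extend_apply _ _ _
  rw [h2] at h1
  have h3 : ‖(algebraMap K ((v : InfinitePlace K) → WithAbs v.1) x (pl φ)) - ((t φ : ℤ) : WithAbs (pl φ).1)‖
      = |φ x - t φ| := by
    rw [WithAbs.norm_eq_apply_ofAbs]
    have : (pl φ) (x - (t φ : ℤ)) = |φ x - t φ| := by
      simp only [pl, InfinitePlace.apply, RingHom.comp_apply, map_sub, map_intCast]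
      rw [← Real.norm_eq_abs, ← Complex.norm_real]
      simp
    exact this
  rwa [h3] at h1

lemma sgnv_surj : Function.Surjective (sgnv : Kˣ → (K →+* ℝ) → ZMod 2) := by
  intro s
  obtain ⟨x, hx⟩ := weak_approx K (fun φ => if s φ = 1 then -1 else 1)
  have hne : Nonempty (K →+* ℝ) ∨ IsEmpty (K →+* ℝ) := (isEmpty_or_nonempty _).symm
  rcases hne with ⟨⟨φ0⟩⟩ | hne
  · have hx0 : x ≠ 0 := by
      rintro rfl
      have := hx φ0
      split_ifs at this <;> norm_num at this
    refine ⟨Units.mk0 x hx0, ?_⟩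
    funext φ
    have h1 := hx φ
    rw [abs_lt] at h1
    have h2 : s φ = 0 ∨ s φ = 1 := by generalize s φ = y; revert y; decide
    rcases h2 with h2 | h2
    · rw [h2] at h1 ⊢
      norm_num at h1
      have h3 : ¬ φ ((Units.mk0 x hx0 : Kˣ) : K) < 0 := not_lt.2 h1.1.le
      exact if_neg h3
    · rw [h2] at h1 ⊢
      norm_num at h1
      have h3 : φ ((Units.mk0 x hx0 : Kˣ) : K) < 0 := h1.2
      exact if_pos h3
  · exact ⟨1, Subsingleton.elim _ _⟩

/-- the sign map as a homomorphism -/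
noncomputable def SG : Kˣ →* Multiplicative ((K →+* ℝ) → ZMod 2) :=
  MonoidHom.mk' (fun z => Multiplicative.ofAdd (sgnv z)) (fun z w => by rw [← ofAdd_add, ← sgnv_mul])

lemma SG_surj : Function.Surjective (SG K) := fun s => by
  obtain ⟨z, hz⟩ := sgnv_surj K (Multiplicative.toAdd s)
  exact ⟨z, by simp [SG, hz]⟩

lemma mem_ker_SG {z : Kˣ} : z ∈ (SG K).ker ↔ ∀ φ : K →+* ℝ, 0 < φ z := by
  rw [← sgnv_zero, MonoidHom.mem_ker]; rfl

local notation "PP" => totPosPrincipalSubgroup K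

lemma mem_PP {J : FIˣ} : J ∈ PP ↔ ∃ x ∈ (SG K).ker, pr x = J := by
  constructor
  · rintro ⟨x, hx, h⟩
    exact ⟨x, (mem_ker_SG K).2 hx, by ext1; rw [coe_toPrincipalIdeal, h]⟩
  · rintro ⟨x, hx, rfl⟩
    exact ⟨x, (mem_ker_SG K).1 hx, by rw [coe_toPrincipalIdeal]⟩

lemma PP_le : PP ≤ (pr).range := by
  intro J hJ
  obtain ⟨x, -, h⟩ := (mem_PP K).1 hJ
  exact ⟨x, h⟩

/-- Index of squares in a quotient group. -/
lemma quot_sq {A : Type*} [CommGroup A] (B : Subgroup A) [Finite (A ⧸ B)] :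
    Nat.card {c : A ⧸ B // c ^ 2 = 1} = (B ⊔ sqr A).index := by
  rw [← card_mod_sq (A ⧸ B), ← Subgroup.index_comap_of_surjective _ (QuotientGroup.mk'_surjective B)]
  congr 1
  ext x
  rw [Subgroup.mem_comap, Subgroup.mem_sup]
  constructor
  · rintro ⟨y, hy⟩
    obtain ⟨y, rfl⟩ := QuotientGroup.mk_surjective y
    have h : (QuotientGroup.mk (y ^ 2) : A ⧸ B) = QuotientGroup.mk x := hy
    rw [QuotientGroup.eq] at h
    exact ⟨_, h, y ^ 2, ⟨y, rfl⟩, by rw [mul_comm, mul_inv_cancel_left]⟩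
  · rintro ⟨b, hb, _, ⟨y, rfl⟩, rfl⟩
    refine ⟨QuotientGroup.mk y, ?_⟩
    change (QuotientGroup.mk (y ^ 2) : A ⧸ B) = QuotientGroup.mk (b * y ^ 2)
    rw [QuotientGroup.eq, mul_comm b, inv_mul_cancel_left]
    exact hb

instance finite_CG : Finite (CG K) :=
  Finite.of_equiv _ (ClassGroup.equiv (R := 𝓞 K) K).toEquiv

lemma card_CG_two : Nat.card {c : CG K // c ^ 2 = 1} = Nat.card {c : ClassGroup (𝓞 K) // c ^ 2 = 1} := by
  symm
  refine Nat.card_congr ((ClassGroup.equiv (R := 𝓞 K) K).toEquiv.subtypeEquiv fun c => ?_)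
  change c ^ 2 = 1 ↔ (ClassGroup.equiv (R := 𝓞 K) K c) ^ 2 = 1
  rw [← map_pow, map_eq_one_iff _ (MulEquiv.injective _)]

instance finite_narrow : Finite (NarrowClassGroup K) := by
  apply Nat.finite_of_card_ne_zero
  change (PP).index ≠ 0
  rw [← Subgroup.relIndex_mul_index (PP_le K)]
  refine mul_ne_zero ?_ ?_
  · rw [← Subgroup.index_comap]
    have hle : (SG K).ker ≤ (PP).comap pr := fun x hx => (mem_PP K).2 ⟨x, hx, rfl⟩
    refine ne_zero_of_dvd_ne_zero ?_ (Subgroup.index_dvd_of_le hle)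
    rw [Subgroup.index_ker]
    exact Nat.card_pos.ne'
  · exact (Nat.card_pos (α := CG K)).ne'

lemma narrow_card : Nat.card {c : NarrowClassGroup K // c ^ 2 = 1} * Nat.card ((ZZ).map (SG K)) =
    Nat.card {c : CG K // c ^ 2 = 1} * 2 ^ Nat.card (K →+* ℝ) := by
  rw [quot_sq, quot_sq]
  have hle : PP ⊔ sqr FIˣ ≤ (pr).range ⊔ sqr FIˣ := sup_le_sup_right (PP_le K) _
  rw [← Subgroup.relIndex_mul_index hle]
  have e1 : (PP ⊔ sqr FIˣ).relIndex ((pr).range ⊔ sqr FIˣ) = ((ZZ).map (SG K)).index := by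
    have : (pr).range ⊔ sqr FIˣ = (pr).range ⊔ (PP ⊔ sqr FIˣ) := by
      rw [← sup_assoc, sup_eq_left.2 (PP_le K)]
    rw [this, Subgroup.relIndex_sup_right, ← Subgroup.index_comap,
      ← Subgroup.index_comap_of_surjective _ (SG_surj K)]
    congr 1
    ext z
    rw [Subgroup.mem_comap, Subgroup.mem_comap, Subgroup.mem_sup]
    constructor
    · rintro ⟨p, hp, _, ⟨J, rfl⟩, h⟩
      obtain ⟨y, hy, rfl⟩ := (mem_PP K).1 hp
      refine ⟨y⁻¹ * z, (mem_Z K).2 ⟨J, ?_⟩, ?_⟩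
      · rw [map_mul, map_inv, ← h, inv_mul_cancel_left]; rfl
      · rw [map_mul, map_inv, (MonoidHom.mem_ker).1 hy]; simp
    · rintro ⟨w, hw, h⟩
      obtain ⟨J, hJ⟩ := (mem_Z K).1 hw
      refine ⟨pr (z * w⁻¹), (mem_PP K).2 ⟨_, ?_, rfl⟩, J ^ 2, ⟨J, rfl⟩, ?_⟩
      · rw [MonoidHom.mem_ker, map_mul, map_inv, h, mul_inv_cancel]
      · rw [← hJ, ← map_mul, inv_mul_cancel_right]
  rw [e1]
  have e2 := Subgroup.card_mul_index ((ZZ).map (SG K))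
  have e3 : Nat.card (Multiplicative ((K →+* ℝ) → ZMod 2)) = 2 ^ Nat.card (K →+* ℝ) := by
    rw [Nat.card_congr Multiplicative.toAdd, Nat.card_fun, Nat.card_zmod]
  rw [e3] at e2
  rw [← e2]; ring
end
end Recip

end

section
open NumberField
open scoped nonZeroDivisors TensorProduct
namespace Recip
set_option linter.unusedSectionVars false
section
variable (K : Type*) [Field K] [NumberField K]
local notation "sp2" => (Ideal.span {(2 : 𝓞 K)})
local notation "am" => algebraMap (𝓞 K) K
local notation "ZZ" => singularSubgroup K
local notation "SQ" => squaresSubgroup K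
local notation "F2" => ZMod 2
local notation "VA" => ((K →+* ℝ) → ZMod 2)

/-- image of the localisation map, as a subspace -/
noncomputable def WW : Submodule (ZMod 2) (((K →+* ℝ) → ZMod 2) × V2 K) where
  carrier := {x | ∃ z : singularSubgroup K, FF z = Multiplicative.ofAdd x}
  zero_mem' := ⟨1, by rw [map_one]; rfl⟩
  add_mem' := by
    rintro x y ⟨z, hz⟩ ⟨w, hw⟩
    exact ⟨z * w, by rw [map_mul, hz, hw]; rfl⟩
  smul_mem' := by
    rintro c x ⟨z, hz⟩
    have h : c = 0 ∨ c = 1 := by revert c; decide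
    rcases h with rfl | rfl
    · exact ⟨1, by rw [map_one, zero_smul]; rfl⟩
    · exact ⟨z, by rw [hz, one_smul]⟩

/-- preimage of a subspace under the localisation map -/
noncomputable def ST (T : Submodule (ZMod 2) (((K →+* ℝ) → ZMod 2) × V2 K)) : Subgroup (singularSubgroup K) :=
  (AddSubgroup.toSubgroup T.toAddSubgroup).comap FF

lemma mem_ST {T : Submodule F2 (VA × V2 K)} {z : ZZ} : z ∈ ST K T ↔ (sgnv (z : Kˣ), gcl z) ∈ T := Iff.rfl

lemma gcl_sq {z : ZZ} (h : (z : Kˣ) ∈ SQ) : gcl z = 0 := by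
  obtain ⟨x, hx⟩ := h
  have hx' : x ^ 2 = (z : Kˣ) := hx
  have hodd : IsCoprime (Ideal.span {(1 : 𝓞 K)}) sp2 := by
    rw [Ideal.span_singleton_one, ← Ideal.one_eq_top]; exact isCoprime_one_left
  rw [gcl_eq z (a := 1) (β := x⁻¹) _ hodd, cl_eq_zero hodd]
  · exact ⟨1, by simp⟩
  · rw [← hx']; simp

lemma Q_le_ker : (SQ).subgroupOf ZZ ≤ (FF (K := K)).ker := by
  intro z hz
  rw [Subgroup.mem_subgroupOf] at hz
  rw [MonoidHom.mem_ker]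
  change Multiplicative.ofAdd (sgnv (z : Kˣ), gcl z) = 1
  rw [gcl_sq K hz]
  obtain ⟨x, hx⟩ := hz
  have hx' : x ^ 2 = (z : Kˣ) := hx
  rw [← hx', sgnv_sq]; rfl

lemma relIndex_ST (T : Submodule F2 (VA × V2 K)) :
    ((SQ).subgroupOf ZZ).relIndex (ST K T) =
      ((SQ).subgroupOf ZZ).relIndex (FF (K := K)).ker * 2 ^ Module.finrank F2 (WW K ⊓ T : Submodule F2 (VA × V2 K)) := by
  have hk : (FF (K := K)).ker ≤ ST K T := by
    intro z hz
    rw [ST, Subgroup.mem_comap, (MonoidHom.mem_ker).1 hz]; exact one_mem _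
  rw [← Subgroup.relIndex_mul_relIndex _ _ _ (Q_le_ker K) hk, Subgroup.relIndex_ker]
  congr 1
  have h1 := Module.natCard_eq_pow_finrank (K := ZMod 2) (V := (WW K ⊓ T : Submodule F2 (VA × V2 K)))
  rw [Nat.card_zmod] at h1
  rw [← h1]
  refine Nat.card_congr (Multiplicative.toAdd.subtypeEquiv fun x => ?_)
  constructor
  · rintro ⟨z, hz, rfl⟩
    exact ⟨⟨z, rfl⟩, hz⟩
  · rintro ⟨⟨z, hz⟩, hT⟩
    refine ⟨z, ?_, hz⟩
    change FF z ∈ AddSubgroup.toSubgroup T.toAddSubgroup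
    rw [hz]; exact hT

/-- dot product on signs -/
noncomputable def dotA : LinearMap.BilinForm (ZMod 2) ((K →+* ℝ) → ZMod 2) :=
  LinearMap.mk₂ (ZMod 2) (fun x y => ∑ φ, x φ * y φ)
    (fun x y z => by simp [add_mul, Finset.sum_add_distrib])
    (fun c x y => by simp [Finset.mul_sum, mul_assoc])
    (fun x y z => by simp [mul_add, Finset.sum_add_distrib])
    (fun c x y => by simp [Finset.mul_sum, mul_left_comm])

lemma dotA_apply (x y : VA) : dotA K x y = ∑ φ, x φ * y φ := rfl

lemma dotA_symm (x y : VA) : dotA K x y = dotA K y x := by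
  rw [dotA_apply, dotA_apply]; exact Finset.sum_congr rfl fun φ _ => mul_comm _ _

lemma dotA_nd : (dotA K).Nondegenerate := by
  classical
  have key : ∀ x : VA, (∀ y, dotA K x y = 0) → x = 0 := by
    intro x h
    funext φ
    have := h (Pi.single φ 1)
    rw [dotA_apply] at this
    simpa [Pi.single_apply] using this
  refine ⟨key, fun y h => key y fun x => ?_⟩
  rw [dotA_symm]; exact h x

theorem main (ρ ρplus : ℕ)
    (hρ : Nat.card {c : ClassGroup (𝓞 K) // c ^ 2 = 1} = 2 ^ ρ)
    (hρplus : Nat.card {c : NarrowClassGroup K // c ^ 2 = 1} = 2 ^ ρplus) :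
    (SQ).relIndex (ZZ ⊓ adicSquareClass K) = 2 ^ ρplus ∧
    (SQ).relIndex (ZZ ⊓ adicSquareClass K ⊓ posModSquares K) = 2 ^ ρ := by
  obtain ⟨d, hd, -, b, sB, hb⟩ := recip2 K
  rw [← card_CG_two] at hρ
  set ν := ((SQ).subgroupOf ZZ).relIndex (FF (K := K)).ker with hν
  -- upper bound
  have hSR := SR_bound hd hb (ST K ((⊥ : Submodule F2 VA).prod (LinearMap.ker b))) (by
    intro z hz
    have hz' : sgnv (z : Kˣ) ∈ (⊥ : Submodule F2 VA) ∧ gcl z ∈ LinearMap.ker b := hz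
    refine ⟨(Submodule.mem_bot _).1 hz'.1, fun y => ?_⟩
    rw [(LinearMap.mem_ker).1 hz'.2]; rfl)
  rw [relIndex_ST, hρ] at hSR
  have hν0 : ν ≠ 0 := fun h => hSR.1 (by rw [← hν, h, zero_mul])
  -- lower bound
  have htop : (SQ).relIndex ZZ = ν * 2 ^ Module.finrank F2 (WW K) := by
    have h1 := relIndex_ST K ⊤
    have h2 : ST K ⊤ = ⊤ := by
      rw [eq_top_iff]; intro z _; exact (mem_ST K).2 Submodule.mem_top
    rw [h2, inf_top_eq, Subgroup.relIndex_top_right] at h1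
    exact h1
  have hlow := sel_lower K (by rw [htop]; exact mul_ne_zero hν0 (by positivity))
  rw [htop, hρ, ← pow_add] at hlow
  -- dimension count
  have hA : Module.finrank F2 VA = Nat.card (K →+* ℝ) := by
    rw [Module.finrank_fintype_fun_eq_card, Nat.card_eq_fintype_card]
  have h3 : Module.finrank F2 VA + Module.finrank F2 (V2 K) ≤ 2 * Fintype.card (InfinitePlace K) := by
    have e1 := finrank_V2 K
    have e2 := card_places (K := K)
    have e3 := card_real_emb (K := K)
    have e4 : Nat.card {w : InfinitePlace K // w.IsReal} + Nat.card {w : InfinitePlace K // w.IsComplex} =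
        Fintype.card (InfinitePlace K) := by
      classical
      rw [InfinitePlace.card_eq_nrRealPlaces_add_nrComplexPlaces, Nat.card_eq_fintype_card, Nat.card_eq_fintype_card]
    rw [hA]; omega
  have hW : ∀ x ∈ WW K, ∀ y ∈ WW K, dotA K x.1 y.1 + b x.2 y.2 = 0 := by
    rintro _ ⟨z, hz⟩ _ ⟨w, hw⟩
    rw [← Multiplicative.ofAdd.injective hz, ← Multiplicative.ofAdd.injective hw]
    exact isotropic d hd b hb z w
  obtain ⟨hνρ, hdim⟩ := lagrangian (dotA K) b (dotA_symm K) sB (dotA_nd K) (WW K) hW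
    (Fintype.card (InfinitePlace K)) ρ ν hSR.2 hlow h3
  constructor
  · have e1 : (ZZ ⊓ adicSquareClass K).subgroupOf ZZ = ST K ((⊤ : Submodule F2 VA).prod ⊥) := by
      ext z
      rw [mem_ST, Subgroup.mem_subgroupOf, Subgroup.mem_inf, mem_adic, Submodule.mem_prod, Submodule.mem_bot]
      exact ⟨fun h => ⟨Submodule.mem_top, h.2⟩, fun h => ⟨z.2, h.2⟩⟩
    rw [← Subgroup.relIndex_subgroupOf (inf_le_left : ZZ ⊓ adicSquareClass K ≤ ZZ), e1, relIndex_ST, ← hν, hνρ]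
    have hmap : Nat.card ((ZZ).map (SG K)) =
        2 ^ Module.finrank F2 ((WW K).map (LinearMap.fst F2 VA (V2 K))) := by
      have h1 := Module.natCard_eq_pow_finrank (K := ZMod 2) (V := ((WW K).map (LinearMap.fst F2 VA (V2 K))))
      rw [Nat.card_zmod] at h1
      rw [← h1]
      refine Nat.card_congr (Multiplicative.toAdd.subtypeEquiv fun x => ?_)
      constructor
      · rintro ⟨z, hz, rfl⟩
        exact ⟨(sgnv z, gcl ⟨z, hz⟩), ⟨⟨z, hz⟩, rfl⟩, rfl⟩
      · rintro ⟨y, ⟨z, hz⟩, hy⟩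
        refine ⟨z, z.2, ?_⟩
        rw [← Multiplicative.ofAdd.injective hz] at hy
        exact hy
    have hn := narrow_card K
    rw [hρplus, hmap, hρ, ← hA, ← hdim, pow_add, ← mul_assoc] at hn
    exact (Nat.eq_of_mul_eq_mul_right (by positivity) hn).symm
  · have hle : ZZ ⊓ adicSquareClass K ⊓ posModSquares K ≤ ZZ := inf_le_left.trans inf_le_left
    have e1 : (ZZ ⊓ adicSquareClass K ⊓ posModSquares K).subgroupOf ZZ = (FF (K := K)).ker := by
      ext z
      rw [Subgroup.mem_subgroupOf, Subgroup.mem_inf, Subgroup.mem_inf, mem_adic, mem_pos, MonoidHom.mem_ker]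
      constructor
      · rintro ⟨⟨-, h1⟩, h2⟩
        change Multiplicative.ofAdd (sgnv (z : Kˣ), gcl z) = 1
        rw [h1, h2]; rfl
      · intro h
        have h' : (sgnv (z : Kˣ), gcl z) = 0 := Multiplicative.ofAdd.injective h
        rw [Prod.mk_eq_zero] at h'
        exact ⟨⟨z.2, h'.2⟩, h'.1⟩
    rw [← Subgroup.relIndex_subgroupOf hle, e1, ← hν, hνρ]
end
end Recip

end

/-- Let `K` be a number field with `r₁ > 0` real places and `r₂` complex places.  Let
`S₂ ⊆ Sel₂(K)` be the subgroup of classes `z·Kˣ²` such that `z` is, up to a square in `Kˣ`,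
a unit above `2` that is congruent to a square modulo `4`.  Then `dim_{𝔽₂} S₂ = ρ⁺`.
Moreover, the subgroup of `S₂` of classes that in addition admit a totally positive
representative has `𝔽₂`-dimension `ρ`, where `ρ = rk₂(C_K)` and `ρ⁺ = rk₂(C_K⁺)`. -/
theorem two_adic_selmer_subgroup_card (r₁ r₂ ρ ρplus : ℕ)
    (hr₁ : Nat.card {w : InfinitePlace K // w.IsReal} = r₁)
    (hr₂ : Nat.card {w : InfinitePlace K // w.IsComplex} = r₂)
    (hr₁pos : 0 < r₁)
    (hρ : Nat.card {c : ClassGroup (𝓞 K) // c ^ 2 = 1} = 2 ^ ρ)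
    (hρplus : Nat.card {c : NarrowClassGroup K // c ^ 2 = 1} = 2 ^ ρplus) :
    Nat.card ((singularSubgroup K ⊓ adicSquareClass K : Subgroup Kˣ) ⧸
        (squaresSubgroup K).subgroupOf (singularSubgroup K ⊓ adicSquareClass K)) =
      2 ^ ρplus ∧
    Nat.card ((singularSubgroup K ⊓ adicSquareClass K ⊓ posModSquares K : Subgroup Kˣ) ⧸
        (squaresSubgroup K).subgroupOf
          (singularSubgroup K ⊓ adicSquareClass K ⊓ posModSquares K)) =
      2 ^ ρ := by
  exact Recip.main K ρ ρplus hρ hρplus
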